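/- Let n ≥ 3 and 2 ≤ i ≤ n−1, and let Φ_i : 𝒦ⁿ → 𝒦ⁿ be a continuous translation invariant Minkowski valuation of degree i commuting with SO(n) whose generating function is the support function h_L of a convex body of revolution L, normalized so that a₀ⁿ[L] = 1, and suppose that: (a) T_L f ∈ C²(𝕊^{n−1}) whenever f ∈ C(𝕊^{n−1}); (b) for all k ≥ 2, (k−1)(k+n−1)|a_kⁿ[L]| < (n−1)/i; (c) there exists β > 0 such that for all α ≥ 0 there is a constant C > 0 with ‖∇²_{jl} T_L f‖_{𝒰_{α+β}} ≤ C‖f‖_{𝒰_α} for all f ∈ 𝒰_α and all j,l ∈ {1,…,n}. Then there exists ε > 0 such that if K ∈ 𝒦ⁿ has absolutely continuous area measure of order i with continuous density s_i(K,·) satisfying ‖1 − s_i(γK,·)‖_∞ < ε for some γ > 0, then there exists a sequence of positive numbers (γ_m)_{m=1}^∞ such that d_TV(S_i(γ_m Φ_i^m K, ·), σ_{n−1}) → 0 as m → ∞, where σ_{n−1} is spherical Lebesgue measure on 𝕊^{n−1}. -/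

import Mathlib

open scoped InnerProductSpace Pointwise
open MeasureTheory Metric Filter Topology

noncomputable section

/-- Euclidean space `ℝⁿ`. -/
abbrev En (n : ℕ) := EuclideanSpace ℝ (Fin n)

namespace MinkIter

variable {n : ℕ}

/-- The unit sphere `𝕊^{n-1}` as a subtype. -/
abbrev Sph (n : ℕ) := Metric.sphere (0 : En n) 1

/-- Spherical Lebesgue measure on `𝕊^{n-1}`. -/
def sphVol (n : ℕ) : Measure (Sph n) := (volume : Measure (En n)).toSphere

/-- A fixed pole `ē ∈ 𝕊^{n-1}`. -/
def pole (n : ℕ) : En n :=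
  if h : 0 < n then EuclideanSpace.single (⟨0, h⟩ : Fin n) 1 else 0

/-- The support function of a convex body, as a function on all of `ℝⁿ`. -/
def supp (K : ConvexBody (En n)) (x : En n) : ℝ :=
  sSup ((fun y => ⟪x, y⟫_ℝ) '' (K : Set (En n)))

/-- The Euclidean unit ball `𝔹ⁿ` as a convex body. -/
def ballB (n : ℕ) : ConvexBody (En n) :=
  ⟨closedBall 0 1, convex_closedBall 0 1, isCompact_closedBall 0 1, ⟨0, by simp⟩⟩

/-- The dilate `c • K` of a convex body. -/
def scale (c : ℝ) (K : ConvexBody (En n)) : ConvexBody (En n) :=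
  ⟨c • (K : Set (En n)), K.convex.smul c, K.isCompact.smul c, K.nonempty.smul_set⟩

/-- The translate `K + x` of a convex body. -/
def translate (K : ConvexBody (En n)) (x : En n) : ConvexBody (En n) :=
  ⟨(fun y => x + y) '' (K : Set (En n)), K.convex.translate x,
    K.isCompact.image (continuous_add_left x), K.nonempty.image _⟩

/-- A linear isometry of `ℝⁿ` is a rotation (element of `SO(n)`) if it preserves
orientation. -/
def IsRotation (ρ : En n ≃ₗᵢ[ℝ] En n) : Prop :=
  0 < LinearMap.det (ρ.toLinearEquiv.toLinearMap)

/-- The image `ρ K` of a convex body under a linear isometry. -/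
def rotate (ρ : En n ≃ₗᵢ[ℝ] En n) (K : ConvexBody (En n)) : ConvexBody (En n) :=
  ⟨ρ '' (K : Set (En n)), K.convex.linear_image ρ.toLinearEquiv.toLinearMap,
    K.isCompact.image ρ.continuous, K.nonempty.image _⟩

/-- `Φ` is a Minkowski valuation: `ΦK + ΦL = Φ(K ∪ L) + Φ(K ∩ L)` whenever `K ∪ L`
is convex (Minkowski addition on the left). -/
def IsMinkowskiValuation (Φ : ConvexBody (En n) → ConvexBody (En n)) : Prop :=
  ∀ (K L : ConvexBody (En n)) (hu : Convex ℝ ((K : Set (En n)) ∪ (L : Set (En n))))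
    (hi : ((K : Set (En n)) ∩ (L : Set (En n))).Nonempty),
    Φ K + Φ L =
      Φ ⟨(K : Set (En n)) ∪ (L : Set (En n)), hu, K.isCompact.union L.isCompact,
          K.nonempty.inl⟩ +
      Φ ⟨(K : Set (En n)) ∩ (L : Set (En n)), K.convex.inter L.convex,
          K.isCompact.inter_right L.isCompact.isClosed, hi⟩

/-- `Φ` is translation invariant. -/
def TranslationInvariant (Φ : ConvexBody (En n) → ConvexBody (En n)) : Prop :=
  ∀ (K : ConvexBody (En n)) (x : En n), Φ (translate K x) = Φ K

/-- `Φ` is (positively) homogeneous of degree `i`. -/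
def HasDegree (i : ℕ) (Φ : ConvexBody (En n) → ConvexBody (En n)) : Prop :=
  ∀ (K : ConvexBody (En n)) (c : ℝ), 0 ≤ c → Φ (scale c K) = scale (c ^ i) (Φ K)

/-- `Φ` commutes with `SO(n)`. -/
def RotationEquivariant (Φ : ConvexBody (En n) → ConvexBody (En n)) : Prop :=
  ∀ ρ : En n ≃ₗᵢ[ℝ] En n, IsRotation ρ → ∀ K, Φ (rotate ρ K) = rotate ρ (Φ K)

/-- `Φ` is even: `Φ(-K) = ΦK`. -/
def IsEven (Φ : ConvexBody (En n) → ConvexBody (En n)) : Prop :=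
  ∀ K, Φ (scale (-1) K) = Φ K

/-- `Φ` is monotone w.r.t. set inclusion. -/
def MonotoneVal (Φ : ConvexBody (En n) → ConvexBody (En n)) : Prop :=
  ∀ K L : ConvexBody (En n), (K : Set (En n)) ⊆ (L : Set (En n)) →
    (Φ K : Set (En n)) ⊆ (Φ L : Set (En n))

/-- `Φ` is non-trivial: `ΦK ≠ {o}` for some `K`. -/
def NontrivialVal (Φ : ConvexBody (En n) → ConvexBody (En n)) : Prop :=
  ∃ K : ConvexBody (En n), (Φ K : Set (En n)) ≠ {0}

/-- The mixed volume `V(K₁,…,Kₙ)`, via polarization of the volume. -/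
def mixedVol (Ks : Fin n → ConvexBody (En n)) : ℝ :=
  ((n.factorial : ℝ))⁻¹ *
    ∑ S : Finset (Fin n), (-1 : ℝ) ^ (n - S.card) *
      (volume ((∑ k ∈ S, Ks k : ConvexBody (En n)) : Set (En n))).toReal

/-- `κ_m`, the volume of the `m`-dimensional unit ball. -/
def kappa (m : ℕ) : ℝ := (volume (closedBall (0 : En m) 1)).toReal

/-- `ω_m`, the surface area of the `m`-dimensional unit ball. -/
def omegaS (m : ℕ) : ℝ := m * kappa m

/-- The `j`-th intrinsic volume `V_j(K) = binom(n,j) V(K[j],𝔹ⁿ[n-j]) / κ_{n-j}`. -/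
def intrinsicVol (j : ℕ) (K : ConvexBody (En n)) : ℝ :=
  (n.choose j : ℝ) / kappa (n - j) *
    mixedVol (fun k : Fin n => if (k : ℕ) < j then K else ballB n)

/-- `μ` is the area measure of order `i` of `K`: for every convex body `L`,
`∫ h_L dμ = n V(L, K[i], 𝔹ⁿ[n-1-i])`. -/
def IsAreaMeasure (i : ℕ) (K : ConvexBody (En n)) (μ : Measure (Sph n)) : Prop :=
  ∀ L : ConvexBody (En n),
    (∫ v : Sph n, supp L (v : En n) ∂μ) =
      n * mixedVol (fun k : Fin n =>
        if (k : ℕ) = 0 then L else if (k : ℕ) ≤ i then K else ballB n)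

/-- `Φ` is generated by the zonal function with profile `g : [-1,1] → ℝ`, i.e.
`h_{ΦK} = S_i(K,·) ∗ g` where `∗` is the spherical convolution. -/
def GeneratedBy (i : ℕ) (Φ : ConvexBody (En n) → ConvexBody (En n)) (g : ℝ → ℝ) : Prop :=
  ∀ (K : ConvexBody (En n)) (μ : Measure (Sph n)), IsAreaMeasure i K μ →
    ∀ u : En n, ‖u‖ = 1 →
      supp (Φ K) u = ∫ v : Sph n, g ⟪u, (v : En n)⟫_ℝ ∂μ

/-- `L` is a body of revolution: invariant under all rotations fixing the pole. -/
def IsZonalBody (L : ConvexBody (En n)) : Prop :=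
  ∀ ρ : En n ≃ₗᵢ[ℝ] En n, IsRotation ρ → ρ (pole n) = pole n → rotate ρ L = L

/-- The quadratic form of the Hessian of `F` at `u` in direction `w`. -/
def hessQ (F : En n → ℝ) (u w : En n) : ℝ := iteratedFDeriv ℝ 2 F u ![w, w]

/-- `(j,l)` entry of the Hessian of `F` at `u`. -/
def hessE (F : En n → ℝ) (u : En n) (j l : Fin n) : ℝ :=
  iteratedFDeriv ℝ 2 F u ![EuclideanSpace.single j 1, EuclideanSpace.single l 1]

/-- A convex body is of class `C^k₊` if its support function is of class `C^k`
away from the origin and the restriction of its Hessian to `u^⊥` is positive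
definite for every unit vector `u`. -/
def IsCkPlus (k : ℕ∞) (L : ConvexBody (En n)) : Prop :=
  ContDiffOn ℝ k (supp L) {0}ᶜ ∧
    ∀ u : En n, ‖u‖ = 1 → ∀ w : En n, w ≠ 0 → ⟪u, w⟫_ℝ = 0 → 0 < hessQ (supp L) u w

/-- `Φ` is a `C^∞₊` regular Minkowski valuation of degree `i`: it is generated by
the support function of a body of revolution of class `C^∞₊`. -/
def CInfRegular (i : ℕ) (Φ : ConvexBody (En n) → ConvexBody (En n)) : Prop :=
  ∃ (L : ConvexBody (En n)) (g : ℝ → ℝ), IsZonalBody L ∧ IsCkPlus ⊤ L ∧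
    (∀ u : En n, ‖u‖ = 1 → supp L u = g ⟪u, pole n⟫_ℝ) ∧ GeneratedBy i Φ g

/-- The `C²(𝕊^{n-1})` distance of two functions. -/
def C2dist (F G : En n → ℝ) : ℝ :=
  ⨆ u : Sph n, (|F (u : En n) - G (u : En n)| +
    ‖fderiv ℝ F (u : En n) - fderiv ℝ G (u : En n)‖ +
    ‖iteratedFDeriv ℝ 2 F (u : En n) - iteratedFDeriv ℝ 2 G (u : En n)‖)

/-- The Legendre polynomial of dimension `d` and degree `k` (Rodrigues formula). -/
def legendreP (d k : ℕ) (t : ℝ) : ℝ :=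
  (-1 : ℝ) ^ k *
    (Real.Gamma (((d : ℝ) - 1) / 2) / (2 ^ k * Real.Gamma (((d : ℝ) - 1) / 2 + k))) *
    (1 - t ^ 2) ^ (-(((d : ℝ) - 3) / 2)) *
    iteratedDeriv k (fun s : ℝ => (1 - s ^ 2) ^ ((((d : ℝ) - 3) / 2) + (k : ℝ))) t

/-- The multiplier `a_k^d[h]` of a zonal function with profile `h : [-1,1] → ℝ`. -/
def multInt (d k : ℕ) (h : ℝ → ℝ) : ℝ :=
  omegaS (d - 1) *
    ∫ t in (-1 : ℝ)..1, legendreP d k t * h t * (1 - t ^ 2) ^ (((d : ℝ) - 3) / 2)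

/-- The multiplier `a_k^n[f] = ∫_{𝕊^{n-1}} f(u) P_k^n(ē·u) du` of a zonal function
`f` on the sphere. -/
def multSph (k : ℕ) (f : En n → ℝ) : ℝ :=
  ∫ u : Sph n, f (u : En n) * legendreP n k ⟪pole n, (u : En n)⟫_ℝ ∂(sphVol n)

/-- The projection `π₀ f` of `f` onto the constants (its mean value). -/
def proj0 (f : En n → ℝ) : ℝ :=
  (omegaS n)⁻¹ * ∫ u : Sph n, f (u : En n) ∂(sphVol n)

/-- The `L²(𝕊^{n-1})` norm. -/
def sphL2 (f : En n → ℝ) : ℝ :=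
  Real.sqrt (∫ u : Sph n, (f (u : En n)) ^ 2 ∂(sphVol n))

/-- The sup norm on the sphere. -/
def supSph (f : En n → ℝ) : ℝ := ⨆ u : Sph n, |f (u : En n)|

/-- `M ∈ UBounds α f` iff `M` witnesses `‖f‖_{𝒰_α} ≤ M`: `‖f‖_∞ ≤ M` and for every
`k ≥ 1` there is a polynomial of degree at most `k` with `‖f - p_k‖_{L²} ≤ M k^{-α}`. -/
def UBounds (α : ℝ) (f : En n → ℝ) : Set ℝ :=
  {M | (∀ u : En n, ‖u‖ = 1 → |f u| ≤ M) ∧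
    ∀ k : ℕ, 0 < k → ∃ p : MvPolynomial (Fin n) ℝ, p.totalDegree ≤ k ∧
      sphL2 (fun x => f x - MvPolynomial.eval (fun j => x j) p) ≤ M * (k : ℝ) ^ (-α)}

/-- `f ∈ 𝒰_α`. -/
def MemU (α : ℝ) (f : En n → ℝ) : Prop := (UBounds α f).Nonempty

/-- The norm `‖f‖_{𝒰_α}`. -/
def UNorm (α : ℝ) (f : En n → ℝ) : ℝ := sInf (UBounds α f)

/-- The convolution transform `T_g f` with zonal kernel of profile `g`, extended
1-homogeneously to `ℝⁿ`: `(T_g f)(u) = ∫_{𝕊^{n-1}} g(u·v) f(v) dv` for unit `u`. -/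
def Tg (g : ℝ → ℝ) (f : En n → ℝ) (x : En n) : ℝ :=
  ‖x‖ * ∫ v : Sph n, g ⟪‖x‖⁻¹ • x, (v : En n)⟫_ℝ * f (v : En n) ∂(sphVol n)

/-- The 0-homogeneous extension of a function on the sphere. -/
def zeroExt (f : En n → ℝ) (x : En n) : ℝ := f (‖x‖⁻¹ • x)

/-- The spherical Laplacian `Δ_𝕊 f`, i.e. the Euclidean Laplacian of the
0-homogeneous extension. -/
def sphLap (f : En n → ℝ) (u : En n) : ℝ := ∑ j : Fin n, hessE (zeroExt f) u j j

/-- The operator `□_n f = f + Δ_𝕊 f /(n-1)`. -/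
def boxN (f : En n → ℝ) (u : En n) : ℝ := f u + ((n : ℝ) - 1)⁻¹ * sphLap f u

/-- The mixed discriminant of `m` symmetric `m × m` matrices, via polarization of
the determinant. -/
def mixedDisc {m : ℕ} (A : Fin m → Matrix (Fin m) (Fin m) ℝ) : ℝ :=
  ((m.factorial : ℝ))⁻¹ *
    ∑ S : Finset (Fin m), (-1 : ℝ) ^ (m - S.card) * (∑ k ∈ S, A k).det

/-- The rank one matrix `u ⊗ u`. -/
def outer (u : En n) : Matrix (Fin n) (Fin n) ℝ := Matrix.of fun j l => u j * u l

/-- The matrix of the orthogonal projection onto `u^⊥`. -/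
def projMat (u : En n) : Matrix (Fin n) (Fin n) ℝ := 1 - outer u

/-- The Hessian matrix of `F` at `u`. -/
def hessMat (F : En n → ℝ) (u : En n) : Matrix (Fin n) (Fin n) ℝ :=
  Matrix.of fun j l => hessE F u j l

/-- The mixed discriminant `D_{n-1}(B₁|_{u^⊥},…,B_{n-1}|_{u^⊥})` of the restrictions
to `u^⊥` of matrices annihilating `u`, computed via the identity
`D_{n-1}(B₁|_{u^⊥},…) = n · D_n(u ⊗ u, B₁,…,B_{n-1})`. -/
def restrDisc (u : En n) (B : Fin (n - 1) → Matrix (Fin n) (Fin n) ℝ) : ℝ :=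
  n * mixedDisc (fun k : Fin n =>
    if h : (k : ℕ) = 0 then outer u else B ⟨(k : ℕ) - 1, by have := k.isLt; omega⟩)

/-- Total variation distance between two Borel measures on the sphere. -/
def dTV (μ ν : Measure (Sph n)) : ℝ :=
  ⨆ A : {A : Set (Sph n) // MeasurableSet A}, |(μ A).toReal - (ν A).toReal|

/-- Lévy–Prokhorov distance between two Borel measures on the sphere. -/
def dLP (μ ν : Measure (Sph n)) : ℝ :=
  sInf {ε : ℝ | 0 < ε ∧ ∀ A : Set (Sph n), MeasurableSet A →
    μ A ≤ ν (Metric.thickening ε A) + ENNReal.ofReal ε ∧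
    ν A ≤ μ (Metric.thickening ε A) + ENNReal.ofReal ε}

/-- Two convex bodies are homothetic: one is a translate of a positive dilate of
the other. -/
def Homothetic (K L : ConvexBody (En n)) : Prop :=
  ∃ (c : ℝ) (x : En n), 0 < c ∧ (L : Set (En n)) = x +ᵥ c • (K : Set (En n))

/-- The dimension of a convex body (dimension of its affine hull). -/
def bodyDim (K : ConvexBody (En n)) : ℕ :=
  Module.finrank ℝ (vectorSpan ℝ (K : Set (En n)))

/-- `K` is a Euclidean ball. -/
def IsBall (K : ConvexBody (En n)) : Prop :=
  ∃ (c : En n) (r : ℝ), 0 < r ∧ (K : Set (En n)) = closedBall c r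

/-- The mean width `w(K) = (2/ω_n) ∫_{𝕊^{n-1}} h_K`. -/
def meanWidth (K : ConvexBody (En n)) : ℝ :=
  2 / omegaS n * ∫ u : Sph n, supp K (u : En n) ∂(sphVol n)

/-- `N(n,k)`, the dimension of the space of spherical harmonics of dimension `n`
and degree `k`. -/
def Nnk (n k : ℕ) : ℝ :=
  (((n : ℝ) + 2 * k - 2) / ((n : ℝ) + k - 2)) * (Nat.choose (n + k - 2) (n - 2) : ℝ)

section

/-- Alternating sum over the supersets of a fixed set. -/
theorem sum_neg_one_pow_superset {R : Type*} [CommRing R] {m : ℕ} (S : Finset (Fin m)) :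
    ∑ T : Finset (Fin m), (-1 : R) ^ (m - T.card) * (if S ⊆ T then 1 else 0) =
      if S = Finset.univ then 1 else 0 := by
  have h := Finset.prod_add (fun _ : Fin m => (1 : R)) (fun k => if k ∈ S then 0 else -1)
    Finset.univ
  have h2 : ∏ k : Fin m, ((1 : R) + if k ∈ S then 0 else -1) =
      if S = Finset.univ then 1 else 0 := by
    split_ifs with hS
    · subst hS; simp
    · obtain ⟨k, hk⟩ : ∃ k, k ∉ S := by
        by_contra! hh; exact hS (Finset.eq_univ_iff_forall.2 hh)
      exact Finset.prod_eq_zero (Finset.mem_univ k) (by simp [hk])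
  rw [← h2, h, Finset.powerset_univ]
  refine Finset.sum_congr rfl fun T _ => ?_
  rw [Finset.prod_const_one, one_mul]
  split_ifs with hT
  · rw [mul_one, Finset.prod_congr rfl (g := fun _ => (-1 : R)), Finset.prod_const]
    · rw [← Finset.compl_eq_univ_sdiff, Finset.card_compl, Fintype.card_fin]
    · intro k hk
      rw [if_neg]
      exact fun hkS => (Finset.mem_sdiff.1 hk).2 (hT hkS)
  · obtain ⟨k, hkS, hkT⟩ := Finset.not_subset.1 hT
    rw [mul_zero]
    exact (Finset.prod_eq_zero (Finset.mem_sdiff.2 ⟨Finset.mem_univ k, hkT⟩) (by simp [hkS])).symm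

/-- Ryser's formula for the permanent, with additional constant terms. -/
theorem ryser {R : Type*} [CommRing R] {m : ℕ} (c : Fin m → R) (a : Fin m → Fin m → R) :
    ∑ T : Finset (Fin m), (-1 : R) ^ (m - T.card) * ∏ j, (c j + ∑ k ∈ T, a j k) =
      ∑ σ : Equiv.Perm (Fin m), ∏ j, a j (σ j) := by
  classical
  let a' : Fin m → Option (Fin m) → R := fun j o => o.elim (c j) (a j)
  let img : (Fin m → Option (Fin m)) → Finset (Fin m) := fun p =>
    Finset.univ.filter fun k => ∃ j, p j = some k
  have h1 : ∀ T : Finset (Fin m), ∏ j, (c j + ∑ k ∈ T, a j k) =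
      ∑ p : Fin m → Option (Fin m), (∏ j, a' j (p j)) * (if img p ⊆ T then 1 else 0) := by
    intro T
    have e : ∀ j, c j + ∑ k ∈ T, a j k =
        ∑ o : Option (Fin m), a' j o * (if ∀ k, o = some k → k ∈ T then 1 else 0) := by
      intro j
      rw [Fintype.sum_option]
      simp [a', Finset.sum_ite_mem]
    rw [Finset.prod_congr rfl fun j _ => e j, Finset.prod_univ_sum]
    rw [Fintype.piFinset_univ]
    refine Finset.sum_congr rfl fun p _ => ?_
    rw [Finset.prod_mul_distrib]
    congr 1
    rw [Finset.prod_ite_zero]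
    have : (∀ i ∈ Finset.univ, ∀ k, p i = some k → k ∈ T) ↔ img p ⊆ T := by
      constructor
      · intro h k hk
        obtain ⟨j, hj⟩ := (Finset.mem_filter.1 hk).2
        exact h j (Finset.mem_univ _) k hj
      · intro h j _ k hk
        exact h (Finset.mem_filter.2 ⟨Finset.mem_univ _, j, hk⟩)
    simp only [this, Finset.prod_const_one]
  simp_rw [h1, Finset.mul_sum]
  rw [Finset.sum_comm]
  have h2 : ∀ p : Fin m → Option (Fin m),
      ∑ T : Finset (Fin m), (-1 : R) ^ (m - T.card) *
        ((∏ j, a' j (p j)) * (if img p ⊆ T then 1 else 0)) =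
      (∏ j, a' j (p j)) * (if img p = Finset.univ then 1 else 0) := by
    intro p
    rw [← sum_neg_one_pow_superset, Finset.mul_sum]
    exact Finset.sum_congr rfl fun T _ => by ring
  simp_rw [h2, mul_ite, mul_one, mul_zero]
  rw [← Finset.sum_filter]
  symm
  refine Finset.sum_bij (fun σ _ => fun j => some (σ j)) ?_ ?_ ?_ ?_
  · intro σ _
    refine Finset.mem_filter.2 ⟨Finset.mem_univ _, Finset.eq_univ_iff_forall.2 fun k => ?_⟩
    exact Finset.mem_filter.2 ⟨Finset.mem_univ _, σ.symm k, by simp⟩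
  · intro σ _ τ _ h
    ext j
    have := congrFun h j
    simpa using congrArg (Option.map Fin.val) this
  · intro p hp
    have hp' := (Finset.mem_filter.1 hp).2
    have hs : ∀ k, ∃ j, p j = some k := fun k =>
      (Finset.mem_filter.1 (Finset.eq_univ_iff_forall.1 hp' k)).2
    choose f hf using hs
    have finj : Function.Injective f := fun x y hxy => by
      have := hf x; rw [hxy, hf y] at this; exact (Option.some.inj this).symm
    have fbij : Function.Bijective f := Finite.injective_iff_bijective.1 finj
    refine ⟨(Equiv.ofBijective f fbij).symm, Finset.mem_univ _, ?_⟩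
    funext j
    have := hf ((Equiv.ofBijective f fbij).symm j)
    rw [← this]
    congr 1
    exact Equiv.apply_symm_apply (Equiv.ofBijective f fbij) j
  · intro σ _
    rfl

/-- Polarization of the determinant. -/
theorem det_polarization {R : Type*} [CommRing R] {m : ℕ} (C : Matrix (Fin m) (Fin m) R)
    (A : Fin m → Matrix (Fin m) (Fin m) R) :
    ∑ T : Finset (Fin m), (-1 : R) ^ (m - T.card) * (C + ∑ k ∈ T, A k).det =
      ∑ τ : Equiv.Perm (Fin m), (Matrix.of fun j l => A (τ j) j l).det := by
  have h : ∀ T : Finset (Fin m), (C + ∑ k ∈ T, A k).det =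
      ∑ σ : Equiv.Perm (Fin m), ((Equiv.Perm.sign σ : ℤ) : R) *
        ∏ j, (C (σ j) j + ∑ k ∈ T, A k (σ j) j) := by
    intro T
    rw [Matrix.det_apply']
    simp [Matrix.add_apply, Matrix.sum_apply]
  simp_rw [h, Finset.mul_sum]
  rw [Finset.sum_comm]
  have h2 : ∀ σ : Equiv.Perm (Fin m), ∑ T : Finset (Fin m), (-1 : R) ^ (m - T.card) *
      (((Equiv.Perm.sign σ : ℤ) : R) * ∏ j, (C (σ j) j + ∑ k ∈ T, A k (σ j) j)) =
      ∑ τ : Equiv.Perm (Fin m), ((Equiv.Perm.sign σ : ℤ) : R) * ∏ j, A (τ (σ j)) (σ j) j := by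
    intro σ
    have := ryser (fun j => C (σ j) j) (fun j k => A k (σ j) j)
    rw [← Finset.mul_sum]
    rw [Fintype.sum_equiv (Equiv.mulRight σ) (fun τ : Equiv.Perm (Fin m) =>
      ∏ j, A (τ (σ j)) (σ j) j) (fun τ => ∏ j, A (τ j) (σ j) j) (fun τ => rfl), ← this,
      Finset.mul_sum]
    exact Finset.sum_congr rfl fun T _ => by ring
  simp_rw [h2]
  rw [Finset.sum_comm]
  refine Finset.sum_congr rfl fun τ _ => ?_
  rw [Matrix.det_apply']
  rfl

end

section

/-- The mixed discriminant of `i` copies of `H` and `m - i` copies of the identity. -/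
def mixDet {m : ℕ} (i : ℕ) (H : Matrix (Fin m) (Fin m) ℝ) : ℝ :=
  ((m.factorial : ℝ))⁻¹ * ∑ T : Finset (Fin m), (-1 : ℝ) ^ (m - T.card) *
    (∑ k ∈ T, if (k : ℕ) < i then H else 1).det

theorem mixDet_eq_sum_perm {m : ℕ} (i : ℕ) (H : Matrix (Fin m) (Fin m) ℝ) :
    mixDet i H = ((m.factorial : ℝ))⁻¹ * ∑ τ : Equiv.Perm (Fin m),
      (Matrix.of fun j l => if (τ j : ℕ) < i then H j l else (1 : Matrix _ _ ℝ) j l).det := by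
  rw [mixDet]
  congr 1
  have := det_polarization (0 : Matrix (Fin m) (Fin m) ℝ)
    (fun k : Fin m => if (k : ℕ) < i then H else 1)
  simp only [zero_add] at this
  rw [this]
  refine Finset.sum_congr rfl fun τ _ => ?_
  congr 1
  ext j l
  simp only [Matrix.of_apply]
  split_ifs <;> rfl

theorem mixDet_eq_sum_const {m : ℕ} (i : ℕ) (C H : Matrix (Fin m) (Fin m) ℝ) :
    mixDet i H = ((m.factorial : ℝ))⁻¹ * ∑ T : Finset (Fin m), (-1 : ℝ) ^ (m - T.card) *
      (C + ∑ k ∈ T, if (k : ℕ) < i then H else 1).det := by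
  have h1 := det_polarization (0 : Matrix (Fin m) (Fin m) ℝ)
    (fun k : Fin m => if (k : ℕ) < i then H else 1)
  have h2 := det_polarization C (fun k : Fin m => if (k : ℕ) < i then H else 1)
  simp only [zero_add] at h1
  rw [mixDet, h2, h1]

theorem card_perm_lt {m i : ℕ} (hi : i ≤ m) (τ : Equiv.Perm (Fin m)) :
    (Finset.univ.filter fun j : Fin m => (τ j : ℕ) < i).card = i := by
  have h : (Finset.univ.filter fun j : Fin m => (τ j : ℕ) < i) =
      (Finset.univ.filter fun j : Fin m => (j : ℕ) < i).map τ.symm.toEmbedding := by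
    ext j; simp
  rw [h, Finset.card_map]
  rw [Fin.card_filter_val_lt]
  omega

theorem mixDet_smul {m i : ℕ} (hi : i ≤ m) (c : ℝ) (H : Matrix (Fin m) (Fin m) ℝ) :
    mixDet i (c • H) = c ^ i * mixDet i H := by
  rw [mixDet_eq_sum_perm, mixDet_eq_sum_perm, mul_left_comm]
  congr 1
  rw [Finset.mul_sum]
  refine Finset.sum_congr rfl fun τ _ => ?_
  have := Matrix.det_mul_column (fun j : Fin m => if (τ j : ℕ) < i then c else 1)
    (Matrix.of fun j l => if (τ j : ℕ) < i then H j l else (1 : Matrix _ _ ℝ) j l)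
  have hp : ∏ j : Fin m, (if (τ j : ℕ) < i then c else 1) = c ^ i := by
    rw [Finset.prod_ite, Finset.prod_const, Finset.prod_const_one, mul_one, card_perm_lt hi]
  rw [hp] at this
  rw [← this]
  congr 1
  ext j l
  simp only [Matrix.of_apply, Matrix.smul_apply, smul_eq_mul]
  split_ifs <;> simp

theorem abs_prod_one_add_sub_le {ι : Type*} [DecidableEq ι] (s : Finset ι) :
    ∃ C : ℝ, 0 ≤ C ∧ ∀ (x : ι → ℝ) (η : ℝ), η ≤ 1 → (∀ j, |x j| ≤ η) →
      |∏ j ∈ s, (1 + x j) - 1 - ∑ j ∈ s, x j| ≤ C * η ^ 2 := by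
  induction s using Finset.induction_on with
  | empty => exact ⟨0, le_rfl, fun x η _ _ => by simp⟩
  | insert a s ha ih =>
    obtain ⟨C, hC, h⟩ := ih
    refine ⟨C + (s.card + C), by positivity, fun x η hη hx => ?_⟩
    have h0 : 0 ≤ η := (abs_nonneg _).trans (hx a)
    have h1 := h x η hη hx
    rw [Finset.prod_insert ha, Finset.sum_insert ha]
    set P := ∏ j ∈ s, (1 + x j)
    set S := ∑ j ∈ s, x j
    have hS : |S| ≤ s.card * η := by
      refine (Finset.abs_sum_le_sum_abs _ _).trans ?_
      refine (Finset.sum_le_card_nsmul _ _ η fun j _ => hx j).trans (by simp)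
    have hP : |P - 1| ≤ (s.card + C) * η := by
      have : P - 1 = (P - 1 - S) + S := by ring
      rw [this]
      refine (abs_add_le _ _).trans ?_
      nlinarith [mul_nonneg hC h0]
    have : (1 + x a) * P - 1 - (x a + S) = (P - 1 - S) + x a * (P - 1) := by ring
    rw [this]
    refine (abs_add_le _ _).trans ?_
    have h3 : |x a * (P - 1)| ≤ η * ((s.card + C) * η) := by
      rw [abs_mul]; exact mul_le_mul (hx a) hP (abs_nonneg _) h0
    nlinarith

theorem abs_det_one_add_sub_le (m : ℕ) :
    ∃ C : ℝ, 0 ≤ C ∧ ∀ (G : Matrix (Fin m) (Fin m) ℝ) (η : ℝ), η ≤ 1 → (∀ j l, |G j l| ≤ η) →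
      |(1 + G).det - 1 - G.trace| ≤ C * η ^ 2 := by
  obtain ⟨C, hC, h⟩ := abs_prod_one_add_sub_le (Finset.univ : Finset (Fin m))
  refine ⟨C + (Fintype.card (Equiv.Perm (Fin m))) * 2 ^ m, by positivity, fun G η hη hG => ?_⟩
  rcases Nat.eq_zero_or_pos m with hm | hm
  · subst hm
    simp [Matrix.trace]; positivity
  have h0 : 0 ≤ η := (abs_nonneg _).trans (hG ⟨0, hm⟩ ⟨0, hm⟩)
  rw [Matrix.det_apply', ← Finset.add_sum_erase _ _ (Finset.mem_univ (1 : Equiv.Perm (Fin m)))]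
  have h1 := h (fun j => G j j) η hη (fun j => hG j j)
  have e1 : ((Equiv.Perm.sign (1 : Equiv.Perm (Fin m)) : ℤ) : ℝ) *
      ∏ j, (1 + G) ((1 : Equiv.Perm (Fin m)) j) j = ∏ j, (1 + G j j) := by
    simp
  rw [e1]
  have h2 : ∀ σ ∈ Finset.univ.erase (1 : Equiv.Perm (Fin m)),
      |((Equiv.Perm.sign σ : ℤ) : ℝ) * ∏ j, (1 + G) (σ j) j| ≤ 2 ^ m * η ^ 2 := by
    intro σ hσ
    have hσ1 : σ ≠ 1 := (Finset.mem_erase.1 hσ).1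
    obtain ⟨a, ha⟩ : ∃ a, σ a ≠ a := by
      by_contra! hh; exact hσ1 (Equiv.ext hh)
    have hb : σ (σ a) ≠ σ a := fun hh => ha (σ.injective hh)
    have hs : |((Equiv.Perm.sign σ : ℤ) : ℝ)| = 1 := by
      rcases Int.units_eq_one_or (Equiv.Perm.sign σ) with hh | hh <;> rw [hh] <;> simp
    have hle : ∀ p q, |(1 + G) p q| ≤ 2 := by
      intro p q
      rw [Matrix.add_apply]
      refine (abs_add_le _ _).trans ?_
      have : |(1 : Matrix (Fin m) (Fin m) ℝ) p q| ≤ 1 := by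
        rw [Matrix.one_apply]; split_ifs <;> simp
      linarith [hG p q]
    have hoff : ∀ j, σ j ≠ j → |(1 + G) (σ j) j| ≤ η := by
      intro j hj
      rw [Matrix.add_apply, Matrix.one_apply_ne hj, zero_add]; exact hG _ _
    rw [abs_mul, hs, one_mul, Finset.abs_prod]
    rw [← Finset.mul_prod_erase _ _ (Finset.mem_univ a),
      ← Finset.mul_prod_erase _ _ (Finset.mem_erase.2 ⟨ha, Finset.mem_univ (σ a)⟩), ← mul_assoc]
    have hrest : ∏ x ∈ (Finset.univ.erase a).erase (σ a), |(1 + G) (σ x) x| ≤ 2 ^ m := by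
      refine (Finset.prod_le_prod (fun _ _ => abs_nonneg _) fun x _ => hle _ _).trans ?_
      rw [Finset.prod_const]
      refine pow_le_pow_right₀ (by norm_num) ?_
      refine (Finset.card_le_univ _).trans (by simp)
    calc _ ≤ (η * η) * 2 ^ m := by
          refine mul_le_mul (mul_le_mul (hoff _ ha) (hoff _ hb) (abs_nonneg _) h0) hrest ?_ ?_
          · exact Finset.prod_nonneg fun _ _ => abs_nonneg _
          · positivity
      _ = _ := by ring
  have h3 : |∑ σ ∈ Finset.univ.erase (1 : Equiv.Perm (Fin m)),
      ((Equiv.Perm.sign σ : ℤ) : ℝ) * ∏ j, (1 + G) (σ j) j| ≤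
      (Fintype.card (Equiv.Perm (Fin m))) * (2 ^ m * η ^ 2) := by
    refine (Finset.abs_sum_le_sum_abs _ _).trans ?_
    refine (Finset.sum_le_card_nsmul _ _ _ h2).trans ?_
    rw [nsmul_eq_mul]
    refine mul_le_mul_of_nonneg_right ?_ (by positivity)
    exact_mod_cast Finset.card_le_univ _
  have e2 : G.trace = ∑ j, G j j := rfl
  rw [e2]
  have e3 : ∀ a b s : ℝ, a + b - 1 - s = (a - 1 - s) + b := fun a b s => by ring
  rw [e3]
  refine (abs_add_le _ _).trans ?_
  nlinarith

theorem sum_perm_lt {m i : ℕ} (hi : i ≤ m) (hm : 0 < m) (j : Fin m) :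
    ∑ τ : Equiv.Perm (Fin m), (if (τ j : ℕ) < i then (1 : ℝ) else 0) =
      (m.factorial : ℝ) * (i / m) := by
  have hind : ∀ j', ∑ τ : Equiv.Perm (Fin m), (if (τ j' : ℕ) < i then (1 : ℝ) else 0) =
      ∑ τ : Equiv.Perm (Fin m), (if (τ j : ℕ) < i then (1 : ℝ) else 0) := by
    intro j'
    refine Fintype.sum_equiv (Equiv.mulRight (Equiv.swap j j')) _ _ fun τ => ?_
    simp
  have hs : ∑ j' : Fin m, ∑ τ : Equiv.Perm (Fin m), (if (τ j' : ℕ) < i then (1 : ℝ) else 0) =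
      m.factorial * i := by
    rw [Finset.sum_comm]
    have : ∀ τ : Equiv.Perm (Fin m), ∑ j' : Fin m, (if (τ j' : ℕ) < i then (1 : ℝ) else 0) = i := by
      intro τ
      rw [Finset.sum_boole, card_perm_lt hi]
    rw [Finset.sum_congr rfl fun τ _ => this τ]
    simp [Fintype.card_perm]
  rw [Finset.sum_congr rfl fun j' _ => hind j'] at hs
  rw [Finset.sum_const, Finset.card_univ, Fintype.card_fin, nsmul_eq_mul] at hs
  have : (m : ℝ) ≠ 0 := by positivity
  field_simp
  linarith

/-- First order expansion of the mixed discriminant at the identity. -/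
theorem abs_mixDet_one_add_sub_le {m i : ℕ} (hi : i ≤ m) (hm : 0 < m) :
    ∃ C : ℝ, 0 ≤ C ∧ ∀ (E : Matrix (Fin m) (Fin m) ℝ) (η : ℝ), η ≤ 1 → (∀ j l, |E j l| ≤ η) →
      |mixDet i (1 + E) - 1 - i / m * E.trace| ≤ C * η ^ 2 := by
  obtain ⟨C, hC, h⟩ := abs_det_one_add_sub_le m
  refine ⟨C, hC, fun E η hη hE => ?_⟩
  have h0 : 0 ≤ η := (abs_nonneg _).trans (hE ⟨0, hm⟩ ⟨0, hm⟩)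
  have hf : (0 : ℝ) < m.factorial := by positivity
  let G : Equiv.Perm (Fin m) → Matrix (Fin m) (Fin m) ℝ := fun τ =>
    Matrix.of fun j l => if (τ j : ℕ) < i then E j l else 0
  have e1 : mixDet i (1 + E) = (m.factorial : ℝ)⁻¹ * ∑ τ : Equiv.Perm (Fin m), (1 + G τ).det := by
    rw [mixDet_eq_sum_perm]
    congr 1
    refine Finset.sum_congr rfl fun τ _ => ?_
    congr 1
    ext j l
    simp only [Matrix.of_apply, Matrix.add_apply, G]
    split_ifs <;> simp
  have e2 : i / m * E.trace = (m.factorial : ℝ)⁻¹ * ∑ τ : Equiv.Perm (Fin m), (G τ).trace := by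
    have : ∀ τ : Equiv.Perm (Fin m), (G τ).trace =
        ∑ j, (if (τ j : ℕ) < i then (1 : ℝ) else 0) * E j j := by
      intro τ
      simp [Matrix.trace, G]
    rw [Finset.sum_congr rfl fun τ _ => this τ, Finset.sum_comm]
    simp_rw [← Finset.sum_mul, sum_perm_lt hi hm, ← Finset.mul_sum]
    rw [← mul_assoc, ← mul_assoc, inv_mul_cancel₀ hf.ne', one_mul]
    rfl
  have e3 : (1 : ℝ) = (m.factorial : ℝ)⁻¹ * ∑ τ : Equiv.Perm (Fin m), (1 : ℝ) := by
    simp [Fintype.card_perm, hf.ne']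
  have e4 : mixDet i (1 + E) - 1 - i / m * E.trace = (m.factorial : ℝ)⁻¹ *
      ∑ τ : Equiv.Perm (Fin m), ((1 + G τ).det - 1 - (G τ).trace) := by
    rw [e1, e2, Finset.sum_sub_distrib, Finset.sum_sub_distrib, mul_sub, mul_sub, ← e3]
  rw [e4, abs_mul, abs_of_pos (inv_pos.2 hf)]
  have h5 : |∑ τ : Equiv.Perm (Fin m), ((1 + G τ).det - 1 - (G τ).trace)| ≤
      m.factorial * (C * η ^ 2) := by
    refine (Finset.abs_sum_le_sum_abs _ _).trans ?_
    refine (Finset.sum_le_card_nsmul _ _ (C * η ^ 2) fun τ _ => h (G τ) η hη fun j l => ?_).trans ?_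
    · simp only [G, Matrix.of_apply]
      split_ifs
      · exact hE j l
      · simpa using h0
    · simp [Fintype.card_perm]
  calc _ ≤ (m.factorial : ℝ)⁻¹ * (m.factorial * (C * η ^ 2)) := by gcongr
    _ = _ := by field_simp

end

section

open Polynomial in
/-- The polynomials `q_j` with `(d/dt)^j (1 - t²)^a = (1 - t²)^(a - j) q_j(t)`. -/
def rodriguesPoly (a : ℝ) : ℕ → Polynomial ℝ
  | 0 => 1
  | j + 1 => (1 - X ^ 2) * derivative (rodriguesPoly a j) -
      C (2 * (a - j)) * (X * rodriguesPoly a j)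

open Polynomial in
theorem derivative_rodriguesPoly (a : ℝ) (j : ℕ) :
    derivative (rodriguesPoly a (j + 1)) =
      C (-((j + 1 : ℝ) * (2 * a - j))) * rodriguesPoly a j := by
  induction j with
  | zero =>
    simp only [rodriguesPoly, derivative_one, mul_zero, zero_sub, mul_one, derivative_neg,
      derivative_mul, derivative_C, zero_mul, derivative_X, zero_add]
    simp
  | succ j ih =>
    rw [rodriguesPoly]
    have hq : (1 - X ^ 2) * derivative (rodriguesPoly a j) =
        rodriguesPoly a (j + 1) + C (2 * (a - j)) * (X * rodriguesPoly a j) := by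
      rw [rodriguesPoly]; ring
    simp only [derivative_sub, derivative_mul, derivative_C, derivative_X, derivative_one,
      derivative_X_pow]
    rw [ih]
    simp only [derivative_mul, derivative_C]
    have e : ∀ P Q : ℝ[X], (1 - X ^ 2) * (0 * Q + P * derivative (rodriguesPoly a j)) =
        P * ((1 - X ^ 2) * derivative (rodriguesPoly a j)) := fun P Q => by ring
    have h2 : (1 - X ^ 2) * (0 * rodriguesPoly a j +
        C (-((j + 1 : ℝ) * (2 * a - j))) * derivative (rodriguesPoly a j)) =
        C (-((j + 1 : ℝ) * (2 * a - j))) *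
          (rodriguesPoly a (j + 1) + C (2 * (a - j)) * (X * rodriguesPoly a j)) := by
      rw [e, hq]
    rw [h2]
    simp only [C_mul, C_neg, C_sub, C_add, Nat.cast_add, Nat.cast_one, C_1, Nat.cast_ofNat,
      map_natCast]
    simp only [map_ofNat, pow_one, Nat.add_one_sub_one]
    ring

open Polynomial in
theorem rodriguesPoly_ode (a : ℝ) (k : ℕ) :
    (1 - X ^ 2) * derivative (derivative (rodriguesPoly a k)) =
      C (2 * (a - k + 1)) * (X * derivative (rodriguesPoly a k)) -
        C ((k : ℝ) * (2 * a - k + 1)) * rodriguesPoly a k := by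
  cases k with
  | zero => simp [rodriguesPoly]
  | succ j =>
    have hq : (1 - X ^ 2) * derivative (rodriguesPoly a j) =
        rodriguesPoly a (j + 1) + C (2 * (a - j)) * (X * rodriguesPoly a j) := by
      rw [rodriguesPoly]; ring
    rw [derivative_rodriguesPoly, derivative_mul, derivative_C, zero_mul, zero_add,
      mul_left_comm, hq]
    simp only [C_mul, C_neg, C_sub, C_add, Nat.cast_add, Nat.cast_one, C_1, map_natCast]
    simp only [map_ofNat]
    ring

theorem rodriguesPoly_eval_one (a : ℝ) (k : ℕ) :
    (rodriguesPoly a k).eval 1 = (-2) ^ k * ∏ j ∈ Finset.range k, (a - j) := by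
  induction k with
  | zero => simp [rodriguesPoly]
  | succ j ih =>
    rw [rodriguesPoly, Finset.prod_range_succ]
    simp [ih]
    ring

theorem rodriguesPoly_natDegree (a : ℝ) (k : ℕ) (h : ∀ j < k, 2 * a - j ≠ 0) :
    (rodriguesPoly a k).natDegree = k := by
  induction k with
  | zero => simp [rodriguesPoly]
  | succ j ih =>
    have ih' := ih fun l hl => h l (by omega)
    have hd := derivative_rodriguesPoly a j
    have hc : (-((j + 1 : ℝ) * (2 * a - j))) ≠ 0 :=
      neg_ne_zero.2 (mul_ne_zero (by positivity) (h j (by omega)))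
    have h2 : (Polynomial.derivative (rodriguesPoly a (j + 1))).natDegree = j := by
      rw [hd, Polynomial.natDegree_C_mul hc, ih']
    have hle : (rodriguesPoly a (j + 1)).natDegree ≠ 0 := by
      intro h0
      have := Polynomial.derivative_of_natDegree_zero h0
      rw [hd] at this
      have hq0 : rodriguesPoly a j = 0 := by
        rcases mul_eq_zero.1 this with h' | h'
        · exact absurd (Polynomial.C_eq_zero.1 h') hc
        · exact h'
      have hcont : rodriguesPoly a j ≠ 0 := by
        clear * - h
        induction j with
        | zero => simp [rodriguesPoly]
        | succ l ihl =>
          intro h0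
          have hd := derivative_rodriguesPoly a l
          rw [h0, Polynomial.derivative_zero] at hd
          rcases mul_eq_zero.1 hd.symm with h' | h'
          · have := Polynomial.C_eq_zero.1 h'
            have hc : (-((l + 1 : ℝ) * (2 * a - l))) ≠ 0 :=
              neg_ne_zero.2 (mul_ne_zero (by positivity) (h l (by omega)))
            exact hc this
          · exact ihl (fun j hj => h j (by omega)) h'
      exact hcont hq0
    rw [Polynomial.natDegree_derivative] at h2
    omega

theorem iteratedDeriv_one_sub_sq_rpow (a : ℝ) (j : ℕ) {t : ℝ} (ht : t ∈ Set.Ioo (-1 : ℝ) 1) :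
    iteratedDeriv j (fun s : ℝ => (1 - s ^ 2) ^ a) t =
      (1 - t ^ 2) ^ (a - j) * (rodriguesPoly a j).eval t := by
  induction j generalizing t with
  | zero => simp [rodriguesPoly]
  | succ j ih =>
    have hpos : 0 < 1 - t ^ 2 := by nlinarith [ht.1, ht.2]
    rw [iteratedDeriv_succ]
    have hev : iteratedDeriv j (fun s : ℝ => (1 - s ^ 2) ^ a) =ᶠ[𝓝 t]
        fun s => (1 - s ^ 2) ^ (a - j) * (rodriguesPoly a j).eval s := by
      filter_upwards [Ioo_mem_nhds ht.1 ht.2] with s hs using ih hs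
    rw [hev.deriv_eq]
    have h1 : HasDerivAt (fun s : ℝ => 1 - s ^ 2) (-(2 * t)) t := by
      have := ((hasDerivAt_id t).pow 2).const_sub 1
      simpa using this
    have h2 := (h1.rpow_const (p := a - j) (Or.inl hpos.ne')).mul
      ((rodriguesPoly a j).hasDerivAt t)
    have h3 := h2.deriv
    have e : (fun s => (1 - s ^ 2) ^ (a - j) * (rodriguesPoly a j).eval s) =
      ((fun s : ℝ => (1 - s ^ 2) ^ (a - (j : ℝ))) * fun s => (rodriguesPoly a j).eval s) := rfl
    rw [e, h3, rodriguesPoly]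
    have e1 : (1 - t ^ 2) ^ (a - j) = (1 - t ^ 2) ^ (a - j - 1) * (1 - t ^ 2) := by
      rw [Real.rpow_sub_one hpos.ne']; field_simp
    have e2 : a - ((j + 1 : ℕ) : ℝ) = a - j - 1 := by push_cast; ring
    rw [e2, e1]
    simp only [Polynomial.eval_sub, Polynomial.eval_mul, Polynomial.eval_one, Polynomial.eval_pow,
      Polynomial.eval_X, Polynomial.eval_C]
    ring

/-- The Legendre polynomial of dimension `n` and degree `k`, as a polynomial. -/
def legPoly (n k : ℕ) : Polynomial ℝ :=
  Polynomial.C ((rodriguesPoly (((n : ℝ) - 3) / 2 + k) k).eval 1)⁻¹ *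
    rodriguesPoly (((n : ℝ) - 3) / 2 + k) k

theorem rodriguesPoly_eval_one_eq_Gamma {ν : ℝ} (hν : 0 ≤ ν) (k : ℕ) :
    (rodriguesPoly (ν + k) k).eval 1 =
      (-2) ^ k * (Real.Gamma (ν + 1 + k) / Real.Gamma (ν + 1)) := by
  rw [rodriguesPoly_eval_one]
  congr 1
  induction k with
  | zero => simp; rw [div_self (Real.Gamma_pos_of_pos (by linarith)).ne']
  | succ k ih =>
    rw [Finset.prod_range_succ']
    have e : ∀ j ∈ Finset.range k, (ν + ((k + 1 : ℕ) : ℝ) - ((j + 1 : ℕ) : ℝ)) = ν + k - j := by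
      intro j _; push_cast; ring
    rw [Finset.prod_congr rfl e, ih]
    have : ν + 1 + ((k + 1 : ℕ) : ℝ) = (ν + 1 + k) + 1 := by push_cast; ring
    rw [this, Real.Gamma_add_one (s := ν + 1 + k) (by positivity)]
    push_cast
    ring

theorem rodriguesPoly_eval_one_ne_zero {n : ℕ} (hn : 3 ≤ n) (k : ℕ) :
    (rodriguesPoly (((n : ℝ) - 3) / 2 + k) k).eval 1 ≠ 0 := by
  have h3 : (3 : ℝ) ≤ n := by exact_mod_cast hn
  rw [rodriguesPoly_eval_one_eq_Gamma (by linarith)]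
  have h1 : 0 < Real.Gamma (((n : ℝ) - 3) / 2 + 1 + k) :=
    Real.Gamma_pos_of_pos (by have : (0 : ℝ) ≤ k := by positivity
                              linarith)
  have h2 : 0 < Real.Gamma (((n : ℝ) - 3) / 2 + 1) := Real.Gamma_pos_of_pos (by linarith)
  have h4 : ((-2 : ℝ)) ^ k ≠ 0 := pow_ne_zero _ (by norm_num)
  have := (div_pos h1 h2).ne'
  exact mul_ne_zero h4 this

theorem legPoly_eval_one {n : ℕ} (hn : 3 ≤ n) (k : ℕ) : (legPoly n k).eval 1 = 1 := by
  rw [legPoly, Polynomial.eval_mul, Polynomial.eval_C,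
    inv_mul_cancel₀ (rodriguesPoly_eval_one_ne_zero hn k)]

theorem legendreP_eq {n : ℕ} (hn : 3 ≤ n) (k : ℕ) {t : ℝ} (ht : t ∈ Set.Ioo (-1 : ℝ) 1) :
    legendreP n k t = (legPoly n k).eval t := by
  have h3 : (3 : ℝ) ≤ n := by exact_mod_cast hn
  have hpos : 0 < 1 - t ^ 2 := by nlinarith [ht.1, ht.2]
  rw [legendreP, iteratedDeriv_one_sub_sq_rpow _ _ ht, legPoly,
    rodriguesPoly_eval_one_eq_Gamma (by linarith)]
  have e : ((n : ℝ) - 3) / 2 + k - k = ((n : ℝ) - 3) / 2 := by ring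
  have e1 : ((n : ℝ) - 3) / 2 + 1 = ((n : ℝ) - 1) / 2 := by ring
  rw [e, e1, Real.rpow_neg hpos.le, Polynomial.eval_mul, Polynomial.eval_C]
  have hr : (1 - t ^ 2) ^ (((n : ℝ) - 3) / 2) ≠ 0 := (Real.rpow_pos_of_pos hpos _).ne'
  have h1 : Real.Gamma (((n : ℝ) - 1) / 2 + k) ≠ 0 :=
    (Real.Gamma_pos_of_pos (by have : (0 : ℝ) ≤ k := by positivity
                               linarith)).ne'
  have h2 : Real.Gamma (((n : ℝ) - 1) / 2) ≠ 0 := (Real.Gamma_pos_of_pos (by linarith)).ne'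
  have h4 : ((-2 : ℝ)) ^ k = (-1) ^ k * 2 ^ k := by rw [← mul_pow]; norm_num
  have h5 : ((-1 : ℝ)) ^ k * (-1) ^ k = 1 := by rw [← mul_pow]; norm_num
  have h6 : ((-1 : ℝ)) ^ k ≠ 0 := pow_ne_zero _ (by norm_num)
  rw [h4]
  field_simp
  rw [sq, h5]; ring

theorem legPoly_natDegree {n : ℕ} (hn : 3 ≤ n) (k : ℕ) : (legPoly n k).natDegree = k := by
  have h3 : (3 : ℝ) ≤ n := by exact_mod_cast hn
  rw [legPoly, Polynomial.natDegree_C_mul (inv_ne_zero (rodriguesPoly_eval_one_ne_zero hn k))]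
  refine rodriguesPoly_natDegree _ _ fun j hj => ?_
  have : (j : ℝ) < k := by exact_mod_cast hj
  have : (0 : ℝ) ≤ j := by positivity
  intro h
  linarith

open Polynomial in
theorem legPoly_ode (n k : ℕ) :
    (1 - X ^ 2) * derivative (derivative (legPoly n k)) -
      C ((n : ℝ) - 1) * (X * derivative (legPoly n k)) =
        C (-((k : ℝ) * (k + n - 2))) * legPoly n k := by
  have h := rodriguesPoly_ode (((n : ℝ) - 3) / 2 + k) k
  rw [legPoly]
  simp only [derivative_mul, derivative_C, zero_mul, zero_add]
  set c := ((rodriguesPoly (((n : ℝ) - 3) / 2 + k) k).eval 1)⁻¹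
  set q := rodriguesPoly (((n : ℝ) - 3) / 2 + k) k
  have e1 : 2 * (((n : ℝ) - 3) / 2 + k - k + 1) = n - 1 := by ring
  have e2 : (k : ℝ) * (2 * (((n : ℝ) - 3) / 2 + k) - k + 1) = k * (k + n - 2) := by ring
  rw [e1, e2] at h
  rw [mul_left_comm, h, C_neg]
  ring

theorem derivative_legPoly {n : ℕ} (hn : 3 ≤ n) (k : ℕ) :
    Polynomial.derivative (legPoly n (k + 1)) =
      Polynomial.C (((k + 1 : ℝ) * (k + n - 1)) / (n - 1)) * legPoly (n + 2) k := by
  have h3 : (3 : ℝ) ≤ n := by exact_mod_cast hn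
  have hode := congrArg (Polynomial.eval 1) (legPoly_ode n (k + 1))
  simp [legPoly_eval_one hn] at hode
  have hne := rodriguesPoly_eval_one_ne_zero (n := n + 2) (by omega) k
  have ea : (((n + 2 : ℕ) : ℝ) - 3) / 2 + k = ((n : ℝ) - 3) / 2 + ((k + 1 : ℕ) : ℝ) := by
    push_cast; ring
  have hd : ∃ c, Polynomial.derivative (legPoly n (k + 1)) =
      Polynomial.C c * legPoly (n + 2) k := by
    rw [legPoly, Polynomial.derivative_mul, Polynomial.derivative_C, zero_mul, zero_add,
      derivative_rodriguesPoly, legPoly, ea]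
    rw [ea] at hne
    refine ⟨((rodriguesPoly (((n : ℝ) - 3) / 2 + ((k + 1 : ℕ) : ℝ)) (k + 1)).eval 1)⁻¹ *
      (-((k + 1 : ℝ) * (2 * (((n : ℝ) - 3) / 2 + ((k + 1 : ℕ) : ℝ)) - k))) *
      ((rodriguesPoly (((n : ℝ) - 3) / 2 + ((k + 1 : ℕ) : ℝ)) k).eval 1), ?_⟩
    rw [← mul_assoc, ← mul_assoc, ← Polynomial.C_mul, ← Polynomial.C_mul, mul_assoc _ _ (_⁻¹),
      mul_inv_cancel₀ hne, mul_one]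
  obtain ⟨c, hc⟩ := hd
  rw [hc] at hode ⊢
  simp [legPoly_eval_one (n := n + 2) (by omega)] at hode
  congr 2
  rw [eq_div_iff (by linarith)]
  linarith

theorem legPoly_zero {n : ℕ} : legPoly n 0 = 1 := by
  simp [legPoly, rodriguesPoly]

end

instance : IsFiniteMeasure (sphVol n) := by unfold sphVol; infer_instance

instance : (sphVol n).IsOpenPosMeasure := by unfold sphVol; infer_instance

/-- The self-homeomorphism of the sphere induced by a linear isometry. -/
def sphIso (ρ : En n ≃ₗᵢ[ℝ] En n) : Sph n ≃ₜ Sph n where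
  toFun v := ⟨ρ v, by simp⟩
  invFun v := ⟨ρ.symm v, by simp⟩
  left_inv v := by ext1; simp
  right_inv v := by ext1; simp
  continuous_toFun := by fun_prop
  continuous_invFun := by fun_prop

@[simp] theorem coe_sphIso (ρ : En n ≃ₗᵢ[ℝ] En n) (v : Sph n) :
    ((sphIso ρ v : Sph n) : En n) = ρ v := rfl

theorem measurePreserving_sphIso (ρ : En n ≃ₗᵢ[ℝ] En n) :
    MeasurePreserving (sphIso ρ) (sphVol n) (sphVol n) := by
  refine ⟨(sphIso ρ).continuous.measurable, ?_⟩
  ext s hs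
  rw [Measure.map_apply (sphIso ρ).continuous.measurable hs, sphVol,
    Measure.toSphere_apply' _ hs,
    Measure.toSphere_apply' _ ((sphIso ρ).continuous.measurable hs)]
  congr 1
  rw [← ρ.measurePreserving.measure_preimage_emb ρ.toHomeomorph.measurableEmbedding
    (Set.Ioo (0 : ℝ) 1 • (Subtype.val '' s))]
  congr 1
  ext x
  simp only [Set.mem_smul, Set.mem_image, Set.mem_preimage, Subtype.exists, exists_and_right,
    exists_eq_right]
  constructor
  · rintro ⟨r, hr, y, ⟨hy, hys⟩, rfl⟩
    exact ⟨r, hr, ρ y, ⟨by simpa using hy, hys⟩, by simp⟩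
  · rintro ⟨r, hr, y, ⟨hy, hys⟩, h⟩
    refine ⟨r, hr, ρ.symm y, ⟨by simpa using hy, ?_⟩, ?_⟩
    · convert hys using 1
      ext1; simp
    · rw [← map_smul, h]; simp

theorem integral_comp_isometry (ρ : En n ≃ₗᵢ[ℝ] En n) (f : En n → ℝ) :
    ∫ v : Sph n, f (ρ v) ∂(sphVol n) = ∫ v : Sph n, f v ∂(sphVol n) :=
  (measurePreserving_sphIso ρ).integral_comp (sphIso ρ).measurableEmbedding
    (fun v : Sph n => f v)

theorem integrable_of_continuous {f : Sph n → ℝ} (hf : Continuous f) :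
    Integrable f (sphVol n) :=
  hf.integrable_of_hasCompactSupport (HasCompactSupport.of_compactSpace f)

theorem sphVol_singleton (hn : 2 ≤ n) (x : Sph n) : sphVol n {x} = 0 := by
  rw [sphVol, Measure.toSphere_apply' _ (measurableSet_singleton x)]
  have : volume (Set.Ioo (0 : ℝ) 1 • ((↑) '' ({x} : Set (Sph n)) : Set (En n))) = 0 := by
    refine measure_mono_null (t := ((ℝ ∙ (x : En n) : Submodule ℝ (En n)) : Set (En n))) ?_ ?_
    · rintro y ⟨r, -, z, ⟨w, rfl, rfl⟩, rfl⟩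
      exact Submodule.smul_mem _ _ (Submodule.mem_span_singleton_self _)
    · refine Measure.addHaar_submodule _ _ fun h => ?_
      have h1 := finrank_span_singleton (K := ℝ) (v := (x : En n))
        (fun h => by simpa [h] using x.2)
      rw [h, finrank_top, finrank_euclideanSpace, Fintype.card_fin] at h1
      omega
  rw [this, mul_zero]

/-- The pole as a point on the sphere. -/
theorem norm_pole (hn : 0 < n) : ‖pole n‖ = 1 := by simp [pole, hn]

/-- An orthonormal pair extends to an orthonormal basis. -/
theorem exists_basis_of_pair (hn : 2 ≤ n) {u e : En n} (hu : ‖u‖ = 1) (he : ‖e‖ = 1)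
    (hue : ⟪u, e⟫_ℝ = 0) : ∃ b : OrthonormalBasis (Fin n) ℝ (En n),
      b ⟨0, by omega⟩ = u ∧ b ⟨1, by omega⟩ = e := by
  have hv : Orthonormal ℝ (({⟨0, by omega⟩, ⟨1, by omega⟩} : Set (Fin n)).domRestrict
      (fun j : Fin n => if (j : ℕ) = 0 then u else e)) := by
    rw [orthonormal_iff_ite]
    rintro ⟨a, ha⟩ ⟨b, hb⟩
    simp only [Set.mem_insert_iff, Set.mem_singleton_iff] at ha hb
    rcases ha with rfl | rfl <;> rcases hb with rfl | rfl <;>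
      simp [Set.domRestrict, hue, real_inner_comm u e, hu, he]
  obtain ⟨b, hb⟩ := hv.exists_orthonormalBasis_extension_of_card_eq (by simp)
  exact ⟨b, by simpa using hb ⟨0, by omega⟩ (by simp), by simpa using hb ⟨1, by omega⟩ (by simp)⟩

/-- A unit vector extends to an orthonormal basis. -/
theorem exists_basis_of_unit {m : ℕ} {u : En (m + 1)} (hu : ‖u‖ = 1) :
    ∃ b : OrthonormalBasis (Fin (m + 1)) ℝ (En (m + 1)), b 0 = u := by
  have hv : Orthonormal ℝ (({0} : Set (Fin (m + 1))).domRestrict (fun _ => u)) := by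
    rw [orthonormal_iff_ite]
    rintro ⟨a, ha⟩ ⟨b, hb⟩
    simp only [Set.mem_singleton_iff] at ha hb
    subst ha hb
    simp [Set.domRestrict, hu]
  obtain ⟨b, hb⟩ := hv.exists_orthonormalBasis_extension_of_card_eq (by simp)
  exact ⟨b, by simpa using hb 0 (by simp)⟩

/-- The orthogonal group acts transitively on orthonormal pairs. -/
theorem exists_isometry_of_pair (hn : 2 ≤ n) {u e u' e' : En n} (hu : ‖u‖ = 1) (he : ‖e‖ = 1)
    (hue : ⟪u, e⟫_ℝ = 0) (hu' : ‖u'‖ = 1) (he' : ‖e'‖ = 1) (hue' : ⟪u', e'⟫_ℝ = 0) :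
    ∃ ρ : En n ≃ₗᵢ[ℝ] En n, ρ u = u' ∧ ρ e = e' := by
  obtain ⟨b, rfl, rfl⟩ := exists_basis_of_pair hn hu he hue
  obtain ⟨b', rfl, rfl⟩ := exists_basis_of_pair hn hu' he' hue'
  exact ⟨b.equiv b' (Equiv.refl _), by simp, by simp⟩

theorem exists_orthogonal_unit (hn : 2 ≤ n) {u : En n} (hu : ‖u‖ = 1) :
    ∃ e : En n, ‖e‖ = 1 ∧ ⟪u, e⟫_ℝ = 0 := by
  obtain ⟨m, rfl⟩ : ∃ m, n = m + 1 + 1 := ⟨n - 2, by omega⟩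
  obtain ⟨b, rfl⟩ := exists_basis_of_unit hu
  exact ⟨b 1, by simp, b.inner_eq_zero (by simp)⟩

/-- Decomposition of a unit vector along a given unit vector. -/
theorem exists_decomp (hn : 2 ≤ n) {u w : En n} (hu : ‖u‖ = 1) (hw : ‖w‖ = 1) :
    ∃ (e : En n) (σ : ℝ), ‖e‖ = 1 ∧ ⟪u, e⟫_ℝ = 0 ∧ σ ^ 2 = 1 - ⟪u, w⟫_ℝ ^ 2 ∧
      w = ⟪u, w⟫_ℝ • u + σ • e := by
  by_cases h : w - ⟪u, w⟫_ℝ • u = 0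
  · obtain ⟨e, he, hue⟩ := exists_orthogonal_unit hn hu
    refine ⟨e, 0, he, hue, ?_, by rw [zero_smul, add_zero]; exact sub_eq_zero.1 h⟩
    have h1 : w = ⟪u, w⟫_ℝ • u := sub_eq_zero.1 h
    have h2 : ‖w‖ ^ 2 = ⟪u, w⟫_ℝ ^ 2 := by
      conv_lhs => rw [h1]
      rw [norm_smul, hu, mul_one, Real.norm_eq_abs, sq_abs]
    rw [hw] at h2; linarith
  · have hpos : ‖w - ⟪u, w⟫_ℝ • u‖ ≠ 0 := norm_ne_zero_iff.2 h
    refine ⟨‖w - ⟪u, w⟫_ℝ • u‖⁻¹ • (w - ⟪u, w⟫_ℝ • u), ‖w - ⟪u, w⟫_ℝ • u‖, ?_, ?_, ?_, ?_⟩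
    · rw [norm_smul, norm_inv, norm_norm, inv_mul_cancel₀ hpos]
    · rw [inner_smul_right, inner_sub_right, inner_smul_right, real_inner_self_eq_norm_sq, hu]
      ring
    · rw [norm_sub_sq_real, inner_smul_right, norm_smul, hu, hw, real_inner_comm,
        Real.norm_eq_abs, mul_one, sq_abs]
      ring
    · rw [smul_smul, mul_inv_cancel₀ hpos, one_smul]; abel

/-- The integral of a function of an orthonormal pair of coordinates. -/
theorem integral_pair_eq (hn : 2 ≤ n) (f : ℝ → ℝ → ℝ) {u e u' e' : En n} (hu : ‖u‖ = 1)
    (he : ‖e‖ = 1) (hue : ⟪u, e⟫_ℝ = 0) (hu' : ‖u'‖ = 1) (he' : ‖e'‖ = 1)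
    (hue' : ⟪u', e'⟫_ℝ = 0) :
    ∫ v : Sph n, f ⟪u, (v : En n)⟫_ℝ ⟪e, (v : En n)⟫_ℝ ∂(sphVol n) =
      ∫ v : Sph n, f ⟪u', (v : En n)⟫_ℝ ⟪e', (v : En n)⟫_ℝ ∂(sphVol n) := by
  obtain ⟨ρ, rfl, rfl⟩ := exists_isometry_of_pair hn hu he hue hu' he' hue'
  rw [← integral_comp_isometry ρ (fun v => f ⟪ρ u, v⟫_ℝ ⟪ρ e, v⟫_ℝ)]
  simp

theorem integral_zonal_eq (hn : 2 ≤ n) (f : ℝ → ℝ) {u u' : En n} (hu : ‖u‖ = 1)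
    (hu' : ‖u'‖ = 1) :
    ∫ v : Sph n, f ⟪u, (v : En n)⟫_ℝ ∂(sphVol n) =
      ∫ v : Sph n, f ⟪u', (v : En n)⟫_ℝ ∂(sphVol n) := by
  obtain ⟨e, he, hue⟩ := exists_orthogonal_unit hn hu
  obtain ⟨e', he', hue'⟩ := exists_orthogonal_unit hn hu'
  exact integral_pair_eq hn (fun t _ => f t) hu he hue hu' he' hue'

/-- Integration of a polynomial in the height function. -/
def zonalInt (n : ℕ) (r : Polynomial ℝ) : ℝ :=
  ∫ v : Sph n, r.eval ⟪pole n, (v : En n)⟫_ℝ ∂(sphVol n)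

theorem continuous_eval_inner (r : Polynomial ℝ) (u : En n) :
    Continuous fun v : Sph n => r.eval ⟪u, (v : En n)⟫_ℝ :=
  r.continuous.comp (by fun_prop)

theorem zonalInt_add (r s : Polynomial ℝ) : zonalInt n (r + s) = zonalInt n r + zonalInt n s := by
  simp only [zonalInt, Polynomial.eval_add]
  exact integral_add (integrable_of_continuous (continuous_eval_inner _ _))
    (integrable_of_continuous (continuous_eval_inner _ _))

theorem zonalInt_C_mul (c : ℝ) (r : Polynomial ℝ) :
    zonalInt n (Polynomial.C c * r) = c * zonalInt n r := by
  simp only [zonalInt, Polynomial.eval_mul, Polynomial.eval_C]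
  exact integral_const_mul _ _

theorem zonalInt_eq (hn : 2 ≤ n) (r : Polynomial ℝ) {u : En n} (hu : ‖u‖ = 1) :
    ∫ v : Sph n, r.eval ⟪u, (v : En n)⟫_ℝ ∂(sphVol n) = zonalInt n r :=
  integral_zonal_eq hn (fun t => r.eval t) hu (norm_pole (by omega))

theorem integral_neg_sph (f : En n → ℝ) :
    ∫ v : Sph n, f (-v) ∂(sphVol n) = ∫ v : Sph n, f v ∂(sphVol n) := by
  simpa using integral_comp_isometry (LinearIsometryEquiv.neg ℝ) f

theorem zonalInt_X_pow_odd {k : ℕ} (hk : Odd k) : zonalInt n (Polynomial.X ^ k) = 0 := by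
  have h := integral_neg_sph (n := n) (fun v => ⟪pole n, v⟫_ℝ ^ k)
  simp only [inner_neg_right, hk.neg_pow, integral_neg] at h
  simp only [zonalInt, Polynomial.eval_pow, Polynomial.eval_X]
  linarith

theorem integral_inner_pow (hn : 2 ≤ n) (y : En n) (k : ℕ) :
    ∫ v : Sph n, ⟪y, (v : En n)⟫_ℝ ^ k ∂(sphVol n) =
      ‖y‖ ^ k * zonalInt n (Polynomial.X ^ k) := by
  by_cases hy : y = 0
  · subst hy
    rcases Nat.eq_zero_or_pos k with rfl | hk
    · simp [zonalInt]
    · simp [hk.ne']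
  · have hy' : ‖y‖ ≠ 0 := norm_ne_zero_iff.2 hy
    rw [← zonalInt_eq hn _ (u := ‖y‖⁻¹ • y) (by rw [norm_smul, norm_inv, norm_norm,
      inv_mul_cancel₀ hy']), ← integral_const_mul]
    refine integral_congr_ae (.of_forall fun v => ?_)
    simp only [Polynomial.eval_pow, Polynomial.eval_X, real_inner_smul_left]
    rw [← mul_pow, ← mul_assoc, mul_inv_cancel₀ hy', one_mul]

theorem integral_pow_mul_sq (hn : 2 ≤ n) {u e : En n} (hu : ‖u‖ = 1) (he : ‖e‖ = 1)
    (hue : ⟪u, e⟫_ℝ = 0) (k : ℕ) :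
    ((k : ℝ) + 1) * ∫ v : Sph n, ⟪u, (v : En n)⟫_ℝ ^ k * ⟪e, (v : En n)⟫_ℝ ^ 2 ∂(sphVol n) =
      zonalInt n (Polynomial.X ^ (k + 2)) := by
  rcases Nat.even_or_odd k with hk | hk
  · obtain ⟨m, hm⟩ := hk
    set c : ℕ → ℝ := fun j => ∫ v : Sph n, ⟪u, (v : En n)⟫_ℝ ^ (k + 2 - j) *
      ⟪e, (v : En n)⟫_ℝ ^ j ∂(sphVol n) with hc
    have key : (∑ j ∈ Finset.range (k + 2 + 1), Polynomial.C (((k + 2).choose j : ℝ) * c j) *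
        Polynomial.X ^ j : Polynomial ℝ) =
        Polynomial.C (zonalInt n (Polynomial.X ^ (k + 2))) *
          (Polynomial.expand ℝ 2 ((1 + Polynomial.X) ^ (m + 1))) := by
      refine Polynomial.funext fun x => ?_
      simp only [Polynomial.eval_finsetSum, Polynomial.eval_mul, Polynomial.eval_C,
        Polynomial.eval_pow, Polynomial.eval_X, Polynomial.expand_eval, Polynomial.eval_add,
        Polynomial.eval_one]
      have h1 := integral_inner_pow hn (u + x • e) (k + 2)
      have h2 : ‖u + x • e‖ ^ (k + 2) = (1 + x ^ 2) ^ (m + 1) := by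
        have : ‖u + x • e‖ ^ 2 = 1 + x ^ 2 := by
          rw [norm_add_sq_real, inner_smul_right, hue, norm_smul, hu, he, Real.norm_eq_abs,
            mul_one, sq_abs]
          ring
        rw [← this, ← pow_mul]
        congr 1
        omega
      rw [h2] at h1
      rw [mul_comm (zonalInt n _), ← h1]
      have h3 : ∀ v : Sph n, ⟪u + x • e, (v : En n)⟫_ℝ ^ (k + 2) =
          ∑ j ∈ Finset.range (k + 2 + 1), (((k + 2).choose j : ℝ) * x ^ j) *
            (⟪u, (v : En n)⟫_ℝ ^ (k + 2 - j) * ⟪e, (v : En n)⟫_ℝ ^ j) := by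
        intro v
        rw [inner_add_left, real_inner_smul_left, add_comm, add_pow]
        refine Finset.sum_congr rfl fun j _ => ?_
        rw [mul_pow]; ring
      rw [integral_congr_ae (.of_forall h3), integral_finsetSum]
      · refine Finset.sum_congr rfl fun j _ => ?_
        rw [integral_const_mul]; ring
      · intro j _
        exact integrable_of_continuous (by fun_prop)
    have h2 := congrArg (fun p => p.coeff 2) key
    simp only [Polynomial.finsetSum_coeff, Polynomial.coeff_C_mul, Polynomial.coeff_X_pow] at h2
    rw [Finset.sum_eq_single 2 (by intro b _ hb; simp [hb.symm]) (by simp)] at h2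
    have h3 := Polynomial.coeff_expand_mul (R := ℝ) (p := 2) (by norm_num)
      ((1 + Polynomial.X) ^ (m + 1)) 1
    simp only [one_mul] at h3
    rw [h3, Polynomial.coeff_one_add_X_pow] at h2
    have h4 : (((k + 2).choose 2 : ℕ) : ℝ) = (k + 2) * (k + 1) / 2 := by
      rw [Nat.cast_choose_two]; push_cast; ring
    simp only [h4, hc, if_true, mul_one, Nat.choose_one_right, Nat.add_sub_cancel] at h2
    have h5 : ((m + 1 : ℕ) : ℝ) = ((k : ℝ) + 2) / 2 := by
      rw [hm]; push_cast; ring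
    rw [h5] at h2
    have h6 : ((k : ℝ) + 2) ≠ 0 := by positivity
    field_simp at h2
    linarith
  · rw [zonalInt_X_pow_odd (by
      obtain ⟨m, rfl⟩ := hk
      exact ⟨m + 1, by ring⟩)]
    have h := integral_neg_sph (n := n) (fun v => ⟪u, v⟫_ℝ ^ k * ⟪e, v⟫_ℝ ^ 2)
    simp only [inner_neg_right, hk.neg_pow, neg_sq, neg_mul, integral_neg] at h
    have : ∫ v : Sph n, ⟪u, (v : En n)⟫_ℝ ^ k * ⟪e, (v : En n)⟫_ℝ ^ 2 ∂(sphVol n) = 0 := by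
      linarith
    rw [this, mul_zero]

theorem zonalInt_recursion (hn : 2 ≤ n) (k : ℕ) :
    ((k : ℝ) + 1) * (zonalInt n (Polynomial.X ^ k) - zonalInt n (Polynomial.X ^ (k + 2))) =
      ((n : ℝ) - 1) * zonalInt n (Polynomial.X ^ (k + 2)) := by
  obtain ⟨m, rfl⟩ : ∃ m, n = m + 1 := ⟨n - 1, by omega⟩
  obtain ⟨b, hb⟩ := exists_basis_of_unit (norm_pole (n := m + 1) (by omega))
  have h1 : ∀ v : Sph (m + 1), ⟪pole (m + 1), (v : En (m + 1))⟫_ℝ ^ k -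
      ⟪pole (m + 1), (v : En (m + 1))⟫_ℝ ^ (k + 2) =
      ∑ j : Fin m, ⟪pole (m + 1), (v : En (m + 1))⟫_ℝ ^ k *
        ⟪b j.succ, (v : En (m + 1))⟫_ℝ ^ 2 := by
    intro v
    have h2 := b.sum_sq_norm_inner_left (v : En (m + 1))
    rw [Fin.sum_univ_succ, hb] at h2
    simp only [Real.norm_eq_abs, sq_abs, norm_eq_of_mem_sphere, one_pow] at h2
    rw [← Finset.mul_sum]
    have : ∑ j : Fin m, ⟪b j.succ, (v : En (m + 1))⟫_ℝ ^ 2 =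
        1 - ⟪pole (m + 1), (v : En (m + 1))⟫_ℝ ^ 2 := by
      simp only [real_inner_comm] at h2 ⊢
      linarith
    rw [this]; ring
  have h2 : zonalInt (m + 1) (Polynomial.X ^ k) - zonalInt (m + 1) (Polynomial.X ^ (k + 2)) =
      ∑ j : Fin m, ∫ v : Sph (m + 1), ⟪pole (m + 1), (v : En (m + 1))⟫_ℝ ^ k *
        ⟪b j.succ, (v : En (m + 1))⟫_ℝ ^ 2 ∂(sphVol (m + 1)) := by
    rw [← integral_finsetSum _ (fun j _ => integrable_of_continuous (by fun_prop)),
      ← integral_congr_ae (.of_forall h1)]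
    simp only [zonalInt, Polynomial.eval_pow, Polynomial.eval_X]
    exact (integral_sub (integrable_of_continuous (by fun_prop))
      (integrable_of_continuous (by fun_prop))).symm
  rw [h2, Finset.mul_sum, Finset.sum_congr rfl fun j _ =>
    integral_pow_mul_sq hn (norm_pole (by omega)) (by simp)
      (by rw [← hb]; exact b.inner_eq_zero (Fin.succ_ne_zero j).symm) k]
  simp

open Polynomial in
theorem zonalInt_div (hn : 2 ≤ n) (r : ℝ[X]) :
    zonalInt n ((1 - X ^ 2) * derivative r - C ((n : ℝ) - 1) * (X * r)) = 0 := by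
  induction r using Polynomial.induction_on' with
  | add p q hp hq =>
    rw [← add_zero 0]
    nth_rewrite 1 [← hp]
    rw [← hq, ← zonalInt_add]
    congr 1
    simp only [map_add]; ring
  | monomial k a =>
    rw [← C_mul_X_pow_eq_monomial]
    rcases Nat.eq_zero_or_pos k with rfl | hk
    · have h := zonalInt_X_pow_odd (n := n) (k := 1) (by decide)
      rw [show (1 - X ^ 2) * derivative (C a * X ^ 0) - C ((n : ℝ) - 1) * (X * (C a * X ^ 0)) =
        C (-((n : ℝ) - 1) * a) * X ^ 1 by simp; ring, zonalInt_C_mul, h, mul_zero]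
    · obtain ⟨j, rfl⟩ : ∃ j, k = j + 1 := ⟨k - 1, by omega⟩
      have h := zonalInt_recursion hn j
      rw [show (1 - X ^ 2) * derivative (C a * X ^ (j + 1)) -
          C ((n : ℝ) - 1) * (X * (C a * X ^ (j + 1))) =
          C (a * ((j : ℝ) + 1)) * X ^ j + C (-(a * ((j : ℝ) + 1)) - ((n : ℝ) - 1) * a) *
            X ^ (j + 2) by
        rw [derivative_C_mul_X_pow]
        simp only [map_mul, map_sub, map_neg, map_add, map_one, Nat.add_sub_cancel,
          Nat.cast_add, Nat.cast_one]
        ring]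
      rw [zonalInt_add, zonalInt_C_mul, zonalInt_C_mul]
      linear_combination a * h

open Polynomial in
theorem zonalInt_legPoly_mul (hn : 3 ≤ n) {j k : ℕ} (hjk : j ≠ k) :
    zonalInt n (legPoly n j * legPoly n k) = 0 := by
  have h1 := zonalInt_div (n := n) (by omega) (derivative (legPoly n j) * legPoly n k)
  have h2 := zonalInt_div (n := n) (by omega) (derivative (legPoly n k) * legPoly n j)
  set c : ℕ → ℝ := fun k => -((k : ℝ) * ((k : ℝ) + n - 2)) with hc
  have e : (1 - X ^ 2) * derivative (derivative (legPoly n j) * legPoly n k) -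
        C ((n : ℝ) - 1) * (X * (derivative (legPoly n j) * legPoly n k)) =
      ((1 - X ^ 2) * derivative (derivative (legPoly n k) * legPoly n j) -
        C ((n : ℝ) - 1) * (X * (derivative (legPoly n k) * legPoly n j))) +
        C (c j - c k) * (legPoly n j * legPoly n k) := by
    have o1 := legPoly_ode n j
    have o2 := legPoly_ode n k
    simp only [derivative_mul, hc, map_sub] at o1 o2 ⊢
    linear_combination legPoly n k * o1 - legPoly n j * o2
  rw [e, zonalInt_add, h2, zonalInt_C_mul, zero_add] at h1
  rcases mul_eq_zero.1 h1 with h | h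
  · exfalso
    simp only [hc] at h
    have h3 : ((j : ℝ) - k) * (j + k + n - 2) = 0 := by linear_combination -h
    rcases mul_eq_zero.1 h3 with h4 | h4
    · exact hjk (by exact_mod_cast sub_eq_zero.1 h4)
    · have : (3 : ℝ) ≤ n := by exact_mod_cast hn
      have h5 : (0 : ℝ) ≤ j := by positivity
      have h6 : (0 : ℝ) ≤ k := by positivity
      linarith
  · exact h

open Polynomial in
theorem mem_span_legPoly (hn : 3 ≤ n) (d : ℕ) (r : ℝ[X]) (hr : r.degree < d) :
    r ∈ Submodule.span ℝ (legPoly n '' Set.Iio d) := by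
  induction d generalizing r with
  | zero =>
    have : r = 0 := by
      rw [← degree_eq_bot]
      exact Nat.WithBot.lt_zero_iff.1 (by simpa using hr)
    rw [this]; exact Submodule.zero_mem _
  | succ d ih =>
    have hlead : (legPoly n d).coeff d ≠ 0 := by
      have h0 : (legPoly n d).leadingCoeff = (legPoly n d).coeff d := by
        rw [leadingCoeff, legPoly_natDegree hn]
      rw [← h0]
      intro h
      rw [leadingCoeff_eq_zero] at h
      have h1 := legPoly_eval_one hn d
      simp [h] at h1
    set c := r.coeff d / (legPoly n d).coeff d
    have hmem : r - c • legPoly n d ∈ Submodule.span ℝ (legPoly n '' Set.Iio d) := by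
      refine ih _ ?_
      rw [degree_lt_iff_coeff_zero]
      intro m hm
      rcases hm.eq_or_lt with rfl | hm
      · rw [coeff_sub, coeff_smul, smul_eq_mul, div_mul_cancel₀ _ hlead, sub_self]
      · rw [coeff_sub, coeff_smul, coeff_eq_zero_of_degree_lt (hr.trans_le (by
          exact_mod_cast hm)), coeff_eq_zero_of_natDegree_lt (by rwa [legPoly_natDegree hn]),
          smul_zero, sub_zero]
    have h2 : r = (r - c • legPoly n d) + c • legPoly n d := by abel
    rw [h2]
    refine Submodule.add_mem _ (Submodule.span_mono (Set.image_mono ?_) hmem)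
      (Submodule.smul_mem _ _ (Submodule.subset_span ⟨d, by simp, rfl⟩))
    exact fun x (hx : x < d) => Nat.lt_succ_of_lt hx

open Polynomial in
theorem zonalInt_legPoly_mul_of_degree_lt (hn : 3 ≤ n) {k : ℕ} {r : ℝ[X]}
    (hr : r.degree < k) : zonalInt n (legPoly n k * r) = 0 := by
  have := mem_span_legPoly hn k r hr
  clear hr
  induction this using Submodule.span_induction with
  | mem x hx =>
    obtain ⟨j, hj, rfl⟩ := hx
    exact zonalInt_legPoly_mul hn (ne_of_gt hj)
  | zero => simp [zonalInt]
  | add x y _ _ hx hy => rw [mul_add, zonalInt_add, hx, hy, add_zero]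
  | smul a x _ hx => rw [mul_smul_comm, smul_eq_C_mul, zonalInt_C_mul, hx, mul_zero]

theorem inner_mem_Icc {u v : En n} (hu : ‖u‖ = 1) (hv : ‖v‖ = 1) :
    ⟪u, v⟫_ℝ ∈ Set.Icc (-1 : ℝ) 1 := by
  have := abs_real_inner_le_norm u v
  rw [hu, hv, mul_one] at this
  exact abs_le.1 this

theorem exists_inner_eq (hn : 2 ≤ n) {u : En n} (hu : ‖u‖ = 1) {t : ℝ}
    (ht : t ∈ Set.Icc (-1 : ℝ) 1) : ∃ w : En n, ‖w‖ = 1 ∧ ⟪u, w⟫_ℝ = t := by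
  obtain ⟨e, he, hue⟩ := exists_orthogonal_unit hn hu
  refine ⟨t • u + √(1 - t ^ 2) • e, ?_, ?_⟩
  · have h1 : 0 ≤ 1 - t ^ 2 := by nlinarith [ht.1, ht.2]
    have h2 : ‖t • u + √(1 - t ^ 2) • e‖ ^ 2 = 1 := by
      rw [norm_add_sq_real, inner_smul_left, inner_smul_right, hue, norm_smul, norm_smul, hu, he,
        mul_one, mul_one, Real.norm_eq_abs, Real.norm_eq_abs, sq_abs, sq_abs, Real.sq_sqrt h1]
      simp
    have h3 := norm_nonneg (t • u + √(1 - t ^ 2) • e)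
    nlinarith
  · rw [inner_add_right, inner_smul_right, inner_smul_right, hue, real_inner_self_eq_norm_sq, hu]
    ring

/-- Spherical convolution with a power of the height function. -/
theorem exists_conv_pow (hn : 2 ≤ n) {f : ℝ → ℝ} (hf : Continuous f) (m : ℕ) :
    ∃ Q : Polynomial ℝ, Q.natDegree ≤ m ∧ ∀ u w : En n, ‖u‖ = 1 → ‖w‖ = 1 →
      ∫ v : Sph n, f ⟪u, (v : En n)⟫_ℝ * ⟪w, (v : En n)⟫_ℝ ^ m ∂(sphVol n) =
        Q.eval ⟪u, w⟫_ℝ := by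
  obtain ⟨e₀, he₀, hue₀⟩ := exists_orthogonal_unit hn (norm_pole (n := n) (by omega))
  set c : ℕ → ℝ := fun j => ∫ v : Sph n, f ⟪pole n, (v : En n)⟫_ℝ *
    (⟪pole n, (v : En n)⟫_ℝ ^ (m - j) * ⟪e₀, (v : En n)⟫_ℝ ^ j) ∂(sphVol n) with hc
  refine ⟨∑ j ∈ Finset.range (m + 1), if Even j then
    Polynomial.C ((m.choose j : ℝ) * c j) * (Polynomial.X ^ (m - j) *
      (1 - Polynomial.X ^ 2) ^ (j / 2)) else 0, ?_, ?_⟩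
  · refine Polynomial.natDegree_sum_le_of_forall_le _ _ fun j hj => ?_
    have hj' := Finset.mem_range.1 hj
    split_ifs with h
    · refine (Polynomial.natDegree_C_mul_le _ _).trans (Polynomial.natDegree_mul_le.trans ?_)
      have h1 : ((1 - Polynomial.X ^ 2 : Polynomial ℝ) ^ (j / 2)).natDegree ≤ j / 2 * 2 := by
        refine Polynomial.natDegree_pow_le.trans (Nat.mul_le_mul_left _ ?_)
        exact (Polynomial.natDegree_sub_le _ _).trans (by simp)
      rw [Polynomial.natDegree_X_pow]
      omega
    · simp
  · intro u w hu hw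
    obtain ⟨e, σ, he, hue, hσ, hdec⟩ := exists_decomp hn hu hw
    set τ := ⟪u, w⟫_ℝ
    have hcj : ∀ j, c j = ∫ v : Sph n, f ⟪u, (v : En n)⟫_ℝ *
        (⟪u, (v : En n)⟫_ℝ ^ (m - j) * ⟪e, (v : En n)⟫_ℝ ^ j) ∂(sphVol n) := fun j =>
      integral_pair_eq hn (fun t s => f t * (t ^ (m - j) * s ^ j)) (norm_pole (by omega)) he₀ hue₀
        hu he hue
    have hodd : ∀ j, ¬ Even j → c j = 0 := by
      intro j hj
      have h1 := integral_pair_eq hn (fun t s => f t * (t ^ (m - j) * s ^ j))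
        (norm_pole (by omega)) he₀ hue₀ (norm_pole (n := n) (by omega)) (by rwa [norm_neg])
        (by rw [inner_neg_right, hue₀, neg_zero] : ⟪pole n, -e₀⟫_ℝ = 0)
      simp only [inner_neg_left, (Nat.not_even_iff_odd.1 hj).neg_pow, mul_neg,
        integral_neg] at h1
      change c j = -c j at h1
      linarith
    have h3 : ∀ v : Sph n, f ⟪u, (v : En n)⟫_ℝ * ⟪w, (v : En n)⟫_ℝ ^ m =
        ∑ j ∈ Finset.range (m + 1), ((m.choose j : ℝ) * (τ ^ (m - j) * σ ^ j)) *
          (f ⟪u, (v : En n)⟫_ℝ * (⟪u, (v : En n)⟫_ℝ ^ (m - j) * ⟪e, (v : En n)⟫_ℝ ^ j)) := by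
      intro v
      have : ⟪w, (v : En n)⟫_ℝ = σ * ⟪e, (v : En n)⟫_ℝ + τ * ⟪u, (v : En n)⟫_ℝ := by
        conv_lhs => rw [hdec]
        rw [inner_add_left, real_inner_smul_left, real_inner_smul_left, add_comm]
      rw [this, add_pow, Finset.mul_sum]
      refine Finset.sum_congr rfl fun j _ => ?_
      rw [mul_pow, mul_pow]; ring
    rw [integral_congr_ae (.of_forall h3), integral_finsetSum]
    · rw [Polynomial.eval_finsetSum]
      refine Finset.sum_congr rfl fun j _ => ?_
      rw [integral_const_mul, ← hcj]
      split_ifs with h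
      · obtain ⟨i, rfl⟩ := h
        have h2 : (i + i) / 2 = i := by omega
        simp only [Polynomial.eval_mul, Polynomial.eval_C, Polynomial.eval_pow,
          Polynomial.eval_X, Polynomial.eval_sub, Polynomial.eval_one]
        rw [h2, ← hσ]; ring
      · rw [hodd j h]; simp
    · intro j _
      exact integrable_of_continuous (by fun_prop)

/-- Spherical convolution with a polynomial zonal function. -/
theorem exists_conv (hn : 2 ≤ n) {f : ℝ → ℝ} (hf : Continuous f) (q : Polynomial ℝ) :
    ∃ Q : Polynomial ℝ, Q.natDegree ≤ q.natDegree ∧ ∀ u w : En n, ‖u‖ = 1 → ‖w‖ = 1 →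
      ∫ v : Sph n, f ⟪u, (v : En n)⟫_ℝ * q.eval ⟪w, (v : En n)⟫_ℝ ∂(sphVol n) =
        Q.eval ⟪u, w⟫_ℝ := by
  choose Q hQd hQ using fun m => exists_conv_pow hn hf m
  refine ⟨∑ j ∈ Finset.range (q.natDegree + 1), Polynomial.C (q.coeff j) * Q j, ?_, ?_⟩
  · refine Polynomial.natDegree_sum_le_of_forall_le _ _ fun j hj => ?_
    exact (Polynomial.natDegree_C_mul_le _ _).trans
      ((hQd j).trans (Nat.lt_succ_iff.1 (Finset.mem_range.1 hj)))
  · intro u w hu hw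
    simp only [Polynomial.eval_eq_sum_range, Finset.mul_sum]
    rw [integral_finsetSum]
    · rw [← Polynomial.eval_eq_sum_range, Polynomial.eval_finsetSum]
      refine Finset.sum_congr rfl fun j _ => ?_
      rw [Polynomial.eval_mul, Polynomial.eval_C, ← hQ j u w hu hw, ← integral_const_mul]
      refine integral_congr_ae (.of_forall fun v => ?_)
      simp only; ring
    · intro j _
      exact integrable_of_continuous (by fun_prop)

theorem integral_integral_swap_sph {F : Sph n → Sph n → ℝ}
    (hF : Continuous (Function.uncurry F)) :
    ∫ u, ∫ v, F u v ∂(sphVol n) ∂(sphVol n) = ∫ v, ∫ u, F u v ∂(sphVol n) ∂(sphVol n) :=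
  integral_integral_swap (hF.integrable_of_hasCompactSupport
    (HasCompactSupport.of_compactSpace _))

theorem poly_eq_zero_of_zonalInt_sq (hn : 2 ≤ n) {r : Polynomial ℝ}
    (h : zonalInt n (r * r) = 0) : r = 0 := by
  have hcont : Continuous fun v : Sph n => (r * r).eval ⟪pole n, (v : En n)⟫_ℝ :=
    continuous_eval_inner _ _
  have h1 : (fun v : Sph n => (r * r).eval ⟪pole n, (v : En n)⟫_ℝ) = 0 := by
    refine (Continuous.ae_eq_iff_eq (sphVol n) hcont continuous_const).1
      ((integral_eq_zero_iff_of_nonneg ?_ (integrable_of_continuous hcont)).1 h)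
    intro v
    simp only [Polynomial.eval_mul, Pi.zero_apply]
    exact mul_self_nonneg _
  refine Polynomial.eq_zero_of_infinite_isRoot r ((Set.Icc_infinite
    (by norm_num : (-1 : ℝ) < 1)).mono fun t ht => ?_)
  obtain ⟨w, hw, rfl⟩ := exists_inner_eq hn (norm_pole (n := n) (by omega)) ht
  have := congrFun h1 ⟨w, by simpa using hw⟩
  simpa [Polynomial.eval_mul] using this

/-- The Funk–Hecke formula. -/
theorem funk_hecke (hn : 3 ≤ n) {f : ℝ → ℝ} (hf : Continuous f) (k : ℕ) {u w : En n}
    (hu : ‖u‖ = 1) (hw : ‖w‖ = 1) :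
    ∫ v : Sph n, f ⟪u, (v : En n)⟫_ℝ * (legPoly n k).eval ⟪w, (v : En n)⟫_ℝ ∂(sphVol n) =
      (∫ v : Sph n, f ⟪pole n, (v : En n)⟫_ℝ *
        (legPoly n k).eval ⟪pole n, (v : En n)⟫_ℝ ∂(sphVol n)) *
          (legPoly n k).eval ⟪u, w⟫_ℝ := by
  have hn2 : 2 ≤ n := by omega
  have hp : ‖pole n‖ = 1 := norm_pole (by omega)
  obtain ⟨Q, hQd, hQ⟩ := exists_conv hn2 hf (legPoly n k)
  rw [legPoly_natDegree hn] at hQd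
  have horth : ∀ r : Polynomial ℝ, r.degree < k → zonalInt n (Q * r) = 0 := by
    intro r hr
    obtain ⟨R, hRd, hR⟩ := exists_conv hn2 hf r
    have h1 : zonalInt n (Q * r) = ∫ x : Sph n, ∫ v : Sph n, (f ⟪(x : En n), (v : En n)⟫_ℝ *
        (legPoly n k).eval ⟪pole n, (v : En n)⟫_ℝ) * r.eval ⟪pole n, (x : En n)⟫_ℝ
          ∂(sphVol n) ∂(sphVol n) := by
      refine integral_congr_ae (.of_forall fun x => ?_)
      simp only [Polynomial.eval_mul]
      rw [integral_mul_const, hQ _ _ (norm_eq_of_mem_sphere x) hp, real_inner_comm]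
    have h2 : ∫ v : Sph n, ∫ x : Sph n, (f ⟪(x : En n), (v : En n)⟫_ℝ *
        (legPoly n k).eval ⟪pole n, (v : En n)⟫_ℝ) * r.eval ⟪pole n, (x : En n)⟫_ℝ
          ∂(sphVol n) ∂(sphVol n) = zonalInt n (legPoly n k * R) := by
      refine integral_congr_ae (.of_forall fun v => ?_)
      simp only [Polynomial.eval_mul]
      rw [real_inner_comm, ← hR _ _ (norm_eq_of_mem_sphere v) hp, ← integral_const_mul]
      refine integral_congr_ae (.of_forall fun x => ?_)
      simp only [real_inner_comm]; ring
    rw [h1, integral_integral_swap_sph, h2]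
    · by_cases hr0 : r = 0
      · subst hr0
        have hR0 : ∀ t ∈ Set.Icc (-1 : ℝ) 1, R.eval t = 0 := by
          intro t ht
          obtain ⟨y, hy, rfl⟩ := exists_inner_eq hn2 hp ht
          rw [← hR _ _ hp hy]; simp
        have : R = 0 := Polynomial.eq_zero_of_infinite_isRoot R ((Set.Icc_infinite
          (by norm_num : (-1 : ℝ) < 1)).mono fun t ht => hR0 t ht)
        simp [this, zonalInt]
      · refine zonalInt_legPoly_mul_of_degree_lt hn ?_
        refine Polynomial.degree_le_natDegree.trans_lt (lt_of_le_of_lt ?_ hr)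
        rw [Polynomial.degree_eq_natDegree hr0]
        exact_mod_cast hRd
    · have := (legPoly n k).continuous
      have := r.continuous
      fun_prop
  have hQspan := mem_span_legPoly hn (k + 1) Q (Polynomial.degree_le_natDegree.trans_lt (by
    exact_mod_cast Nat.lt_succ_of_le hQd))
  rw [show Set.Iio (k + 1) = insert k (Set.Iio k) by ext; simp,
    Set.image_insert_eq, Submodule.mem_span_insert] at hQspan
  obtain ⟨c, z, hz, hQz⟩ := hQspan
  have hzdeg : z.degree < k := by
    rw [← Polynomial.mem_degreeLT]
    refine Submodule.span_le.2 ?_ hz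
    rintro _ ⟨j, hj, rfl⟩
    rw [SetLike.mem_coe, Polynomial.mem_degreeLT]
    refine Polynomial.degree_le_natDegree.trans_lt ?_
    rw [legPoly_natDegree hn]
    exact_mod_cast hj
  have hz0 : z = 0 := by
    refine poly_eq_zero_of_zonalInt_sq hn2 ?_
    have h1 := horth z hzdeg
    rwa [hQz, add_mul, zonalInt_add, smul_mul_assoc, Polynomial.smul_eq_C_mul, zonalInt_C_mul,
      zonalInt_legPoly_mul_of_degree_lt hn hzdeg, mul_zero, zero_add] at h1
  rw [hz0, add_zero] at hQz
  have hc : c = ∫ v : Sph n, f ⟪pole n, (v : En n)⟫_ℝ *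
        (legPoly n k).eval ⟪pole n, (v : En n)⟫_ℝ ∂(sphVol n) := by
    rw [hQ _ _ hp hp, hQz, real_inner_self_eq_norm_sq, hp]
    simp [legPoly_eval_one hn]
  rw [hQ _ _ hu hw, ← hc, hQz]
  simp

/-- The squared `L²` norm of the zonal harmonic of degree `k`. -/
def legNormSq (n k : ℕ) : ℝ := zonalInt n (legPoly n k * legPoly n k)

theorem legNormSq_pos (hn : 3 ≤ n) (k : ℕ) : 0 < legNormSq n k := by
  refine lt_of_le_of_ne ?_ (Ne.symm fun h => ?_)
  · refine integral_nonneg fun v => ?_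
    simp only [Polynomial.eval_mul, Pi.zero_apply]
    exact mul_self_nonneg _
  · have h1 := poly_eq_zero_of_zonalInt_sq (by omega) h
    have h2 := legPoly_eval_one hn k
    simp [h1] at h2

theorem integral_legPoly_mul_legPoly (hn : 3 ≤ n) (j k : ℕ) {u w : En n}
    (hu : ‖u‖ = 1) (hw : ‖w‖ = 1) :
    ∫ v : Sph n, (legPoly n j).eval ⟪u, (v : En n)⟫_ℝ *
      (legPoly n k).eval ⟪w, (v : En n)⟫_ℝ ∂(sphVol n) =
      if j = k then legNormSq n k * (legPoly n k).eval ⟪u, w⟫_ℝ else 0 := by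
  rw [funk_hecke hn (legPoly n j).continuous k hu hw]
  split_ifs with h
  · subst h
    simp [legNormSq, zonalInt, Polynomial.eval_mul]
  · have := zonalInt_legPoly_mul hn h
    simp only [zonalInt, Polynomial.eval_mul] at this
    rw [this, zero_mul]

theorem abs_legPoly_eval_le (hn : 3 ≤ n) (k : ℕ) {t : ℝ} (ht : t ∈ Set.Icc (-1 : ℝ) 1) :
    |(legPoly n k).eval t| ≤ 1 := by
  have hn2 : 2 ≤ n := by omega
  have hp : ‖pole n‖ = 1 := norm_pole (by omega)
  obtain ⟨w, hw, rfl⟩ := exists_inner_eq hn2 hp ht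
  have h1 := integral_legPoly_mul_legPoly hn k k hp hw
  have h2 := integral_legPoly_mul_legPoly hn k k hp hp
  have h3 := integral_legPoly_mul_legPoly hn k k hw hw
  rw [if_pos rfl] at h1 h2 h3
  rw [real_inner_self_eq_norm_sq, hp, one_pow, legPoly_eval_one hn, mul_one] at h2
  rw [real_inner_self_eq_norm_sq, hw, one_pow, legPoly_eval_one hn, mul_one] at h3
  have hpos := legNormSq_pos hn k
  have hint : ∀ a b : En n, Integrable (fun v : Sph n => (legPoly n k).eval ⟪a, (v : En n)⟫_ℝ *
      (legPoly n k).eval ⟪b, (v : En n)⟫_ℝ) (sphVol n) := fun a b =>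
    integrable_of_continuous ((continuous_eval_inner _ _).mul (continuous_eval_inner _ _))
  have hle : ∀ s : ℝ, s ^ 2 = 1 → s * (legNormSq n k * (legPoly n k).eval ⟪pole n, w⟫_ℝ) ≤
      legNormSq n k := by
    intro s hs
    have h4 : ∫ v : Sph n, s * ((legPoly n k).eval ⟪pole n, (v : En n)⟫_ℝ *
        (legPoly n k).eval ⟪w, (v : En n)⟫_ℝ) ∂(sphVol n) ≤
        ∫ v : Sph n, (1 / 2) * ((legPoly n k).eval ⟪pole n, (v : En n)⟫_ℝ *
        (legPoly n k).eval ⟪pole n, (v : En n)⟫_ℝ + (legPoly n k).eval ⟪w, (v : En n)⟫_ℝ *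
        (legPoly n k).eval ⟪w, (v : En n)⟫_ℝ) ∂(sphVol n) := by
      refine integral_mono ((hint _ _).const_mul _) (((hint _ _).add (hint _ _)).const_mul _)
        fun v => ?_
      simp only
      nlinarith [sq_nonneg ((legPoly n k).eval ⟪pole n, (v : En n)⟫_ℝ -
        s * (legPoly n k).eval ⟪w, (v : En n)⟫_ℝ)]
    rw [integral_const_mul, integral_const_mul, integral_add (hint _ _) (hint _ _), h1, h2, h3]
      at h4
    linarith
  rw [abs_le]
  have a1 := hle 1 (by norm_num)
  have a2 := hle (-1) (by norm_num)
  constructor <;> nlinarith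

/-- The zonal harmonic of degree `k` with axis `w`. -/
def zonal (k : ℕ) (w : En n) : C(Sph n, ℝ) :=
  ⟨fun v => (legPoly n k).eval ⟪w, (v : En n)⟫_ℝ, continuous_eval_inner _ _⟩

@[simp] theorem zonal_apply (k : ℕ) (w : En n) (v : Sph n) :
    zonal k w v = (legPoly n k).eval ⟪w, (v : En n)⟫_ℝ := rfl

/-- The span of the zonal harmonics of degree less than `d`. -/
def zonalSpan (n d : ℕ) : Submodule ℝ C(Sph n, ℝ) :=
  Submodule.span ℝ {f | ∃ k < d, ∃ w : En n, ‖w‖ = 1 ∧ f = zonal k w}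

theorem zonalSpan_mono {d d' : ℕ} (h : d ≤ d') : zonalSpan n d ≤ zonalSpan n d' := by
  refine Submodule.span_mono ?_
  rintro _ ⟨k, hk, w, hw, rfl⟩
  exact ⟨k, hk.trans_le h, w, hw, rfl⟩

/-- The restriction of a power of a linear form to the sphere. -/
def innerPow (w : En n) (m : ℕ) : C(Sph n, ℝ) :=
  ⟨fun v => ⟪w, (v : En n)⟫_ℝ ^ m, by fun_prop⟩

theorem innerPow_mem_zonalSpan (hn : 3 ≤ n) (w : En n) (m : ℕ) :
    innerPow w m ∈ zonalSpan n (m + 1) := by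
  have key : ∀ w : En n, ‖w‖ = 1 → innerPow w m ∈ zonalSpan n (m + 1) := by
    intro w hw
    have h := mem_span_legPoly hn (m + 1) (Polynomial.X ^ m) (by
      rw [Polynomial.degree_X_pow]; exact_mod_cast Nat.lt_succ_self m)
    let T : Polynomial ℝ →ₗ[ℝ] C(Sph n, ℝ) :=
      { toFun := fun p => ⟨fun v => p.eval ⟪w, (v : En n)⟫_ℝ, continuous_eval_inner _ _⟩
        map_add' := fun p q => by ext; simp
        map_smul' := fun a p => by ext; simp }
    have h1 : T (Polynomial.X ^ m) ∈ (zonalSpan n (m + 1)) := by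
      have : Submodule.span ℝ (legPoly n '' Set.Iio (m + 1)) ≤ (zonalSpan n (m + 1)).comap T := by
        rw [Submodule.span_le]
        rintro _ ⟨k, hk, rfl⟩
        exact Submodule.subset_span ⟨k, hk, w, hw, rfl⟩
      exact this h
    convert h1 using 1
    ext v
    simp [T, innerPow]
  by_cases hw : w = 0
  · rcases Nat.eq_zero_or_pos m with rfl | hm
    · convert key (pole n) (norm_pole (by omega)) using 1
      ext v; simp [innerPow]
    · convert Submodule.zero_mem _ using 1
      ext v; simp [innerPow, hw, hm.ne']
  · have hw' : ‖w‖ ≠ 0 := norm_ne_zero_iff.2 hw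
    convert Submodule.smul_mem _ (‖w‖ ^ m) (key (‖w‖⁻¹ • w)
      (by rw [norm_smul, norm_inv, norm_norm, inv_mul_cancel₀ hw'])) using 1
    ext v
    simp only [innerPow, ContinuousMap.coe_mk, ContinuousMap.coe_smul, Pi.smul_apply, smul_eq_mul]
    rw [← mul_pow, real_inner_smul_left, ← mul_assoc, mul_inv_cancel₀ hw', one_mul]

/-- Restriction of polynomials to the sphere. -/
def restrPoly (n : ℕ) : MvPolynomial (Fin n) ℝ →ₐ[ℝ] C(Sph n, ℝ) :=
  MvPolynomial.aeval fun j => ⟨fun v => (v : En n) j, by fun_prop⟩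

theorem restrPoly_apply (p : MvPolynomial (Fin n) ℝ) (v : Sph n) :
    restrPoly n p v = MvPolynomial.eval (fun j => (v : En n) j) p := by
  induction p using MvPolynomial.induction_on with
  | C a => simp [restrPoly]
  | add p q hp hq => simp [hp, hq]
  | mul_X p i hp =>
    rw [map_mul, map_mul, ContinuousMap.mul_apply, hp]
    simp [restrPoly]

theorem prod_coord_mem_zonalSpan (hn : 3 ≤ n) (m : ℕ) (idx : Fin m → Fin n) :
    restrPoly n (∏ k, MvPolynomial.X (idx k)) ∈ zonalSpan n (m + 1) := by
  have h : restrPoly n (∏ k, MvPolynomial.X (idx k)) = ((m.factorial : ℝ))⁻¹ •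
      ∑ T : Finset (Fin m), (-1 : ℝ) ^ (m - T.card) •
        innerPow (∑ k ∈ T, EuclideanSpace.single (idx k) (1 : ℝ)) m := by
    ext v
    have h1 := ryser (m := m) (fun _ => 0) (fun _ k => (v : En n) (idx k))
    simp only [zero_add, Finset.prod_const, Finset.card_univ, Fintype.card_fin] at h1
    have h2 : ∀ σ : Equiv.Perm (Fin m), ∏ j, (v : En n) (idx (σ j)) = ∏ j, (v : En n) (idx j) :=
      fun σ => Equiv.prod_comp σ fun j => (v : En n) (idx j)
    simp only [h2, Finset.sum_const, Finset.card_univ, Fintype.card_perm, Fintype.card_fin,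
      nsmul_eq_mul] at h1
    rw [restrPoly_apply]
    simp only [map_prod, MvPolynomial.eval_X, innerPow, ContinuousMap.smul_apply,
      ContinuousMap.coe_sum, Finset.sum_apply, ContinuousMap.coe_mk, smul_eq_mul,
      sum_inner, EuclideanSpace.inner_single_left, map_one, one_mul]
    rw [h1, ← mul_assoc, inv_mul_cancel₀ (by positivity), one_mul]
  rw [h]
  exact Submodule.smul_mem _ _ (Submodule.sum_mem _ fun T _ =>
    Submodule.smul_mem _ _ (innerPow_mem_zonalSpan hn _ _))

theorem restrPoly_mem_zonalSpan (hn : 3 ≤ n) (p : MvPolynomial (Fin n) ℝ) {d : ℕ}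
    (hd : p.totalDegree < d) : restrPoly n p ∈ zonalSpan n d := by
  rw [p.as_sum, map_sum]
  refine Submodule.sum_mem _ fun s hs => ?_
  have h1 : MvPolynomial.monomial s (p.coeff s) =
      (p.coeff s) • MvPolynomial.monomial s (1 : ℝ) := by
    rw [MvPolynomial.smul_monomial, smul_eq_mul, mul_one]
  rw [h1, map_smul]
  refine Submodule.smul_mem _ _ ?_
  obtain ⟨l, hl⟩ := Quot.exists_rep (Finsupp.toMultiset s)
  have h2 : MvPolynomial.monomial s (1 : ℝ) =
      ∏ k : Fin l.length, MvPolynomial.X (l[k]) := by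
    rw [MvPolynomial.monomial_eq, map_one, one_mul]
    have h3 : (s.prod fun i e => (MvPolynomial.X i : MvPolynomial (Fin n) ℝ) ^ e) =
        ((Finsupp.toMultiset s).map MvPolynomial.X).prod := by
      rw [Finsupp.toMultiset_map, Finsupp.prod_toMultiset,
        Finsupp.prod_mapDomain_index (by simp) (by simp [pow_add])]
    rw [h3, ← hl]
    change ((l : Multiset (Fin n)).map MvPolynomial.X).prod = _
    rw [Multiset.map_coe, Multiset.prod_coe]
    exact (Fin.prod_univ_fun_getElem l MvPolynomial.X).symm
  rw [h2]
  refine zonalSpan_mono ?_ (prod_coord_mem_zonalSpan hn _ _)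
  have h4 := MvPolynomial.le_totalDegree hs
  have h5 : l.length = s.sum fun _ e => e := by
    have h6 := Finsupp.card_toMultiset s
    rw [← hl] at h6
    exact h6
  omega

/-- The zonal harmonics span a dense subspace of the continuous functions. -/
theorem exists_zonalSpan_approx (hn : 3 ≤ n) (f : C(Sph n, ℝ)) {ε : ℝ} (hε : 0 < ε) :
    ∃ d, ∃ p ∈ zonalSpan n d, ‖f - p‖ < ε := by
  have hsep : (restrPoly n).range.SeparatesPoints := by
    intro x y hxy
    by_contra! h
    refine hxy (Subtype.ext (PiLp.ext fun j => ?_))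
    have := h _ ⟨restrPoly n (MvPolynomial.X j), ⟨_, rfl⟩, rfl⟩
    simpa [restrPoly_apply] using this
  have htop := ContinuousMap.subalgebra_topologicalClosure_eq_top_of_separatesPoints _ hsep
  have hf : f ∈ (restrPoly n).range.topologicalClosure := by rw [htop]; trivial
  obtain ⟨_, ⟨p, rfl⟩, hp⟩ := Metric.mem_closure_iff.1 hf ε hε
  refine ⟨p.totalDegree + 1, _, restrPoly_mem_zonalSpan hn p (Nat.lt_succ_self _), ?_⟩
  rwa [← dist_eq_norm]

theorem integral_zonalSpan_mul_zonal (hn : 3 ≤ n) {l : ℕ} {p : C(Sph n, ℝ)}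
    (hp : p ∈ zonalSpan n l) {w : En n} (hw : ‖w‖ = 1) :
    ∫ v, p v * zonal l w v ∂(sphVol n) = 0 := by
  induction hp using Submodule.span_induction with
  | mem x hx =>
    obtain ⟨k, hk, w', hw', rfl⟩ := hx
    simp only [zonal_apply]
    rw [integral_legPoly_mul_legPoly hn k l hw' hw, if_neg hk.ne]
  | zero => simp
  | add x y _ _ hx hy =>
    simp only [ContinuousMap.add_apply, add_mul]
    rw [integral_add (integrable_of_continuous (by fun_prop))
      (integrable_of_continuous (by fun_prop)), hx, hy, add_zero]
  | smul a x _ hx =>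
    simp only [ContinuousMap.smul_apply, smul_eq_mul, mul_assoc]
    rw [integral_const_mul, hx, mul_zero]

theorem one_sub_legPoly_le (hn : 3 ≤ n) {k : ℕ} (hk : 0 < k) {t : ℝ}
    (ht : t ∈ Set.Icc (-1 : ℝ) 1) : 1 - (legPoly n k).eval t ≤ (k : ℝ) ^ 2 * (1 - t) := by
  obtain ⟨j, rfl⟩ : ∃ j, k = j + 1 := ⟨k - 1, by omega⟩
  have h3 : (3 : ℝ) ≤ n := by exact_mod_cast hn
  have hbound : ∀ x ∈ Set.Icc (-1 : ℝ) 1,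
      ‖(Polynomial.derivative (legPoly n (j + 1))).eval x‖ ≤ ((j + 1 : ℕ) : ℝ) ^ 2 := by
    intro x hx
    rw [derivative_legPoly hn, Polynomial.eval_mul, Polynomial.eval_C, norm_mul]
    have h1 := abs_legPoly_eval_le (n := n + 2) (by omega) j hx
    have h4 : (0 : ℝ) ≤ j := by positivity
    have h2 : ‖((j : ℝ) + 1) * (j + n - 1) / (n - 1)‖ ≤ ((j + 1 : ℕ) : ℝ) ^ 2 := by
      rw [Real.norm_eq_abs, abs_of_nonneg (by
        apply div_nonneg <;> [apply mul_nonneg; skip] <;> linarith)]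
      rw [div_le_iff₀ (by linarith)]
      push_cast
      have : (j : ℝ) + n - 1 ≤ (j + 1) * (n - 1) := by nlinarith
      nlinarith
    calc _ ≤ ((j + 1 : ℕ) : ℝ) ^ 2 * 1 := by
          refine mul_le_mul h2 h1 (abs_nonneg _) (by positivity)
      _ = _ := mul_one _
  have h := (convex_Icc (-1 : ℝ) 1).norm_image_sub_le_of_norm_hasDerivWithin_le
    (fun x _ => ((legPoly n (j + 1)).hasDerivAt x).hasDerivWithinAt) hbound ht
    (by norm_num : (1 : ℝ) ∈ Set.Icc (-1 : ℝ) 1)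
  rw [legPoly_eval_one hn, Real.norm_eq_abs, Real.norm_eq_abs,
    abs_of_nonneg (by linarith [ht.2] : 0 ≤ 1 - t)] at h
  exact (le_abs_self _).trans h

theorem exists_legNormSq_lower (hn : 3 ≤ n) :
    ∃ c > (0 : ℝ), ∀ k : ℕ, 0 < k → c ≤ legNormSq n k * (k : ℝ) ^ n := by
  have hpos : 0 < (volume : Measure (En n)).real (ball 0 1) := by
    rw [measureReal_def]
    exact ENNReal.toReal_pos (isOpen_ball.measure_ne_zero _ (by simp)) measure_ball_lt_top.ne
  refine ⟨(1 / 4) * (n * (1 / 4) ^ n * (volume : Measure (En n)).real (ball 0 1)),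
    by positivity, fun k hk => ?_⟩
  have hk1 : (1 : ℝ) ≤ k := by exact_mod_cast hk
  set e : Sph n := ⟨pole n, by simpa using norm_pole (n := n) (by omega)⟩
  have h1 := Measure.toSphereBallBound_mul_measureReal_unitBall_le_toSphere_ball
    (volume : Measure (En n)) (ε := 1 / (k : ℝ)) (by positivity) e
  have hε : (0 : ℝ) < 1 / k := by positivity
  have hε1 : 1 / (k : ℝ) ≤ 1 := by rw [div_le_one (by linarith)]; exact hk1
  have h2 : (Measure.toSphereBallBound (Module.finrank ℝ (En n)) (1 / (k : ℝ)) : ℝ) =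
      n * (1 / k / 4) ^ n := by
    rw [Measure.toSphereBallBound, finrank_euclideanSpace, Fintype.card_fin,
      if_pos ⟨by omega, hε⟩, min_eq_left]
    · push_cast
      rw [Real.coe_toNNReal _ hε.le]
    · rw [Real.toNNReal_le_iff_le_coe]; push_cast; linarith
  rw [h2] at h1
  have h3 : (1 / 4 : ℝ) * (sphVol n).real (ball e (1 / (k : ℝ))) ≤ legNormSq n k := by
    have h4 : ∫ v in ball e (1 / (k : ℝ)), (1 / 4 : ℝ) ∂(sphVol n) ≤
        ∫ v in ball e (1 / (k : ℝ)), (legPoly n k * legPoly n k).eval ⟪pole n, (v : En n)⟫_ℝ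
          ∂(sphVol n) := by
      refine setIntegral_mono_on (integrable_const _).integrableOn
        (integrable_of_continuous (continuous_eval_inner _ _)).integrableOn
        measurableSet_ball fun v hv => ?_
      rw [Polynomial.eval_mul]
      have hd : ‖(v : En n) - pole n‖ < 1 / k := by
        rw [mem_ball, Subtype.dist_eq, dist_eq_norm] at hv; exact hv
      have h5 := norm_sub_sq_real (v : En n) (pole n)
      rw [norm_eq_of_mem_sphere, norm_pole (by omega), real_inner_comm] at h5
      have h6 : ‖(v : En n) - pole n‖ ^ 2 ≤ (1 / k) ^ 2 := by
        gcongr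
      have h7 := one_sub_legPoly_le hn hk (inner_mem_Icc (norm_pole (n := n) (by omega))
        (norm_eq_of_mem_sphere v))
      have h8 : (k : ℝ) ^ 2 * (1 - ⟪pole n, (v : En n)⟫_ℝ) ≤ 1 / 2 := by
        have : 1 - ⟪pole n, (v : En n)⟫_ℝ ≤ (1 / k) ^ 2 / 2 := by linarith
        calc _ ≤ (k : ℝ) ^ 2 * ((1 / k) ^ 2 / 2) := by gcongr
          _ = 1 / 2 := by field_simp
      nlinarith
    rw [setIntegral_const, smul_eq_mul, mul_comm] at h4
    refine h4.trans (setIntegral_le_integral (integrable_of_continuous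
      (continuous_eval_inner _ _)) (.of_forall fun v => ?_))
    simp only [Polynomial.eval_mul, Pi.zero_apply]
    exact mul_self_nonneg _
  have h9 : (1 / 4) * (n * (1 / k / 4) ^ n * (volume : Measure (En n)).real (ball 0 1)) ≤
      legNormSq n k := by
    refine le_trans ?_ h3
    exact mul_le_mul_of_nonneg_left h1 (by norm_num)
  calc (1 / 4) * (n * (1 / 4) ^ n * (volume : Measure (En n)).real (ball 0 1))
      = (1 / 4) * (n * (1 / k / 4) ^ n * (volume : Measure (En n)).real (ball 0 1)) *
        (k : ℝ) ^ n := by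
        rw [show (1 / (k : ℝ) / 4) = (1 / 4) * (k : ℝ)⁻¹ by field_simp, mul_pow, inv_pow]
        field_simp
    _ ≤ _ := by gcongr

theorem multSph_eq (hn : 3 ≤ n) (k : ℕ) (F : En n → ℝ) :
    multSph k F = ∫ v : Sph n, F v * (legPoly n k).eval ⟪pole n, (v : En n)⟫_ℝ ∂(sphVol n) := by
  have hp : ‖pole n‖ = 1 := norm_pole (by omega)
  set e : Sph n := ⟨pole n, by simpa using hp⟩
  refine integral_congr_ae ?_
  have hnull : ∀ x : Sph n, ∀ᵐ v ∂(sphVol n), v ≠ x := fun x => by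
    rw [ae_iff]; simpa using sphVol_singleton (by omega) x
  filter_upwards [hnull e, hnull (-e)] with v h1 h2
  have h := inner_mem_Icc hp (norm_eq_of_mem_sphere v)
  rw [legendreP_eq hn]
  refine ⟨lt_of_le_of_ne h.1 fun h3 => h2 ?_, lt_of_le_of_ne h.2 fun h3 => h1 ?_⟩
  · have := (inner_eq_one_iff_of_norm_eq_one (𝕜 := ℝ) (x := -pole n) (y := (v : En n))
      (by simpa using hp) (norm_eq_of_mem_sphere v)).1 (by rw [inner_neg_left, ← h3, neg_neg])
    ext1; simpa [e] using this.symm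
  · have := (inner_eq_one_iff_of_norm_eq_one (𝕜 := ℝ) (x := pole n) (y := (v : En n))
      hp (norm_eq_of_mem_sphere v)).1 h3
    ext1; simpa [e] using this.symm

theorem bddAbove_supp (K : ConvexBody (En n)) (x : En n) :
    BddAbove ((fun y => ⟪x, y⟫_ℝ) '' (K : Set (En n))) :=
  (K.isCompact.image (by fun_prop)).bddAbove

theorem inner_le_supp {K : ConvexBody (En n)} {y : En n} (hy : y ∈ K) (x : En n) :
    ⟪x, y⟫_ℝ ≤ supp K x :=
  le_csSup (bddAbove_supp K x) ⟨y, hy, rfl⟩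

theorem exists_eq_supp (K : ConvexBody (En n)) (x : En n) : ∃ y ∈ K, supp K x = ⟪x, y⟫_ℝ := by
  obtain ⟨y, hy, h⟩ := (K.isCompact.image (f := fun y => ⟪x, y⟫_ℝ) (by fun_prop)).sSup_mem
    (K.nonempty.image _)
  exact ⟨y, hy, h.symm⟩

theorem supp_le {K : ConvexBody (En n)} {x : En n} {c : ℝ} (h : ∀ y ∈ K, ⟪x, y⟫_ℝ ≤ c) :
    supp K x ≤ c := by
  obtain ⟨y, hy, hxy⟩ := exists_eq_supp K x
  exact hxy ▸ h y hy

theorem mem_iff_supp (K : ConvexBody (En n)) (y : En n) :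
    y ∈ K ↔ ∀ x, ⟪x, y⟫_ℝ ≤ supp K x := by
  refine ⟨fun hy x => inner_le_supp hy x, fun h => ?_⟩
  by_contra hy
  obtain ⟨f, c, h1, h2⟩ := geometric_hahn_banach_closed_point K.convex K.isClosed hy
  have hf : ∀ z, f z = ⟪(InnerProductSpace.toDual ℝ (En n)).symm f, z⟫_ℝ := by simp
  have h3 : supp K ((InnerProductSpace.toDual ℝ (En n)).symm f) ≤ c :=
    supp_le fun z hz => by rw [← hf]; exact (h1 z hz).le
  have h4 := h ((InnerProductSpace.toDual ℝ (En n)).symm f)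
  rw [← hf] at h4
  linarith

theorem supp_add (K M : ConvexBody (En n)) (x : En n) :
    supp (K + M) x = supp K x + supp M x := by
  apply le_antisymm
  · refine supp_le fun y hy => ?_
    have hy' : y ∈ ((K + M : ConvexBody (En n)) : Set (En n)) := hy
    rw [ConvexBody.coe_add] at hy'
    obtain ⟨a, ha, b, hb, rfl⟩ := hy'
    rw [inner_add_right]
    exact add_le_add (inner_le_supp ha x) (inner_le_supp hb x)
  · obtain ⟨a, ha, h1⟩ := exists_eq_supp K x
    obtain ⟨b, hb, h2⟩ := exists_eq_supp M x
    rw [h1, h2, ← inner_add_right]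
    apply inner_le_supp
    change a + b ∈ ((K + M : ConvexBody (En n)) : Set (En n))
    rw [ConvexBody.coe_add]
    exact Set.add_mem_add ha hb

theorem supp_zero_body (x : En n) : supp (0 : ConvexBody (En n)) x = 0 := by
  simp [supp]

theorem supp_sum {ι : Type*} (S : Finset ι) (Ks : ι → ConvexBody (En n)) (x : En n) :
    supp (∑ k ∈ S, Ks k) x = ∑ k ∈ S, supp (Ks k) x := by
  classical
  induction S using Finset.induction_on with
  | empty => simp [supp_zero_body]
  | insert a s has ih => rw [Finset.sum_insert has, Finset.sum_insert has, supp_add, ih]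

theorem supp_scale {c : ℝ} (hc : 0 ≤ c) (K : ConvexBody (En n)) (x : En n) :
    supp (scale c K) x = c * supp K x := by
  apply le_antisymm
  · refine supp_le ?_
    rintro y ⟨z, hz, rfl⟩
    change ⟪x, c • z⟫_ℝ ≤ _
    rw [inner_smul_right]
    exact mul_le_mul_of_nonneg_left (inner_le_supp hz x) hc
  · obtain ⟨y, hy, h⟩ := exists_eq_supp K x
    rw [h, ← inner_smul_right]
    exact inner_le_supp (K := scale c K) ⟨y, hy, rfl⟩ x

theorem supp_ballB (x : En n) : supp (ballB n) x = ‖x‖ := by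
  apply le_antisymm
  · refine supp_le fun y hy => ?_
    have hy1 : ‖y‖ ≤ 1 := by
      have : y ∈ closedBall (0 : En n) 1 := hy
      simpa using this
    calc ⟪x, y⟫_ℝ ≤ ‖x‖ * ‖y‖ := real_inner_le_norm x y
      _ ≤ ‖x‖ := mul_le_of_le_one_right (norm_nonneg x) hy1
  · by_cases hx : x = 0
    · subst hx
      obtain ⟨y, -, h⟩ := exists_eq_supp (ballB n) 0
      simp [h]
    · have hy : ‖x‖⁻¹ • x ∈ ballB n := by
        change ‖x‖⁻¹ • x ∈ closedBall (0 : En n) 1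
        simp [norm_smul, hx]
      have := inner_le_supp hy x
      rw [inner_smul_right, real_inner_self_eq_norm_sq] at this
      have hx' : ‖x‖ ≠ 0 := by simpa using hx
      field_simp at this
      exact this

theorem scale_scale (a b : ℝ) (K : ConvexBody (En n)) :
    scale a (scale b K) = scale (a * b) K := by
  apply ConvexBody.ext
  change a • (b • (K : Set (En n))) = (a * b) • (K : Set (En n))
  rw [smul_smul]

/-- Subadditive and positively homogeneous functions. -/
structure IsSublin (h : En n → ℝ) : Prop where
  add_le : ∀ x y, h (x + y) ≤ h x + h y
  smul : ∀ c : ℝ, 0 ≤ c → ∀ x, h (c • x) = c * h x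

theorem IsSublin.zero {h : En n → ℝ} (hh : IsSublin h) : h 0 = 0 := by
  simpa using hh.smul 0 le_rfl 0

theorem isSublin_supp (K : ConvexBody (En n)) : IsSublin (supp K) where
  add_le x y := by
    obtain ⟨z, hz, h⟩ := exists_eq_supp K (x + y)
    rw [h, inner_add_left]
    exact add_le_add (inner_le_supp hz x) (inner_le_supp hz y)
  smul c hc x := by
    obtain ⟨z, hz, h⟩ := exists_eq_supp K x
    obtain ⟨w, hw, h'⟩ := exists_eq_supp K (c • x)
    apply le_antisymm
    · rw [h', real_inner_smul_left]
      exact mul_le_mul_of_nonneg_left (inner_le_supp hw x) hc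
    · rw [h, ← real_inner_smul_left]
      exact inner_le_supp hz _

theorem isSublin_norm : IsSublin (fun x : En n => ‖x‖) where
  add_le := norm_add_le
  smul c hc x := by rw [norm_smul, Real.norm_of_nonneg hc]

theorem IsSublin.add {h k : En n → ℝ} (hh : IsSublin h) (hk : IsSublin k) :
    IsSublin (fun x => h x + k x) where
  add_le x y := by linarith [hh.add_le x y, hk.add_le x y]
  smul c hc x := by rw [hh.smul c hc, hk.smul c hc]; ring

/-- Functions of class `C²` away from the origin. -/
def C2off (h : En n → ℝ) : Prop := ContDiffOn ℝ 2 h {0}ᶜ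

theorem C2off.contDiffAt {h : En n → ℝ} (hh : C2off h) {x : En n} (hx : x ≠ 0) :
    ContDiffAt ℝ 2 h x :=
  ContDiffOn.contDiffAt hh (isOpen_compl_singleton.mem_nhds hx)

theorem C2off.add {h k : En n → ℝ} (hh : C2off h) (hk : C2off k) :
    C2off (fun x => h x + k x) := ContDiffOn.add hh hk

theorem c2off_norm : C2off (fun x : En n => ‖x‖) := fun _ hx =>
  (contDiffAt_norm ℝ hx).contDiffWithinAt

theorem C2off.const_mul {h : En n → ℝ} (hh : C2off h) (c : ℝ) :
    C2off (fun x => c * h x) := ContDiffOn.mul contDiffOn_const hh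

theorem C2off.differentiableAt {h : En n → ℝ} (hh : C2off h) {x : En n} (hx : x ≠ 0) :
    DifferentiableAt ℝ h x := (hh.contDiffAt hx).differentiableAt (by norm_num)

theorem C2off.differentiableAt_fderiv {h : En n → ℝ} (hh : C2off h) {x : En n} (hx : x ≠ 0) :
    DifferentiableAt ℝ (fderiv ℝ h) x :=
  ((hh.contDiffAt hx).fderiv_right (m := 1) (by norm_num)).differentiableAt (by norm_num)

/-- Positively `1`-homogeneous functions. -/
def PosHom (h : En n → ℝ) : Prop := ∀ c : ℝ, 0 < c → ∀ x, h (c • x) = c * h x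

theorem IsSublin.posHom {h : En n → ℝ} (hh : IsSublin h) : PosHom h :=
  fun c hc x => hh.smul c hc.le x

theorem PosHom.fderiv_smul {h : En n → ℝ} (hh : PosHom h) {c : ℝ} (hc : 0 < c) (x : En n) :
    fderiv ℝ h (c • x) = fderiv ℝ h x := by
  have h1 : (fun y => h (c • y)) = fun y => c * h y := funext (hh c hc)
  have h2 := fderiv_comp_smul (f := h) (x := x) c
  rw [h1] at h2
  have hc' : c ≠ 0 := hc.ne'
  have h3 : c • (fderiv ℝ h x - fderiv ℝ h (c • x)) = 0 := by
    rw [smul_sub, sub_eq_zero, ← h2]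
    exact (congrFun (fderiv_const_smul_field (f := h) c) x).symm
  rcases smul_eq_zero.1 h3 with h4 | h4
  · exact absurd h4 hc'
  · exact (sub_eq_zero.1 h4).symm

theorem PosHom.fderiv_fderiv_smul {h : En n → ℝ} (hh : PosHom h) {c : ℝ} (hc : 0 < c)
    (x : En n) : fderiv ℝ (fderiv ℝ h) (c • x) = c⁻¹ • fderiv ℝ (fderiv ℝ h) x := by
  have h1 : (fun y => fderiv ℝ h (c • y)) = fderiv ℝ h := funext (hh.fderiv_smul hc)
  have h2 := fderiv_comp_smul (f := fderiv ℝ h) (x := x) c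
  rw [h1] at h2
  rw [h2, smul_smul, inv_mul_cancel₀ hc.ne', one_smul]

theorem PosHom.fderiv_self {h : En n → ℝ} (hh : PosHom h) (h2 : C2off h) {x : En n}
    (hx : x ≠ 0) : fderiv ℝ h x x = h x := by
  have h1 : HasDerivAt (fun t : ℝ => h (t • x)) (fderiv ℝ h x x) 1 := by
    have hd : HasFDerivAt h (fderiv ℝ h x) ((1 : ℝ) • x) := by
      rw [one_smul]; exact (h2.differentiableAt hx).hasFDerivAt
    have := hd.comp_hasDerivAt (1 : ℝ) ((hasDerivAt_id (1 : ℝ)).smul_const x)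
    simpa [Function.comp_def] using this
  have h3 : HasDerivAt (fun t : ℝ => t * h x) (h x) 1 := by
    simpa using (hasDerivAt_id (1 : ℝ)).mul_const (h x)
  refine h1.unique (h3.congr_of_eventuallyEq ?_)
  filter_upwards [lt_mem_nhds (zero_lt_one (α := ℝ))] with t ht
  exact hh t ht x

theorem PosHom.fderiv_fderiv_self {h : En n → ℝ} (hh : PosHom h) (h2 : C2off h) {x : En n}
    (hx : x ≠ 0) : fderiv ℝ (fderiv ℝ h) x x = 0 := by
  have h1 : HasDerivAt (fun t : ℝ => fderiv ℝ h (t • x)) (fderiv ℝ (fderiv ℝ h) x x) 1 := by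
    have hd : HasFDerivAt (fderiv ℝ h) (fderiv ℝ (fderiv ℝ h) x) ((1 : ℝ) • x) := by
      rw [one_smul]; exact (h2.differentiableAt_fderiv hx).hasFDerivAt
    have := hd.comp_hasDerivAt (1 : ℝ) ((hasDerivAt_id (1 : ℝ)).smul_const x)
    simpa [Function.comp_def] using this
  refine h1.unique ((hasDerivAt_const (1 : ℝ) (fderiv ℝ h x)).congr_of_eventuallyEq ?_)
  filter_upwards [lt_mem_nhds (zero_lt_one (α := ℝ))] with t ht
  exact hh.fderiv_smul ht x

theorem C2off.hess_symm {h : En n → ℝ} (h2 : C2off h) {x : En n} (hx : x ≠ 0) (v w : En n) :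
    fderiv ℝ (fderiv ℝ h) x v w = fderiv ℝ (fderiv ℝ h) x w v :=
  (h2.contDiffAt hx).isSymmSndFDerivAt (by simp) v w

theorem IsSublin.fderiv_le {h : En n → ℝ} (hh : IsSublin h) (h2 : C2off h) {x : En n}
    (hx : x ≠ 0) (y : En n) : fderiv ℝ h x y ≤ h y := by
  have h1 : HasDerivAt (fun t : ℝ => h (x + t • y)) (fderiv ℝ h x y) 0 := by
    have hd : HasFDerivAt h (fderiv ℝ h x) (x + (0 : ℝ) • y) := by
      rw [zero_smul, add_zero]; exact (h2.differentiableAt hx).hasFDerivAt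
    have := hd.comp_hasDerivAt (0 : ℝ) (((hasDerivAt_id (0 : ℝ)).smul_const y).const_add x)
    simpa [Function.comp_def] using this
  have h3 := h1.hasDerivWithinAt (s := Set.Ioi 0)
  rw [hasDerivWithinAt_iff_tendsto_slope' (by simp)] at h3
  refine le_of_tendsto h3 ?_
  filter_upwards [self_mem_nhdsWithin] with t ht
  have ht' : (0 : ℝ) < t := ht
  rw [slope_def_field, div_le_iff₀ (by simpa using ht')]
  have := hh.add_le x (t • y)
  rw [hh.smul t ht'.le] at this
  simp only [zero_smul, add_zero, sub_zero]
  linarith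

theorem IsSublin.hess_nonneg {h : En n → ℝ} (hh : IsSublin h) (h2 : C2off h) {x : En n}
    (hx : x ≠ 0) (y : En n) : 0 ≤ fderiv ℝ (fderiv ℝ h) x y y := by
  have h1 : HasDerivAt (fun t : ℝ => fderiv ℝ h (x + t • y) y)
      (fderiv ℝ (fderiv ℝ h) x y y) 0 := by
    have hd : HasFDerivAt (fderiv ℝ h) (fderiv ℝ (fderiv ℝ h) x) (x + (0 : ℝ) • y) := by
      rw [zero_smul, add_zero]; exact (h2.differentiableAt_fderiv hx).hasFDerivAt
    have := hd.comp_hasDerivAt (0 : ℝ) (((hasDerivAt_id (0 : ℝ)).smul_const y).const_add x)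
    have h4 := this.clm_apply (hasDerivAt_const (0 : ℝ) y)
    simpa [Function.comp_def] using h4
  have h3 := h1.hasDerivWithinAt (s := Set.Ioi 0)
  rw [hasDerivWithinAt_iff_tendsto_slope' (by simp)] at h3
  refine ge_of_tendsto h3 ?_
  have hne : ∀ᶠ t : ℝ in 𝓝[>] 0, x + t • y ≠ 0 := by
    have : Tendsto (fun t : ℝ => x + t • y) (𝓝 0) (𝓝 (x + (0 : ℝ) • y)) :=
      (by fun_prop : Continuous fun t : ℝ => x + t • y).tendsto 0
    rw [zero_smul, add_zero] at this
    exact (this.eventually_ne hx).filter_mono nhdsWithin_le_nhds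
  filter_upwards [self_mem_nhdsWithin, hne] with t ht hne
  have ht' : (0 : ℝ) < t := ht
  rw [slope_def_field]
  refine div_nonneg ?_ (by simpa using ht'.le)
  simp only [zero_smul, add_zero]
  have e1 := hh.fderiv_le h2 hx (x + t • y)
  have e2 := hh.posHom.fderiv_self h2 hne
  have e3 := hh.fderiv_le h2 hne x
  have e4 := hh.posHom.fderiv_self h2 hx
  rw [map_add, map_smul, smul_eq_mul] at e1 e2
  nlinarith

/-- The gradient of a function as a vector field. -/
def gradV (h : En n → ℝ) (x : En n) : En n :=
  (InnerProductSpace.toDual ℝ (En n)).symm (fderiv ℝ h x)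

theorem inner_gradV (h : En n → ℝ) (x z : En n) : ⟪z, gradV h x⟫_ℝ = fderiv ℝ h x z := by
  rw [real_inner_comm, gradV, InnerProductSpace.toDual_symm_apply]

/-- The convex body with a given support function. -/
theorem exists_body {h : En n → ℝ} (hh : IsSublin h) (h2 : C2off h) (hn : 0 < n) :
    ∃ K : ConvexBody (En n), ∀ x, supp K x = h x := by
  have hg : ∀ x, x ≠ 0 → ∀ z, ⟪z, gradV h x⟫_ℝ ≤ h z := fun x hx z => by
    rw [inner_gradV]; exact hh.fderiv_le h2 hx z
  have hp : pole n ≠ 0 := fun h0 => by simpa [h0] using norm_pole hn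
  have hconv : Convex ℝ {y : En n | ∀ x, ⟪x, y⟫_ℝ ≤ h x} := by
    intro y hy z hz a b ha hb hab x
    rw [inner_add_right, inner_smul_right, inner_smul_right]
    have : h x = a * h x + b * h x := by rw [← add_mul, hab, one_mul]
    rw [this]
    exact add_le_add (mul_le_mul_of_nonneg_left (hy x) ha) (mul_le_mul_of_nonneg_left (hz x) hb)
  have hclosed : IsClosed {y : En n | ∀ x, ⟪x, y⟫_ℝ ≤ h x} := by
    rw [Set.ofPred_forall]
    exact isClosed_iInter fun x => isClosed_le (by fun_prop) continuous_const
  have hbdd : Bornology.IsBounded {y : En n | ∀ x, ⟪x, y⟫_ℝ ≤ h x} := by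
    have hc : ContinuousOn h (sphere 0 1) := h2.continuousOn.mono fun x hx h0 => by
      simp [Set.mem_singleton_iff.1 h0] at hx
    obtain ⟨C, hC⟩ := (isCompact_sphere (0 : En n) 1).exists_bound_of_continuousOn hc
    refine (isBounded_iff_forall_norm_le).2 ⟨max C 0, fun y hy => ?_⟩
    by_cases hy0 : y = 0
    · simp [hy0]
    have hy1 : ‖y‖ ≠ 0 := by simpa using hy0
    have := hy (‖y‖⁻¹ • y)
    rw [real_inner_smul_left, real_inner_self_eq_norm_sq] at this
    have h3 := hC (‖y‖⁻¹ • y) (by simp [norm_smul, hy0])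
    have h4 : ‖y‖⁻¹ * ‖y‖ ^ 2 = ‖y‖ := by field_simp
    rw [h4] at this
    exact (this.trans ((le_abs_self _).trans h3)).trans (le_max_left _ _)
  refine ⟨⟨_, hconv, isCompact_of_isClosed_isBounded hclosed hbdd,
    ⟨gradV h (pole n), fun z => hg _ hp z⟩⟩, fun x => le_antisymm (supp_le fun y hy => hy x) ?_⟩
  by_cases hx : x = 0
  · subst hx
    rw [hh.zero]
    exact ((isSublin_supp _).zero).ge
  · rw [← hh.posHom.fderiv_self h2 hx, ← inner_gradV]
    exact inner_le_supp (K := ⟨_, hconv, _, _⟩) (fun z => hg x hx z) x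

section

/-- Parametrization of the region between `M` and `M + L` by the shell `1 < ‖x‖ ≤ 2`. -/
def shellMap (h k : En n → ℝ) (x : En n) : En n :=
  gradV h x + (‖x‖ - 1) • gradV k x

/-- The shell `1 < ‖x‖ ≤ 2`. -/
def shell (n : ℕ) : Set (En n) := {x | 1 < ‖x‖ ∧ ‖x‖ ≤ 2}

theorem ne_zero_of_mem_shell {x : En n} (hx : x ∈ shell n) : x ≠ 0 := by
  rintro rfl
  have := hx.1
  simp at this
  linarith

theorem inner_shellMap (h k : En n → ℝ) (x z : En n) :
    ⟪z, shellMap h k x⟫_ℝ = fderiv ℝ h x z + (‖x‖ - 1) * fderiv ℝ k x z := by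
  rw [shellMap, inner_add_right, inner_smul_right, inner_gradV, inner_gradV]

/-- The support function of a body which is the sum of a body and the unit ball. -/
structure RegularTest (L : ConvexBody (En n)) : Prop where
  c2 : C2off (supp L)
  pos : ∀ x, x ≠ 0 → 0 < supp L x
  exists_eq : ∃ a : En n → ℝ, IsSublin a ∧ ∀ x, supp L x = a x + ‖x‖

variable {M L : ConvexBody (En n)}

theorem RegularTest.nonneg (hL : RegularTest L) (x : En n) : 0 ≤ supp L x := by
  by_cases hx : x = 0
  · rw [hx, (isSublin_supp L).zero]
  · exact (hL.pos x hx).le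

theorem inner_shellMap_self (hM : C2off (supp M)) (hL : RegularTest L) {x : En n} (hx : x ≠ 0) :
    ⟪x, shellMap (supp M) (supp L) x⟫_ℝ = supp M x + (‖x‖ - 1) * supp L x := by
  rw [inner_shellMap, (isSublin_supp M).posHom.fderiv_self hM hx,
    (isSublin_supp L).posHom.fderiv_self hL.c2 hx]

theorem inner_shellMap_le (hM : C2off (supp M)) (hL : RegularTest L) {x : En n}
    (hx : x ∈ shell n) (z : En n) :
    ⟪z, shellMap (supp M) (supp L) x⟫_ℝ ≤ supp M z + (‖x‖ - 1) * supp L z := by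
  have hx0 := ne_zero_of_mem_shell hx
  rw [inner_shellMap]
  exact add_le_add ((isSublin_supp M).fderiv_le hM hx0 z)
    (mul_le_mul_of_nonneg_left ((isSublin_supp L).fderiv_le hL.c2 hx0 z) (by linarith [hx.1]))

theorem injOn_shellMap (hM : C2off (supp M)) (hL : RegularTest L) :
    Set.InjOn (shellMap (supp M) (supp L)) (shell n) := by
  have key : ∀ x ∈ shell n, ∀ x' ∈ shell n,
      shellMap (supp M) (supp L) x = shellMap (supp M) (supp L) x' → ‖x'‖ ≤ ‖x‖ := by
    intro x hx x' hx' h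
    by_contra! hlt
    have h1 := inner_shellMap_le hM hL hx x'
    rw [h, inner_shellMap_self hM hL (ne_zero_of_mem_shell hx')] at h1
    have h2 := hL.pos x' (ne_zero_of_mem_shell hx')
    nlinarith
  intro x hx x' hx' h
  have hn : ‖x‖ = ‖x'‖ := le_antisymm (key x' hx' x hx h.symm) (key x hx x' hx' h)
  have h1 := inner_shellMap_le hM hL hx (x + x')
  have h2 := inner_shellMap_self hM hL (ne_zero_of_mem_shell hx)
  have h3 := inner_shellMap_self hM hL (ne_zero_of_mem_shell hx')
  rw [inner_add_left, h2, h, h3] at h1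
  obtain ⟨a, ha, hLa⟩ := hL.exists_eq
  have h4 := (isSublin_supp M).add_le x x'
  have h5 := ha.add_le x x'
  simp only [hLa] at h1
  rw [← hn] at h1
  have hr : 0 < ‖x‖ - 1 := by linarith [hx.1]
  have h6 : ‖x‖ + ‖x'‖ ≤ ‖x + x'‖ := by
    by_contra! hlt
    have := mul_lt_mul_of_pos_left hlt hr
    have := mul_le_mul_of_nonneg_left h5 hr.le
    rw [← hn] at *
    nlinarith
  have h7 : SameRay ℝ x x' := sameRay_iff_norm_add.2 (le_antisymm (norm_add_le _ _) h6)
  exact h7.eq_of_norm_eq hn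

theorem image_shellMap (hM : C2off (supp M)) (hL : RegularTest L) (hn : 0 < n) :
    shellMap (supp M) (supp L) '' shell n = ((M + L : ConvexBody (En n)) : Set (En n)) \ M := by
  ext y
  constructor
  · rintro ⟨x, hx, rfl⟩
    have hx0 := ne_zero_of_mem_shell hx
    refine ⟨(mem_iff_supp _ _).2 fun z => (inner_shellMap_le hM hL hx z).trans ?_, fun h => ?_⟩
    · rw [supp_add]
      nlinarith [hL.nonneg z, hx.2]
    · have h1 := inner_le_supp h x
      rw [inner_shellMap_self hM hL hx0] at h1
      nlinarith [hL.pos x hx0, hx.1]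
  · rintro ⟨hyL, hyM⟩
    have hyL' := fun z => (mem_iff_supp _ _).1 hyL z
    simp only [supp_add] at hyL'
    have hne : (sphere (0 : En n) 1).Nonempty := ⟨pole n, by simpa using norm_pole hn⟩
    have h0 : ∀ u ∈ sphere (0 : En n) 1, u ≠ 0 := fun u hu h0 => by simp [h0] at hu
    have hcont : ContinuousOn (fun u => (⟪u, y⟫_ℝ - supp M u) / supp L u) (sphere (0 : En n) 1) :=
      ContinuousOn.div ((by fun_prop : Continuous fun u : En n => ⟪u, y⟫_ℝ).continuousOn.sub
        (hM.continuousOn.mono h0)) (hL.c2.continuousOn.mono h0) fun u hu => (hL.pos u (h0 u hu)).ne'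
    obtain ⟨u, hu, hmax⟩ := (isCompact_sphere (0 : En n) 1).exists_isMaxOn hne hcont
    set s := (⟪u, y⟫_ℝ - supp M u) / supp L u with hs
    have hu0 := h0 u hu
    have hu1 : ‖u‖ = 1 := by simpa using hu
    have hzero : supp M u + s * supp L u - ⟪u, y⟫_ℝ = 0 := by
      rw [hs, div_mul_cancel₀ _ (hL.pos u hu0).ne']; ring
    have hnn : ∀ z, 0 ≤ supp M z + s * supp L z - ⟪z, y⟫_ℝ := by
      intro z
      by_cases hz : z = 0
      · simp [hz, (isSublin_supp M).zero, (isSublin_supp L).zero]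
      have hz1 : 0 < ‖z‖ := norm_pos_iff.2 hz
      have hw : ‖z‖⁻¹ • z ∈ sphere (0 : En n) 1 := by simp [norm_smul, hz]
      have h1 : _ ≤ s := hmax hw
      simp only at h1
      rw [div_le_iff₀ (hL.pos _ (h0 _ hw)), (isSublin_supp L).smul _ (inv_nonneg.2 hz1.le),
        (isSublin_supp M).smul _ (inv_nonneg.2 hz1.le), real_inner_smul_left, ← mul_sub,
        mul_left_comm] at h1
      have := le_of_mul_le_mul_left h1 (inv_pos.2 hz1)
      linarith
    have hspos : 0 < s := by
      by_contra! hle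
      refine hyM ((mem_iff_supp _ _).2 fun z => ?_)
      nlinarith [hnn z, hL.nonneg z]
    have hs1 : s ≤ 1 := by
      rw [hs, div_le_one (hL.pos u hu0)]
      linarith [hyL' u]
    have hmin : IsLocalMin (fun z => supp M z + s * supp L z - ⟪z, y⟫_ℝ) u :=
      Filter.Eventually.of_forall fun z => by
        change supp M u + s * supp L u - ⟪u, y⟫_ℝ ≤ supp M z + s * supp L z - ⟪z, y⟫_ℝ
        rw [hzero]; exact hnn z
    have hder : HasFDerivAt (fun z => supp M z + s * supp L z - ⟪z, y⟫_ℝ)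
        (fderiv ℝ (supp M) u + s • fderiv ℝ (supp L) u - (innerSL ℝ y)) u := by
      refine (((hM.differentiableAt hu0).hasFDerivAt).add
        ((hL.c2.differentiableAt hu0).hasFDerivAt.const_mul s)).sub ?_
      have := (innerSL ℝ y).hasFDerivAt (x := u)
      refine this.congr_of_eventuallyEq (Filter.Eventually.of_forall fun z => ?_)
      simp [real_inner_comm]
    have hd0 := hmin.hasFDerivAt_eq_zero hder
    have hsp : 0 < 1 + s := by linarith
    have hnx : ‖(1 + s) • u‖ = 1 + s := by rw [norm_smul, hu1, mul_one, Real.norm_of_nonneg hsp.le]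
    refine ⟨(1 + s) • u, ⟨by rw [hnx]; linarith, by rw [hnx]; linarith⟩, ?_⟩
    refine ext_inner_left ℝ fun z => ?_
    rw [inner_shellMap, (isSublin_supp M).posHom.fderiv_smul hsp,
      (isSublin_supp L).posHom.fderiv_smul hsp, hnx]
    have := congrArg (fun f : En n →L[ℝ] ℝ => f z) hd0
    simp only [sub_apply, add_apply,
      smul_apply, smul_eq_mul, innerSL_apply_apply,
      zero_apply] at this
    rw [real_inner_comm]
    linarith

end

section

variable {m : ℕ}

set_option synthInstance.maxHeartbeats 200000

/-- The Riesz isomorphism as a real-linear map. -/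
def dualInv (n : ℕ) : (En n →L[ℝ] ℝ) →L[ℝ] En n :=
  LinearMap.toContinuousLinearMap
    { toFun := fun φ => (InnerProductSpace.toDual ℝ (En n)).symm φ
      map_add' := fun φ ψ => map_add _ φ ψ
      map_smul' := fun c φ => by simp }

/-- The inner product as a real bilinear map. -/
def innR (n : ℕ) : En n →L[ℝ] En n →L[ℝ] ℝ :=
  LinearMap.toContinuousLinearMap
    { toFun := fun v => innerSL ℝ v
      map_add' := fun φ ψ => map_add _ φ ψ
      map_smul' := fun c φ => by simp }

@[simp] theorem innR_apply (v w : En n) : innR n v w = ⟪v, w⟫_ℝ := rfl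

/-- The operator representing a bilinear form. -/
def opOf (β : En n →L[ℝ] En n →L[ℝ] ℝ) : En n →L[ℝ] En n := (dualInv n).comp β

theorem inner_opOf (β : En n →L[ℝ] En n →L[ℝ] ℝ) (v w : En n) : ⟪w, opOf β v⟫_ℝ = β v w := by
  rw [real_inner_comm]
  exact InnerProductSpace.toDual_symm_apply (𝕜 := ℝ) (E := En n) (x := w) (y := β v)

theorem det_eq_det_basis {ι : Type*} [Fintype ι] [DecidableEq ι]
    (b : OrthonormalBasis ι ℝ (En n)) (f : En n →L[ℝ] En n) :
    f.det = (Matrix.of fun k l => ⟪b k, f (b l)⟫_ℝ).det := by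
  rw [ContinuousLinearMap.det, ← LinearMap.det_toMatrix b.toBasis]
  congr 1
  ext k l
  rw [LinearMap.toMatrix_apply]
  simp [OrthonormalBasis.repr_apply_apply]

/-- The compression of a bilinear form to the orthogonal complement of `b 0`. -/
def cmpr (b : OrthonormalBasis (Fin (m + 1)) ℝ (En (m + 1)))
    (β : En (m + 1) →L[ℝ] En (m + 1) →L[ℝ] ℝ) : Matrix (Fin m) (Fin m) ℝ :=
  Matrix.of fun k l => β (b l.succ) (b k.succ)

theorem det_add_rank_one (b : OrthonormalBasis (Fin (m + 1)) ℝ (En (m + 1)))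
    (β : En (m + 1) →L[ℝ] En (m + 1) →L[ℝ] ℝ) (hβ : ∀ v, β v (b 0) = 0) (a : En (m + 1))
    (c : ℝ) :
    (opOf β + (c • innerSL ℝ (b 0)).smulRight a).det = c * ⟪b 0, a⟫_ℝ * (cmpr b β).det := by
  have hb : ∀ k l, ⟪b k, b l⟫_ℝ = if k = l then 1 else 0 :=
    orthonormal_iff_ite.1 b.orthonormal
  have he : ∀ k l, ⟪b k, (opOf β + (c • innerSL ℝ (b 0)).smulRight a) (b l)⟫_ℝ =
      β (b l) (b k) + c * (if 0 = l then 1 else 0) * ⟪b k, a⟫_ℝ := fun k l => by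
    rw [add_apply, inner_add_right, inner_opOf,
      ContinuousLinearMap.smulRight_apply, inner_smul_right]
    simp [hb]
  rw [det_eq_det_basis b, Matrix.det_succ_row_zero, Fin.sum_univ_succ]
  have h0 : ∀ j : Fin m, (Matrix.of fun k l =>
      ⟪b k, (opOf β + (c • innerSL ℝ (b 0)).smulRight a) (b l)⟫_ℝ) 0 j.succ = 0 := fun j => by
    simp only [Matrix.of_apply]
    rw [he, hβ, if_neg (Fin.succ_ne_zero j).symm]
    simp
  rw [Finset.sum_eq_zero (fun j _ => by rw [h0]; ring), add_zero]
  have h1 : (Matrix.of fun k l =>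
      ⟪b k, (opOf β + (c • innerSL ℝ (b 0)).smulRight a) (b l)⟫_ℝ) 0 0 = c * ⟪b 0, a⟫_ℝ := by
    simp only [Matrix.of_apply]
    rw [he, hβ, if_pos rfl]
    simp
  rw [h1, Fin.val_zero, pow_zero, one_mul]
  congr 2
  ext k l
  simp only [Matrix.submatrix_apply, Matrix.of_apply, cmpr]
  rw [Fin.succAbove_zero, he, if_neg (Fin.succ_ne_zero l).symm]
  simp

/-- The second derivative as a bilinear form. -/
abbrev hessB (h : En n → ℝ) (x : En n) : En n →L[ℝ] En n →L[ℝ] ℝ := fderiv ℝ (fderiv ℝ h) x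

theorem hessE_eq (h : En n → ℝ) (x : En n) (j l : Fin n) :
    hessE h x j l = hessB h x (EuclideanSpace.single j 1) (EuclideanSpace.single l 1) := by
  rw [hessE, iteratedFDeriv_two_apply]
  rfl

theorem det_outer_add (b : OrthonormalBasis (Fin (m + 1)) ℝ (En (m + 1)))
    (β : En (m + 1) →L[ℝ] En (m + 1) →L[ℝ] ℝ) (hβ : ∀ v, β v (b 0) = 0)
    (hs : ∀ v w, β v w = β w v) :
    (outer (b 0) + Matrix.of fun j l =>
      β (EuclideanSpace.single j 1) (EuclideanSpace.single l 1)).det = (cmpr b β).det := by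
  have h1 := det_add_rank_one b β hβ (b 0) 1
  rw [real_inner_self_eq_norm_sq, b.norm_eq_one, one_pow, one_mul, one_mul] at h1
  rw [← h1, det_eq_det_basis (EuclideanSpace.basisFun (Fin (m + 1)) ℝ)]
  congr 1
  ext j l
  simp only [Matrix.add_apply, outer, Matrix.of_apply, EuclideanSpace.basisFun_apply]
  rw [add_apply, inner_add_right, inner_opOf,
      ContinuousLinearMap.smulRight_apply, inner_smul_right, hs]
  simp only [one_smul, innerSL_apply_apply, EuclideanSpace.inner_single_left,
    EuclideanSpace.inner_single_right]
  simp
  ring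

theorem fderiv_norm_eq {x : En n} (hx : x ≠ 0) :
    fderiv ℝ (fun y : En n => ‖y‖) x = ‖x‖⁻¹ • innerSL ℝ x := by
  have h1 : HasFDerivAt (fun y : En n => Real.sqrt (‖y‖ ^ 2)) _ x :=
    (hasStrictFDerivAt_norm_sq x).hasFDerivAt.sqrt (by simpa using hx)
  have h2 : (fun y : En n => Real.sqrt (‖y‖ ^ 2)) = fun y => ‖y‖ :=
    funext fun y => Real.sqrt_sq (norm_nonneg y)
  rw [h2] at h1
  rw [h1.fderiv, Real.sqrt_sq (norm_nonneg x)]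
  ext v
  simp
  ring

theorem hessB_norm {u : En n} (hu : ‖u‖ = 1) (v w : En n) :
    hessB (fun y : En n => ‖y‖) u v w = ⟪v, w⟫_ℝ - ⟪u, v⟫_ℝ * ⟪u, w⟫_ℝ := by
  have hu0 : u ≠ 0 := fun h => by simp [h] at hu
  have h1 : (fun x => fderiv ℝ (fun y : En n => ‖y‖) x) =ᶠ[𝓝 u]
      fun x => ‖x‖⁻¹ • innerSL ℝ x := by
    filter_upwards [isOpen_compl_singleton.mem_nhds hu0] with x hx
    exact fderiv_norm_eq hx
  have h2 : HasFDerivAt (fun x : En n => ‖x‖⁻¹ • innerSL ℝ x)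
      (‖u‖⁻¹ • innR n +
        (-(‖u‖ ^ 2)⁻¹ • (‖u‖⁻¹ • innerSL ℝ u)).smulRight (innerSL ℝ u)) u := by
    have h3 : HasFDerivAt (fun y : En n => ‖y‖) (‖u‖⁻¹ • innerSL ℝ u) u := by
      rw [← fderiv_norm_eq hu0]
      exact (c2off_norm.differentiableAt hu0).hasFDerivAt
    exact ((hasDerivAt_inv (by rw [hu]; norm_num)).comp_hasFDerivAt u h3).smul
      ((innR n).hasFDerivAt)
  rw [hessB, h1.fderiv_eq, h2.fderiv, hu]
  simp
  ring

/-- The Jacobian of the shell map. -/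
theorem hasFDerivAt_shellMap {h k : En n → ℝ} (hh : C2off h) (hk : C2off k) {x : En n}
    (hx : x ≠ 0) :
    HasFDerivAt (shellMap h k) (opOf (hessB h x + (‖x‖ - 1) • hessB k x) +
      (‖x‖⁻¹ • innerSL ℝ x).smulRight (gradV k x)) x := by
  have e : ∀ {f : En n → ℝ}, C2off f → HasFDerivAt (gradV f) (opOf (hessB f x)) x := fun hf =>
    (dualInv n).hasFDerivAt.comp x (hf.differentiableAt_fderiv hx).hasFDerivAt
  have h3 : HasFDerivAt (fun y : En n => ‖y‖ - 1) (‖x‖⁻¹ • innerSL ℝ x) x := by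
    rw [← fderiv_norm_eq hx]
    exact (c2off_norm.differentiableAt hx).hasFDerivAt.sub_const 1
  refine ((e hh).add (h3.smul (e hk))).congr_fderiv ?_
  rw [opOf, opOf, opOf, ContinuousLinearMap.comp_add, ContinuousLinearMap.comp_smul, add_assoc]

/-- The weighted Jacobian of the shell map in polar coordinates. -/
def shellJac (h k : En n → ℝ) (u : En n) (s : ℝ) : ℝ :=
  k u * (outer u + (hessMat h u + s • hessMat k u)).det

theorem outer_add_hessMat_det {h k : En (m + 1) → ℝ} (hh : C2off h) (hk : C2off k)
    (hh' : PosHom h) (hk' : PosHom k) (b : OrthonormalBasis (Fin (m + 1)) ℝ (En (m + 1))) (s : ℝ) :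
    (outer (b 0) + (hessMat h (b 0) + s • hessMat k (b 0))).det =
      (cmpr b (hessB h (b 0) + s • hessB k (b 0))).det := by
  have hb0 : b 0 ≠ 0 := fun h0 => by simpa [h0] using b.norm_eq_one 0
  rw [← det_outer_add b]
  · congr 2
    ext j l
    simp [hessMat, hessE_eq]
  · intro v
    rw [add_apply, smul_apply, add_apply, smul_apply, hh.hess_symm hb0, hk.hess_symm hb0,
      hh'.fderiv_fderiv_self hh hb0, hk'.fderiv_fderiv_self hk hb0]
    simp
  · intro v w
    rw [add_apply, smul_apply, add_apply, smul_apply, hh.hess_symm hb0, hk.hess_symm hb0]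
    rfl

theorem det_shellMap {h k : En (m + 1) → ℝ} (hh : C2off h) (hk : C2off k)
    (hh' : PosHom h) (hk' : PosHom k) {u : En (m + 1)} (hu : ‖u‖ = 1) {r : ℝ} (hr : 0 < r) :
    (opOf (hessB h (r • u) + (‖r • u‖ - 1) • hessB k (r • u)) +
      (‖r • u‖⁻¹ • innerSL ℝ (r • u)).smulRight (gradV k (r • u))).det =
      (r ^ m)⁻¹ * shellJac h k u (r - 1) := by
  obtain ⟨b, rfl⟩ := exists_basis_of_unit hu
  have hb0 : b 0 ≠ 0 := fun h0 => by simp [h0] at hu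
  have hn : ‖r • b 0‖ = r := by rw [norm_smul, hu, mul_one, Real.norm_of_nonneg hr.le]
  have e1 : ‖r • b 0‖⁻¹ • innerSL ℝ (r • b 0) = (1 : ℝ) • innerSL ℝ (b 0) := by
    rw [hn, map_smul, smul_smul, inv_mul_cancel₀ hr.ne']
  have e2 : hessB h (r • b 0) + (‖r • b 0‖ - 1) • hessB k (r • b 0) =
      r⁻¹ • (hessB h (b 0) + (r - 1) • hessB k (b 0)) := by
    rw [hn, hessB, hessB, hh'.fderiv_fderiv_smul hr, hk'.fderiv_fderiv_smul hr]
    ext v w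
    simp only [add_apply, smul_apply, smul_eq_mul]
    ring
  have e3 : ⟪b 0, gradV k (r • b 0)⟫_ℝ = k (b 0) := by
    rw [inner_gradV, hk'.fderiv_smul hr, hk'.fderiv_self hk hb0]
  rw [e1, e2, det_add_rank_one, e3, shellJac, outer_add_hessMat_det hh hk hh' hk']
  · have : cmpr b (r⁻¹ • (hessB h (b 0) + (r - 1) • hessB k (b 0))) =
        r⁻¹ • cmpr b (hessB h (b 0) + (r - 1) • hessB k (b 0)) := by
      ext j l; rfl
    rw [this, Matrix.det_smul, Fintype.card_fin, inv_pow]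
    ring
  · intro v
    simp only [smul_apply, add_apply]
    rw [hh.hess_symm hb0, hk.hess_symm hb0,
      hh'.fderiv_fderiv_self hh hb0, hk'.fderiv_fderiv_self hk hb0]
    simp

theorem shellJac_nonneg {h k : En (m + 1) → ℝ} (hh : C2off h) (hk : C2off k)
    (hh' : IsSublin h) (hk' : IsSublin k) {u : En (m + 1)} (hu : ‖u‖ = 1) {s : ℝ} (hs : 0 ≤ s)
    (hku : 0 ≤ k u) : 0 ≤ shellJac h k u s := by
  obtain ⟨b, rfl⟩ := exists_basis_of_unit hu
  have hb0 : b 0 ≠ 0 := fun h0 => by simp [h0] at hu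
  rw [shellJac, outer_add_hessMat_det hh hk hh'.posHom hk'.posHom]
  refine mul_nonneg hku (Matrix.PosSemidef.det_nonneg ?_)
  refine Matrix.PosSemidef.of_dotProduct_mulVec_nonneg ?_ fun x => ?_
  · ext j l
    simp [cmpr, hh.hess_symm hb0 (b j.succ), hk.hess_symm hb0 (b j.succ)]
  · have e : star x ⬝ᵥ (cmpr b (hessB h (b 0) + s • hessB k (b 0))).mulVec x =
        (hessB h (b 0) + s • hessB k (b 0)) (∑ l, x l • b l.succ) (∑ l, x l • b l.succ) := by
      simp only [dotProduct, Matrix.mulVec, cmpr, Matrix.of_apply, map_sum, map_smul,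
        sum_apply, smul_apply, Finset.mul_sum, smul_eq_mul, star_trivial]
      refine Finset.sum_congr rfl fun l _ => Finset.sum_congr rfl fun j _ => ?_
      ring
    rw [e, add_apply, add_apply, smul_apply, smul_apply, smul_eq_mul]
    exact add_nonneg (hh'.hess_nonneg hh hb0 _) (mul_nonneg hs (hk'.hess_nonneg hk hb0 _))

end

section

variable {m : ℕ}

theorem sph_ne_zero (u : Sph n) : (u : En n) ≠ 0 := fun h => by
  have := u.2
  simp [h] at this

theorem norm_sph (u : Sph n) : ‖(u : En n)‖ = 1 := by simp

theorem C2off.continuous_sph {h : En n → ℝ} (hh : C2off h) :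
    Continuous fun u : Sph n => h u :=
  continuous_iff_continuousAt.2 fun u =>
    ((hh.contDiffAt (sph_ne_zero u)).continuousAt).comp continuous_subtype_val.continuousAt

theorem C2off.continuous_hessB {h : En n → ℝ} (hh : C2off h) :
    Continuous fun u : Sph n => hessB h u :=
  continuous_iff_continuousAt.2 fun u => by
    have h1 := ((hh.contDiffAt (sph_ne_zero u)).fderiv_right (m := 1) (by norm_num))
    have h2 := (h1.fderiv_right (m := 0) (by norm_num)).continuousAt
    exact h2.comp (f := fun u : Sph n => (u : En n)) continuous_subtype_val.continuousAt

theorem C2off.continuous_hessE {h : En n → ℝ} (hh : C2off h) (j l : Fin n) :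
    Continuous fun u : Sph n => hessE h u j l := by
  simp only [hessE_eq]
  exact (hh.continuous_hessB.clm_apply continuous_const).clm_apply continuous_const

theorem C2off.continuous_hessMat {h : En n → ℝ} (hh : C2off h) :
    Continuous fun u : Sph n => hessMat h u :=
  continuous_matrix fun j l => hh.continuous_hessE j l

theorem continuous_outer : Continuous fun u : Sph n => outer (u : En n) :=
  continuous_matrix fun j l => by
    simp only [outer, Matrix.of_apply]
    fun_prop

theorem continuous_shellJac {h k : En n → ℝ} (hh : C2off h) (hk : C2off k) :
    Continuous fun p : Sph n × ℝ => shellJac h k p.1 p.2 := by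
  unfold shellJac
  refine (hk.continuous_sph.comp continuous_fst).mul (Continuous.matrix_det ?_)
  exact (continuous_outer.comp continuous_fst).add
    ((hh.continuous_hessMat.comp continuous_fst).add
      (continuous_snd.smul (hk.continuous_hessMat.comp continuous_fst)))

/-- Integration in polar coordinates. -/
theorem lintegral_polar (F : En (m + 1) → ENNReal) (G : Sph (m + 1) × ℝ → ENNReal)
    (hG : Measurable G) (hFG : ∀ (u : Sph (m + 1)) (r : ℝ), 0 < r → F (r • (u : En (m + 1))) = G (u, r)) :
    ∫⁻ x, F x = ∫⁻ u : Sph (m + 1),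
      (∫⁻ r in Set.Ioi (0 : ℝ), ENNReal.ofReal (r ^ m) * G (u, r)) ∂(sphVol (m + 1)) := by
  have h1 : ∫⁻ x, F x = ∫⁻ x in ({0}ᶜ : Set (En (m + 1))), F x := by
    rw [restrict_compl_singleton]
  have hd : Module.finrank ℝ (En (m + 1)) - 1 = m := by simp
  have h2 := (volume : Measure (En (m + 1))).measurePreserving_homeomorphUnitSphereProd
  rw [hd] at h2
  rw [h1, ← lintegral_subtype_comap (measurableSet_singleton _).compl,
    ← (h2.symm (homeomorphUnitSphereProd (En (m + 1))).toMeasurableEquiv).lintegral_comp_emb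
      (MeasurableEquiv.measurableEmbedding _)]
  have h3 : ∀ p : Sph (m + 1) × Set.Ioi (0 : ℝ),
      F (((homeomorphUnitSphereProd (En (m + 1))).toMeasurableEquiv.symm p :
        ({0}ᶜ : Set (En (m + 1)))) : En (m + 1)) = G (p.1, p.2) := fun p => by
    rw [← hFG _ _ p.2.2]
    congr 1
  simp only [h3]
  have hm : Measurable fun p : Sph (m + 1) × Set.Ioi (0 : ℝ) => G (p.1, p.2) :=
    hG.comp (measurable_fst.prodMk (measurable_subtype_coe.comp measurable_snd))
  rw [lintegral_prod _ hm.aemeasurable]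
  refine lintegral_congr fun u => ?_
  have hmu : Measurable fun y : Set.Ioi (0 : ℝ) => G (u, (y : ℝ)) :=
    hm.comp (measurable_prodMk_left (x := u))
  rw [Measure.volumeIoiPow]
  refine (lintegral_withDensity_eq_lintegral_mul _ (by fun_prop) hmu).trans ?_
  exact lintegral_subtype_comap measurableSet_Ioi
    (fun r => ENNReal.ofReal (r ^ m) * G (u, r))

/-- The parameter domain of the shell between `M` and `M + L`. -/
def shellMeasure (n : ℕ) : Measure (Sph n × ℝ) := (sphVol n).prod (volume.restrict (Set.Ioc 1 2))

instance : IsFiniteMeasure (shellMeasure n) := by unfold shellMeasure; infer_instance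

variable {M L : ConvexBody (En (m + 1))}

theorem volume_shell (hM : C2off (supp M)) (hL : RegularTest L) :
    volume (((M + L : ConvexBody (En (m + 1))) : Set (En (m + 1))) \ M) =
      ∫⁻ p, ENNReal.ofReal (shellJac (supp M) (supp L) p.1 (p.2 - 1)) ∂(shellMeasure (m + 1)) := by
  have hms : MeasurableSet (shell (m + 1)) :=
    (measurableSet_lt measurable_const measurable_norm).inter
      (measurableSet_le measurable_norm measurable_const)
  have hcJ : Continuous fun p : Sph (m + 1) × ℝ =>
      shellJac (supp M) (supp L) p.1 (p.2 - 1) := (continuous_shellJac hM hL.c2).comp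
    (continuous_fst.prodMk (continuous_snd.sub (continuous_const (y := (1 : ℝ)))) :
      Continuous fun p : Sph (m + 1) × ℝ => (p.1, p.2 - 1))
  rw [← image_shellMap hM hL (Nat.succ_pos m), ← lintegral_abs_det_fderiv_eq_addHaar_image volume
    hms (fun x hx => (hasFDerivAt_shellMap hM hL.c2 (ne_zero_of_mem_shell hx)).hasFDerivWithinAt)
    (injOn_shellMap hM hL), ← lintegral_indicator hms]
  rw [lintegral_polar _ (fun p => (Prod.snd ⁻¹' (Set.Ioc (1 : ℝ) 2)).indicator
    (fun p : Sph (m + 1) × ℝ => ENNReal.ofReal ((p.2 ^ m)⁻¹ * shellJac (supp M) (supp L) p.1 (p.2 - 1))) p)]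
  · rw [shellMeasure, lintegral_prod _ hcJ.measurable.ennreal_ofReal.aemeasurable]
    refine lintegral_congr fun u => ?_
    rw [← lintegral_indicator measurableSet_Ioi, ← lintegral_indicator measurableSet_Ioc]
    refine lintegral_congr fun r => ?_
    by_cases hr : r ∈ Set.Ioc (1 : ℝ) 2
    · have hr0 : (0 : ℝ) < r := by linarith [hr.1]
      rw [Set.indicator_of_mem (by exact hr0), Set.indicator_of_mem hr,
        Set.indicator_of_mem (by exact hr), ← ENNReal.ofReal_mul (by positivity), ← mul_assoc,
        mul_inv_cancel₀ (by positivity), one_mul]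
    · rw [Set.indicator_of_notMem hr]
      by_cases hr0 : r ∈ Set.Ioi (0 : ℝ)
      · rw [Set.indicator_of_mem hr0, Set.indicator_of_notMem (by exact hr), mul_zero]
      · rw [Set.indicator_of_notMem hr0]
  · refine Measurable.indicator ?_ (measurable_snd measurableSet_Ioc)
    exact (((measurable_snd.pow_const m).inv).mul hcJ.measurable).ennreal_ofReal
  · intro u r hr
    have hn : ‖r • (u : En (m + 1))‖ = r := by
      rw [norm_smul, norm_sph, mul_one, Real.norm_of_nonneg hr.le]
    by_cases hr2 : r ∈ Set.Ioc (1 : ℝ) 2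
    · rw [Set.indicator_of_mem (by change 1 < _ ∧ _ ≤ _; rw [hn]; exact hr2),
        Set.indicator_of_mem (by exact hr2),
        det_shellMap hM hL.c2 (isSublin_supp M).posHom (isSublin_supp L).posHom (norm_sph u) hr,
        abs_of_nonneg]
      exact mul_nonneg (by positivity) (shellJac_nonneg hM hL.c2 (isSublin_supp M)
        (isSublin_supp L) (norm_sph u) (by linarith [hr2.1]) (hL.nonneg _))
    · rw [Set.indicator_of_notMem (by change ¬ (1 < _ ∧ _ ≤ _); rw [hn]; exact hr2),
        Set.indicator_of_notMem (by exact hr2)]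

theorem ae_shellMeasure : ∀ᵐ p ∂(shellMeasure n), p.2 ∈ Set.Ioc (1 : ℝ) 2 := by
  have : shellMeasure n = ((sphVol n).prod volume).restrict (Set.univ ×ˢ Set.Ioc 1 2) := by
    rw [← Measure.prod_restrict, Measure.restrict_univ, shellMeasure]
  rw [this]
  filter_upwards [ae_restrict_mem (MeasurableSet.univ.prod measurableSet_Ioc)] with p hp
  exact hp.2

theorem integrable_shellMeasure {f : Sph n × ℝ → ℝ} (hf : Continuous f) :
    Integrable f (shellMeasure n) := by
  obtain ⟨C, hC⟩ := ((isCompact_univ (X := Sph n)).prod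
    (isCompact_Icc (a := (1 : ℝ)) (b := 2))).exists_bound_of_continuousOn hf.continuousOn
  refine Integrable.of_bound hf.aestronglyMeasurable C ?_
  filter_upwards [ae_shellMeasure] with p hp
  exact hC p ⟨Set.mem_univ _, Set.Ioc_subset_Icc_self hp⟩

theorem volume_add_sub_volume (hM : C2off (supp M)) (hL : RegularTest L) :
    (volume ((M + L : ConvexBody (En (m + 1))) : Set (En (m + 1)))).toReal -
      (volume (M : Set (En (m + 1)))).toReal =
      ∫ p, shellJac (supp M) (supp L) p.1 (p.2 - 1) ∂(shellMeasure (m + 1)) := by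
  have hsub : (M : Set (En (m + 1))) ⊆ ((M + L : ConvexBody (En (m + 1))) : Set (En (m + 1))) := by
    intro y hy
    refine (mem_iff_supp _ _).2 fun x => ?_
    rw [supp_add]
    linarith [inner_le_supp hy x, hL.nonneg x]
  have h1 := measureReal_sdiff (μ := volume) hsub M.isCompact.measurableSet
    (M + L).isCompact.measure_lt_top.ne
  have hcJ : Continuous fun p : Sph (m + 1) × ℝ =>
      shellJac (supp M) (supp L) p.1 (p.2 - 1) := (continuous_shellJac hM hL.c2).comp
    (continuous_fst.prodMk (continuous_snd.sub (continuous_const (y := (1 : ℝ)))) :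
      Continuous fun p : Sph (m + 1) × ℝ => (p.1, p.2 - 1))
  rw [measureReal_def, measureReal_def, measureReal_def] at h1
  rw [← h1, volume_shell hM hL, integral_eq_lintegral_of_nonneg_ae _ hcJ.aestronglyMeasurable]
  · filter_upwards [ae_shellMeasure] with p hp
    exact shellJac_nonneg hM hL.c2 (isSublin_supp M) (isSublin_supp L) (norm_sph p.1)
      (by linarith [hp.1]) (hL.nonneg _)

end

section

variable {m : ℕ}

theorem sum_finset_fin_succ {E : Type*} [AddCommMonoid E] (F : Finset (Fin (m + 1)) → E) :
    ∑ S, F S = ∑ T : Finset (Fin m), (F (T.map (Fin.succEmb m)) +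
      F (Finset.cons 0 (T.map (Fin.succEmb m)) (by simp))) := by
  rw [Finset.sum_add_distrib]
  have h0 : ∀ S : Finset (Fin (m + 1)), 0 ∉ S →
      (S.preimage Fin.succ (Fin.succ_injective m).injOn).map (Fin.succEmb m) = S := fun S hS => by
    ext k
    refine Fin.cases ?_ (fun k => ?_) k
    · simp [hS]
    · simp
  rw [← Finset.sum_filter_add_sum_filter_not Finset.univ (fun S : Finset (Fin (m + 1)) => 0 ∉ S)]
  congr 1
  · refine (Finset.sum_nbij' (fun T => T.map (Fin.succEmb m))
      (fun S => S.preimage Fin.succ (Fin.succ_injective m).injOn) ?_ ?_ ?_ ?_ ?_).symm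
    · simp
    · simp
    · intro T _; ext k; simp
    · intro S hS; exact h0 S (by simpa using hS)
    · simp
  · refine (Finset.sum_nbij' (fun T => Finset.cons 0 (T.map (Fin.succEmb m)) (by simp))
      (fun S => S.preimage Fin.succ (Fin.succ_injective m).injOn) ?_ ?_ ?_ ?_ ?_).symm
    · simp
    · simp
    · intro T _; ext k; simp
    · intro S hS
      have hS : (0 : Fin (m + 1)) ∈ S := by simpa using hS
      ext k
      refine Fin.cases ?_ (fun k => ?_) k
      · simp [hS]
      · simp
    · simp

theorem mixedVol_succ (Ks : Fin (m + 1) → ConvexBody (En (m + 1))) :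
    ((m + 1 : ℕ) : ℝ) * mixedVol Ks = ((m.factorial : ℝ))⁻¹ * ∑ T : Finset (Fin m),
      (-1 : ℝ) ^ (m - T.card) *
        ((volume ((∑ k ∈ T, Ks k.succ + Ks 0 : ConvexBody (En (m + 1))) : Set (En (m + 1)))).toReal -
        (volume ((∑ k ∈ T, Ks k.succ : ConvexBody (En (m + 1))) : Set (En (m + 1)))).toReal) := by
  rw [mixedVol, ← mul_assoc, Nat.factorial_succ, Nat.cast_mul, mul_inv, ← mul_assoc,
    mul_inv_cancel₀ (by positivity), one_mul, sum_finset_fin_succ]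
  congr 1
  refine Finset.sum_congr rfl fun T _ => ?_
  have hc : T.card ≤ m := by simpa using T.card_le_univ
  rw [Finset.card_cons, Finset.card_map, Nat.add_sub_add_right, Finset.sum_cons, Finset.sum_map,
    Nat.succ_sub hc, pow_succ, add_comm (Ks 0)]
  simp only [Fin.coe_succEmb]
  ring

theorem hessB_sum {ι : Type*} (S : Finset ι) {f : ι → En n → ℝ} (hf : ∀ k ∈ S, C2off (f k))
    {x : En n} (hx : x ≠ 0) : hessB (fun y => ∑ k ∈ S, f k y) x = ∑ k ∈ S, hessB (f k) x := by
  have h1 : (fderiv ℝ fun y => ∑ k ∈ S, f k y) =ᶠ[𝓝 x] fun y => ∑ k ∈ S, fderiv ℝ (f k) y := by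
    filter_upwards [isOpen_compl_singleton.mem_nhds hx] with y hy
    exact fderiv_fun_sum fun k hk => (hf k hk).differentiableAt hy
  rw [hessB, h1.fderiv_eq]
  exact fderiv_fun_sum fun k hk => (hf k hk).differentiableAt_fderiv hx

theorem C2off.sum {ι : Type*} (S : Finset ι) {f : ι → En n → ℝ} (hf : ∀ k ∈ S, C2off (f k)) :
    C2off fun y => ∑ k ∈ S, f k y :=
  ContDiffOn.sum hf

theorem cmpr_add (b : OrthonormalBasis (Fin (m + 1)) ℝ (En (m + 1)))
    (β β' : En (m + 1) →L[ℝ] En (m + 1) →L[ℝ] ℝ) : cmpr b (β + β') = cmpr b β + cmpr b β' := by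
  ext k l; simp [cmpr]

theorem cmpr_smul (b : OrthonormalBasis (Fin (m + 1)) ℝ (En (m + 1))) (c : ℝ)
    (β : En (m + 1) →L[ℝ] En (m + 1) →L[ℝ] ℝ) : cmpr b (c • β) = c • cmpr b β := by
  ext k l; simp [cmpr]

theorem cmpr_sum (b : OrthonormalBasis (Fin (m + 1)) ℝ (En (m + 1))) {ι : Type*} (S : Finset ι)
    (β : ι → En (m + 1) →L[ℝ] En (m + 1) →L[ℝ] ℝ) :
    cmpr b (∑ k ∈ S, β k) = ∑ k ∈ S, cmpr b (β k) := by
  ext k l; simp [cmpr, Matrix.sum_apply]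

theorem cmpr_norm (b : OrthonormalBasis (Fin (m + 1)) ℝ (En (m + 1))) :
    cmpr b (hessB (fun x => ‖x‖) (b 0)) = 1 := by
  have hb : ∀ k l, ⟪b k, b l⟫_ℝ = if k = l then 1 else 0 :=
    orthonormal_iff_ite.1 b.orthonormal
  ext k l
  rw [cmpr, Matrix.of_apply, hessB_norm (b.norm_eq_one 0), hb, hb, hb, Matrix.one_apply]
  simp [eq_comm]

/-- The density of the area measure of order `i` of a body with support function `h`. -/
def areaDens (i : ℕ) (h : En (m + 1) → ℝ) (u : En (m + 1)) : ℝ :=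
  ((m.factorial : ℝ))⁻¹ * ∑ T : Finset (Fin m), (-1 : ℝ) ^ (m - T.card) *
    (outer u + ∑ k ∈ T, if (k : ℕ) < i then hessMat h u else hessMat (fun x => ‖x‖) u).det

theorem continuous_areaDens (i : ℕ) {h : En (m + 1) → ℝ} (hh : C2off h) :
    Continuous fun u : Sph (m + 1) => areaDens i h u := by
  unfold areaDens
  refine continuous_const.mul (continuous_finsetSum _ fun T _ => continuous_const.mul
    (Continuous.matrix_det (continuous_outer.add (continuous_finsetSum _ fun k _ => ?_))))
  split_ifs
  · exact hh.continuous_hessMat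
  · exact c2off_norm.continuous_hessMat

theorem isSublin_norm_posHom : PosHom (fun x : En n => ‖x‖) := isSublin_norm.posHom

theorem outer_add_sum_det (b : OrthonormalBasis (Fin (m + 1)) ℝ (En (m + 1))) {ι : Type*}
    (S : Finset ι) {f : ι → En (m + 1) → ℝ} (hf : ∀ k, C2off (f k)) (hp : ∀ k, PosHom (f k)) :
    (outer (b 0) + ∑ k ∈ S, hessMat (f k) (b 0)).det =
      (∑ k ∈ S, cmpr b (hessB (f k) (b 0))).det := by
  have hb0 : b 0 ≠ 0 := fun h0 => by simpa [h0] using b.norm_eq_one 0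
  rw [← cmpr_sum, ← det_outer_add b]
  · congr 2
    ext j l
    simp [Matrix.sum_apply, hessMat, hessE_eq]
  · intro v
    simp only [sum_apply]
    refine Finset.sum_eq_zero fun k _ => ?_
    rw [(hf k).hess_symm hb0, (hp k).fderiv_fderiv_self (hf k) hb0]
    simp
  · intro v w
    simp only [sum_apply]
    exact Finset.sum_congr rfl fun k _ => (hf k).hess_symm hb0 v w

theorem areaDens_eq (i : ℕ) {h : En (m + 1) → ℝ} (hh : C2off h) (hp : PosHom h)
    (b : OrthonormalBasis (Fin (m + 1)) ℝ (En (m + 1))) :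
    areaDens i h (b 0) = mixDet i (cmpr b (hessB h (b 0))) := by
  rw [areaDens, mixDet]
  congr 1
  refine Finset.sum_congr rfl fun T _ => ?_
  congr 1
  have := outer_add_sum_det b T
    (f := fun k => if (k : ℕ) < i then h else fun x => ‖x‖)
    (fun k => by split_ifs; exacts [hh, c2off_norm])
    (fun k => by split_ifs; exacts [hp, isSublin_norm_posHom])
  simp only [apply_ite (fun f : En (m + 1) → ℝ => hessMat f (b 0)),
    apply_ite (fun f : En (m + 1) → ℝ => cmpr b (hessB f (b 0))), cmpr_norm] at this
  exact this

theorem sum_shellJac (i : ℕ) {h k : En (m + 1) → ℝ} (hh : C2off h) (hk : C2off k)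
    (hp : PosHom h) (hp' : PosHom k) {u : En (m + 1)} (hu : ‖u‖ = 1) (s : ℝ) :
    ((m.factorial : ℝ))⁻¹ * ∑ T : Finset (Fin m), (-1 : ℝ) ^ (m - T.card) *
      shellJac (fun x => ∑ j ∈ T, if (j : ℕ) < i then h x else ‖x‖) k u s =
      k u * areaDens i h u := by
  obtain ⟨b, rfl⟩ := exists_basis_of_unit hu
  have hb0 : b 0 ≠ 0 := fun h0 => by simp [h0] at hu
  rw [areaDens_eq i hh hp, mixDet_eq_sum_const i (s • cmpr b (hessB k (b 0))), mul_left_comm (k _),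
    Finset.mul_sum _ _ (k _)]
  congr 1
  refine Finset.sum_congr rfl fun T _ => ?_
  have hf : ∀ j ∈ T, C2off (fun x => if (j : ℕ) < i then h x else ‖x‖) :=
    fun j _ => by split_ifs; exacts [hh, c2off_norm]
  rw [shellJac, outer_add_hessMat_det (C2off.sum T hf) hk ?_ hp', hessB_sum T hf hb0, cmpr_add,
    cmpr_sum, cmpr_smul, mul_left_comm, add_comm (∑ j ∈ T, _) (s • _)]
  · congr 4
    refine Finset.sum_congr rfl fun j _ => ?_
    split_ifs
    · rfl
    · exact cmpr_norm b
  · intro c hc x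
    rw [Finset.mul_sum]
    refine Finset.sum_congr rfl fun j _ => ?_
    split_ifs
    · exact hp c hc x
    · exact isSublin_norm_posHom c hc x

theorem integral_supp_mul_areaDens (i : ℕ) {K L : ConvexBody (En (m + 1))} (hK : C2off (supp K))
    (hL : RegularTest L) :
    ∫ u : Sph (m + 1), supp L u * areaDens i (supp K) u ∂(sphVol (m + 1)) =
      ((m + 1 : ℕ) : ℝ) * mixedVol (fun k : Fin (m + 1) =>
        if (k : ℕ) = 0 then L else if (k : ℕ) ≤ i then K else ballB (m + 1)) := by
  have hsupp : ∀ T : Finset (Fin m),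
      supp (∑ k ∈ T, if (k : ℕ) < i then K else ballB (m + 1)) =
      fun x => ∑ j ∈ T, if (j : ℕ) < i then supp K x else ‖x‖ := fun T => by
    ext x
    rw [supp_sum]
    refine Finset.sum_congr rfl fun j _ => ?_
    split_ifs
    · rfl
    · exact supp_ballB x
  have hc2 : ∀ T : Finset (Fin m),
      C2off (supp (∑ k ∈ T, if (k : ℕ) < i then K else ballB (m + 1))) := fun T => by
    rw [hsupp]
    exact C2off.sum T fun j _ => by split_ifs; exacts [hK, c2off_norm]
  rw [mixedVol_succ]
  simp only [Fin.val_succ, Nat.succ_ne_zero, if_false, Fin.val_zero, if_true, Nat.succ_le_iff]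
  have hcont : ∀ T : Finset (Fin m), Continuous fun p : Sph (m + 1) × ℝ =>
      shellJac (supp (∑ k ∈ T, if (k : ℕ) < i then K else ballB (m + 1))) (supp L) p.1 (p.2 - 1) :=
    fun T => (continuous_shellJac (hc2 T) hL.c2).comp
      (continuous_fst.prodMk (continuous_snd.sub (continuous_const (y := (1 : ℝ)))) :
        Continuous fun p : Sph (m + 1) × ℝ => (p.1, p.2 - 1))
  simp only [volume_add_sub_volume (hc2 _) hL]
  simp only [← integral_const_mul]
  rw [← integral_finsetSum _ fun T _ => (integrable_shellMeasure (hcont T)).const_mul _,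
    ← integral_const_mul]
  simp only [hsupp, sum_shellJac i hK hL.c2 (isSublin_supp K).posHom (isSublin_supp L).posHom
    (norm_sph _)]
  rw [shellMeasure, integral_fun_fst (fun u : Sph (m + 1) => supp L u * areaDens i (supp K) u)]
  norm_num [measureReal_def]

end

section

variable {m : ℕ}

/-- Regular positive sublinear functions. -/
structure IsGauge (a : En n → ℝ) : Prop where
  sub : IsSublin a
  c2 : C2off a
  pos : ∀ x, x ≠ 0 → 0 < a x

theorem IsGauge.nonneg {a : En n → ℝ} (ha : IsGauge a) (x : En n) : 0 ≤ a x := by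
  by_cases hx : x = 0
  · rw [hx, ha.sub.zero]
  · exact (ha.pos x hx).le

theorem IsGauge.add {a b : En n → ℝ} (ha : IsGauge a) (hb : IsGauge b) :
    IsGauge fun x => a x + b x where
  sub := ha.sub.add hb.sub
  c2 := ha.c2.add hb.c2
  pos x hx := add_pos (ha.pos x hx) (hb.pos x hx)

theorem isGauge_norm : IsGauge (fun x : En n => ‖x‖) where
  sub := isSublin_norm
  c2 := c2off_norm
  pos _ hx := norm_pos_iff.2 hx

theorem isGauge_linear (c : En n) {k : ℝ} (hk : ‖c‖ < k) : IsGauge fun x => k * ‖x‖ + ⟪c, x⟫_ℝ where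
  sub :=
    { add_le := fun x y => by
        have := mul_le_mul_of_nonneg_left (norm_add_le x y) ((norm_nonneg c).trans hk.le)
        rw [inner_add_right]; linarith
      smul := fun r hr x => by
        rw [norm_smul, Real.norm_of_nonneg hr, inner_smul_right]; ring }
  c2 := (c2off_norm.const_mul k).add (innerSL ℝ c).contDiff.contDiffOn
  pos x hx := by
    have h1 := neg_le_of_abs_le (abs_real_inner_le_norm c x)
    have h2 := mul_lt_mul_of_pos_right hk (norm_pos_iff.2 hx)
    linarith

theorem IsGauge.lpSum {a b : En n → ℝ} (ha : IsGauge a) (hb : IsGauge b) {p : ℝ} (hp : 1 ≤ p) :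
    IsGauge fun x => (a x ^ p + b x ^ p) ^ (1 / p) where
  sub :=
    { add_le := fun x y => by
        have h := Real.Lp_add_le_of_nonneg (s := Finset.univ) (f := ![a x, b x]) (g := ![a y, b y])
          hp (by simp [Fin.forall_fin_two, ha.nonneg, hb.nonneg])
          (by simp [Fin.forall_fin_two, ha.nonneg, hb.nonneg])
        simp only [Fin.sum_univ_two, Matrix.cons_val_zero, Matrix.cons_val_one] at h
        refine le_trans ?_ h
        have h0 := ha.nonneg (x + y)
        have h1 := hb.nonneg (x + y)
        have h2 := ha.sub.add_le x y
        have h3 := hb.sub.add_le x y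
        gcongr
      smul := fun c hc x => by
        have h0 := ha.nonneg x
        have h1 := hb.nonneg x
        rw [ha.sub.smul c hc, hb.sub.smul c hc, Real.mul_rpow hc h0, Real.mul_rpow hc h1, ← mul_add,
          Real.mul_rpow (by positivity) (by positivity), ← Real.rpow_mul hc,
          mul_one_div_cancel (by positivity), Real.rpow_one] }
  c2 := by
    refine ContDiffOn.rpow_const_of_ne ((ha.c2.rpow_const_of_ne fun x hx => (ha.pos x hx).ne').add
      (hb.c2.rpow_const_of_ne fun x hx => (hb.pos x hx).ne')) fun x hx => ?_
    exact (add_pos (Real.rpow_pos_of_pos (ha.pos x hx) _)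
      (Real.rpow_pos_of_pos (hb.pos x hx) _)).ne'
  pos x hx := Real.rpow_pos_of_pos (add_pos (Real.rpow_pos_of_pos (ha.pos x hx) _)
      (Real.rpow_pos_of_pos (hb.pos x hx) _)) _

theorem abs_lpSum_sub_max_le {x y p : ℝ} (hx : 0 ≤ x) (hy : 0 ≤ y) (hp : 1 ≤ p) :
    |(x ^ p + y ^ p) ^ (1 / p) - max x y| ≤ ((2 : ℝ) ^ (1 / p) - 1) * max x y := by
  have hp0 : 0 < p := by linarith
  have hM : 0 ≤ max x y := le_max_of_le_left hx
  have hM' : (max x y ^ p) ^ (1 / p) = max x y := by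
    rw [← Real.rpow_mul hM, mul_one_div_cancel hp0.ne', Real.rpow_one]
  have h1 : max x y ≤ (x ^ p + y ^ p) ^ (1 / p) := by
    conv_lhs => rw [← hM']
    refine Real.rpow_le_rpow (by positivity) ?_ (by positivity)
    rcases max_cases x y with h | h <;> rw [h.1] <;>
      linarith [Real.rpow_nonneg hx p, Real.rpow_nonneg hy p]
  have h2 : (x ^ p + y ^ p) ^ (1 / p) ≤ (2 : ℝ) ^ (1 / p) * max x y := by
    conv_rhs => rw [← hM']
    rw [← Real.mul_rpow (by positivity) (by positivity), two_mul]
    refine Real.rpow_le_rpow (by positivity) (add_le_add ?_ ?_) (by positivity)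
    · exact Real.rpow_le_rpow hx (le_max_left _ _) hp0.le
    · exact Real.rpow_le_rpow hy (le_max_right _ _) hp0.le
  rw [abs_of_nonneg (by linarith)]
  linarith

/-- Restrictions to the sphere of differences of regular sublinear functions. -/
def gaugeDiff (n : ℕ) : Set C(Sph n, ℝ) :=
  {f | ∃ a b : En n → ℝ, IsGauge a ∧ IsGauge b ∧ ∀ u : Sph n, f u = a u - b u}

theorem neg_mem_gaugeDiff {f : C(Sph n, ℝ)} (hf : f ∈ gaugeDiff n) : -f ∈ gaugeDiff n := by
  obtain ⟨a, b, ha, hb, h⟩ := hf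
  exact ⟨b, a, hb, ha, fun u => by simp [h]⟩

theorem sup_mem_closure_gaugeDiff {f g : C(Sph n, ℝ)} (hf : f ∈ gaugeDiff n)
    (hg : g ∈ gaugeDiff n) : f ⊔ g ∈ closure (gaugeDiff n) := by
  obtain ⟨a, b, ha, hb, hab⟩ := hf
  obtain ⟨c, d, hc, hd, hcd⟩ := hg
  have h1 := ha.add hd
  have h2 := hc.add hb
  have hbd := hb.add hd
  set x : En n → ℝ := fun v => a v + d v with hx
  set y : En n → ℝ := fun v => c v + b v with hy
  let M : C(Sph n, ℝ) := ⟨fun u => max (x u) (y u), h1.c2.continuous_sph.max h2.c2.continuous_sph⟩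
  have hp : ∀ k : ℕ, (1 : ℝ) ≤ k + 1 := fun k => by simp
  let F : ℕ → C(Sph n, ℝ) := fun k =>
    ⟨fun u => (x u ^ ((k : ℝ) + 1) + y u ^ ((k : ℝ) + 1)) ^ (1 / ((k : ℝ) + 1)) - (b u + d u),
      (h1.lpSum h2 (hp k)).c2.continuous_sph.sub hbd.c2.continuous_sph⟩
  refine mem_closure_of_tendsto (f := F) (b := atTop) ?_
    (Eventually.of_forall fun k => ⟨_, _, h1.lpSum h2 (hp k), hbd, fun u => rfl⟩)
  rw [tendsto_iff_norm_sub_tendsto_zero]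
  have hlim : Tendsto (fun k : ℕ => ((2 : ℝ) ^ (1 / ((k : ℝ) + 1)) - 1) * ‖M‖) atTop (𝓝 0) := by
    have h := ((Real.continuous_const_rpow (by norm_num : (2 : ℝ) ≠ 0)).tendsto 0).comp
      (tendsto_one_div_add_atTop_nhds_zero_nat (𝕜 := ℝ))
    rw [Real.rpow_zero] at h
    simpa using (h.sub_const 1).mul_const ‖M‖
  refine squeeze_zero (fun _ => norm_nonneg _) (fun k => ?_) hlim
  have h2k : (1 : ℝ) ≤ (2 : ℝ) ^ (1 / ((k : ℝ) + 1)) :=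
    Real.one_le_rpow (by norm_num) (by positivity)
  refine (ContinuousMap.norm_le _ (mul_nonneg (by linarith) (norm_nonneg _))).2 fun u => ?_
  have e : (F k - f ⊔ g) u =
      (x u ^ ((k : ℝ) + 1) + y u ^ ((k : ℝ) + 1)) ^ (1 / ((k : ℝ) + 1)) - max (x u) (y u) := by
    have h3 : max (x u) (y u) = max (f u) (g u) + (b u + d u) := by
      rw [hab, hcd, hx, hy, ← max_add_add_right]
      congr 1 <;> ring
    simp only [F, ContinuousMap.sub_apply, ContinuousMap.coe_mk, ContinuousMap.sup_apply, h3]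
    ring
  rw [e, Real.norm_eq_abs]
  refine (abs_lpSum_sub_max_le (h1.nonneg _) (h2.nonneg _) (hp k)).trans ?_
  exact mul_le_mul_of_nonneg_left ((le_abs_self _).trans (M.norm_coe_le_norm u)) (by linarith)

theorem separatesPointsStrongly_gaugeDiff : (gaugeDiff n).SeparatesPointsStrongly := by
  intro v x y
  have key : ∀ (α : ℝ) (c : En n), ∃ f ∈ gaugeDiff n, ∀ u : Sph n, f u = α + ⟪c, (u : En n)⟫_ℝ := by
    intro α c
    refine ⟨⟨fun u => α + ⟪c, (u : En n)⟫_ℝ, by fun_prop⟩, ⟨_, _,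
      isGauge_linear c (k := ‖c‖ + |α| + 1) (by linarith [abs_nonneg α]),
      isGauge_linear 0 (k := ‖c‖ + |α| + 1 - α)
        (by rw [norm_zero]; linarith [le_abs_self α, norm_nonneg c]), fun u => ?_⟩, fun u => rfl⟩
    simp only [ContinuousMap.coe_mk, norm_sph, inner_zero_left]
    ring
  by_cases hxy : x = y
  · obtain ⟨f, hf, h⟩ := key (v x) 0
    exact ⟨f, hf, by simp [h], by simp [h, hxy]⟩
  · have hne : ‖(x : En n) - y‖ ^ 2 ≠ 0 := by
      simpa [sub_eq_zero, Subtype.ext_iff] using hxy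
    set t := (v x - v y) / ‖(x : En n) - y‖ ^ 2 with ht
    obtain ⟨f, hf, h⟩ := key (v y - t * ⟪(x : En n) - y, (y : En n)⟫_ℝ) (t • ((x : En n) - y))
    refine ⟨f, hf, ?_, ?_⟩
    · rw [h, real_inner_smul_left]
      have : ⟪(x : En n) - y, (x : En n)⟫_ℝ - ⟪(x : En n) - y, (y : En n)⟫_ℝ =
          ‖(x : En n) - y‖ ^ 2 := by rw [← inner_sub_right, real_inner_self_eq_norm_sq]
      have h4 : t * ‖(x : En n) - y‖ ^ 2 = v x - v y := div_mul_cancel₀ _ hne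
      rw [← this] at h4
      linarith
    · rw [h, real_inner_smul_left]; ring

theorem closure_gaugeDiff : closure (gaugeDiff n) = Set.univ := by
  have hsup : ∀ᵉ (f ∈ closure (gaugeDiff n)) (g ∈ closure (gaugeDiff n)),
      f ⊔ g ∈ closure (gaugeDiff n) := fun f hf g hg => by
    have hc : Continuous fun p : C(Sph n, ℝ) × C(Sph n, ℝ) => p.1 ⊔ p.2 :=
      ContinuousMap.continuous_of_continuous_uncurry _
        (((continuous_fst.comp continuous_fst).eval continuous_snd).max
          ((continuous_snd.comp continuous_fst).eval continuous_snd))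
    have := map_mem_closure₂ (f := fun f g : C(Sph n, ℝ) => f ⊔ g) hc hf hg
      (fun a ha b hb => sup_mem_closure_gaugeDiff ha hb)
    rwa [closure_closure] at this
  have hneg : ∀ f ∈ closure (gaugeDiff n), -f ∈ closure (gaugeDiff n) := fun f hf =>
    map_mem_closure continuous_neg hf fun a ha => neg_mem_gaugeDiff ha
  have := ContinuousMap.sublattice_closure_eq_top (closure (gaugeDiff n))
    ⟨0, subset_closure ⟨_, _, isGauge_norm, isGauge_norm, by simp⟩⟩
    (fun f hf g hg => by
      have h := hneg _ (hsup _ (hneg f hf) _ (hneg g hg))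
      have e : -(-f ⊔ -g) = f ⊓ g := by
        rw [neg_sup, neg_neg, neg_neg]
      rwa [e] at h) hsup
    (fun v x y => by
      obtain ⟨f, hf, h⟩ := separatesPointsStrongly_gaugeDiff v x y
      exact ⟨f, subset_closure hf, h⟩)
  rwa [closure_closure] at this

theorem IsGauge.exists_regularTest {a : En n → ℝ} (ha : IsGauge a) (hn : 0 < n) :
    ∃ L : ConvexBody (En n), RegularTest L ∧ ∀ x, supp L x = a x + ‖x‖ := by
  have h := ha.add isGauge_norm
  obtain ⟨L, hL⟩ := exists_body h.sub h.c2 hn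
  have e : supp L = fun x => a x + ‖x‖ := funext hL
  exact ⟨L, ⟨by rw [e]; exact h.c2, by rw [e]; exact h.pos, a, ha.sub, hL⟩, hL⟩

/-- A measure on the sphere is determined by its integrals against regular support functions. -/
theorem eq_of_forall_regularTest (hn : 2 ≤ n) {μ ν : Measure (Sph n)} [IsFiniteMeasure ν]
    (hν : ν ≠ 0)
    (h : ∀ L : ConvexBody (En n), RegularTest L →
      ∫ v : Sph n, supp L v ∂μ = ∫ v : Sph n, supp L v ∂ν) : μ = ν := by
  have hfin : IsFiniteMeasure μ := by
    obtain ⟨L, hL, he⟩ := isGauge_norm.exists_regularTest (n := n) (by omega)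
    have h1 := h L hL
    simp only [he, norm_sph, integral_const, smul_eq_mul] at h1
    have h2 : ν.real Set.univ ≠ 0 := by
      simpa [measureReal_def, ENNReal.toReal_eq_zero_iff] using hν
    refine ⟨lt_top_iff_ne_top.2 fun h3 => h2 ?_⟩
    have : μ.real Set.univ = 0 := by simp [measureReal_def, h3]
    rw [this] at h1
    linarith
  have hint : ∀ (ρ : Measure (Sph n)) [IsFiniteMeasure ρ] (f : C(Sph n, ℝ)), Integrable f ρ :=
    fun ρ _ f => Integrable.of_bound f.continuous.aestronglyMeasurable ‖f‖
      (Eventually.of_forall fun u => f.norm_coe_le_norm u)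
  have hcl : ∀ (ρ : Measure (Sph n)) [IsFiniteMeasure ρ],
      Continuous fun f : C(Sph n, ℝ) => ∫ v, f v ∂ρ := fun ρ _ => by
    refine continuous_of_linear_of_bound (𝕜 := ℝ) (f := fun f : C(Sph n, ℝ) => ∫ v, f v ∂ρ)
      ?_ ?_ (C := ρ.real Set.univ) ?_
    · intro f g; exact integral_add (hint ρ f) (hint ρ g)
    · intro c f; exact integral_const_mul c _
    · intro f
      rw [mul_comm]
      exact norm_integral_le_of_norm_le_const (Eventually.of_forall fun u => f.norm_coe_le_norm u)
  have hall : closure (gaugeDiff n) ⊆ {f | ∫ v, f v ∂μ = ∫ v, f v ∂ν} := by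
    refine closure_minimal ?_ (isClosed_eq (hcl μ) (hcl ν))
    rintro f ⟨a, b, ha, hb, hf⟩
    obtain ⟨L, hL, he⟩ := ha.exists_regularTest (by omega)
    obtain ⟨L', hL', he'⟩ := hb.exists_regularTest (by omega)
    have e : ∀ v : Sph n, f v = supp L v - supp L' v := fun v => by rw [hf, he, he']; ring
    have i1 : ∀ (ρ : Measure (Sph n)) [IsFiniteMeasure ρ],
      Integrable (fun v : Sph n => supp L v) ρ := fun ρ _ => hint ρ ⟨_, hL.c2.continuous_sph⟩
    have i2 : ∀ (ρ : Measure (Sph n)) [IsFiniteMeasure ρ],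
      Integrable (fun v : Sph n => supp L' v) ρ := fun ρ _ => hint ρ ⟨_, hL'.c2.continuous_sph⟩
    change ∫ v, f v ∂μ = ∫ v, f v ∂ν
    simp only [e]
    rw [integral_sub (i1 μ) (i2 μ), integral_sub (i1 ν) (i2 ν), h L hL, h L' hL']
  rw [closure_gaugeDiff] at hall
  exact ext_of_forall_integral_eq_of_IsFiniteMeasure fun f => hall (Set.mem_univ f.toContinuousMap)

/-- Area measures of bodies with regular support function and positive curvature. -/
theorem IsAreaMeasure.eq_withDensity (hm : 1 ≤ m) {i : ℕ} {K : ConvexBody (En (m + 1))}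
    (hK : C2off (supp K)) (hpos : ∀ u : Sph (m + 1), 0 < areaDens i (supp K) u)
    {μ : Measure (Sph (m + 1))} (hμ : IsAreaMeasure i K μ) :
    μ = (sphVol (m + 1)).withDensity fun u => ENNReal.ofReal (areaDens i (supp K) u) := by
  have hD := continuous_areaDens i hK
  have : IsFiniteMeasure ((sphVol (m + 1)).withDensity
      fun u : Sph (m + 1) => ENNReal.ofReal (areaDens i (supp K) u)) :=
    isFiniteMeasure_withDensity_ofReal (integrable_of_continuous hD).2
  refine eq_of_forall_regularTest (by omega) ?_ fun L hL => ?_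
  · intro h0
    have h1 := withDensity_eq_zero_iff (hD.measurable.ennreal_ofReal.aemeasurable) |>.1 h0
    have h2 : sphVol (m + 1) = 0 := by
      rw [← ae_eq_bot, ← Filter.eventually_false_iff_eq_bot]
      filter_upwards [h1] with u hu
      exact (ENNReal.ofReal_pos.2 (hpos u)).ne' hu
    have h3 := (isOpen_univ (X := Sph (m + 1))).measure_ne_zero (sphVol (m + 1))
      ⟨⟨pole (m + 1), by simpa using norm_pole (Nat.succ_pos m)⟩, trivial⟩
    rw [h2] at h3
    simp at h3
  · rw [hμ L, ← integral_supp_mul_areaDens i hK hL,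
      integral_withDensity_eq_integral_toReal_smul hD.measurable.ennreal_ofReal
        (Eventually.of_forall fun u => ENNReal.ofReal_lt_top)]
    refine integral_congr_ae (Eventually.of_forall fun u => ?_)
    simp [ENNReal.toReal_ofReal (hpos u).le, mul_comm]

end

theorem continuous_supp (K : ConvexBody (En n)) : Continuous (supp K) := by
  have h := isSublin_supp K
  have hc : ConvexOn ℝ Set.univ (supp K) := by
    refine ⟨convex_univ, fun x _ y _ a b ha hb _ => ?_⟩
    have := h.add_le (a • x) (b • y)
    rw [h.smul a ha, h.smul b hb] at this
    simpa using this
  exact hc.locallyLipschitz.continuous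

/-- A profile function of a support function may be replaced by a continuous one. -/
theorem exists_continuous_profile (hn : 2 ≤ n) {L : ConvexBody (En n)} {g : ℝ → ℝ}
    (hprof : ∀ u : En n, ‖u‖ = 1 → supp L u = g ⟪u, pole n⟫_ℝ) :
    ∃ g' : ℝ → ℝ, Continuous g' ∧ ∀ t ∈ Set.Icc (-1 : ℝ) 1, g t = g' t := by
  have hp : ‖pole n‖ = 1 := norm_pole (by omega)
  obtain ⟨e, he, hpe⟩ := exists_orthogonal_unit hn hp
  refine ⟨fun t => supp L (t • pole n + Real.sqrt (1 - t ^ 2) • e),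
    (continuous_supp L).comp (by fun_prop), fun t ht => ?_⟩
  have h1 : 0 ≤ 1 - t ^ 2 := by nlinarith [ht.1, ht.2]
  have h2 : ⟪t • pole n + Real.sqrt (1 - t ^ 2) • e, pole n⟫_ℝ = t := by
    rw [inner_add_left, inner_smul_left, inner_smul_left, real_inner_comm (pole n) e, hpe,
      real_inner_self_eq_norm_sq, hp]
    simp
  have h3 : ‖t • pole n + Real.sqrt (1 - t ^ 2) • e‖ = 1 := by
    have : ‖t • pole n + Real.sqrt (1 - t ^ 2) • e‖ ^ 2 = 1 := by
      rw [norm_add_sq_real, norm_smul, norm_smul, inner_smul_left, inner_smul_right, hpe, hp, he,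
        mul_one, mul_one, Real.norm_eq_abs, Real.norm_eq_abs, sq_abs, sq_abs, Real.sq_sqrt h1]
      simp
    nlinarith [norm_nonneg (t • pole n + Real.sqrt (1 - t ^ 2) • e)]
  change g t = supp L _
  rw [hprof _ h3, h2]

open scoped Classical in
/-- The extension by zero of a function on the sphere. -/
def extS (φ : C(Sph n, ℝ)) (x : En n) : ℝ :=
  if h : x ∈ sphere (0 : En n) 1 then φ ⟨x, h⟩ else 0

@[simp] theorem extS_coe (φ : C(Sph n, ℝ)) (v : Sph n) : extS φ v = φ v := by
  simp [extS]

theorem continuousOn_extS (φ : C(Sph n, ℝ)) : ContinuousOn (extS φ) (sphere (0 : En n) 1) := by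
  rw [continuousOn_iff_continuous_domRestrict]
  convert φ.continuous using 1
  ext v
  exact extS_coe φ v

/-- The convolution transform on continuous functions. -/
def convT (g : ℝ → ℝ) (φ : C(Sph n, ℝ)) : En n → ℝ := Tg g (extS φ)

theorem convT_apply (g : ℝ → ℝ) (φ : C(Sph n, ℝ)) (x : En n) :
    convT g φ x = ‖x‖ * ∫ v : Sph n, g ⟪‖x‖⁻¹ • x, (v : En n)⟫_ℝ * φ v ∂(sphVol n) := by
  simp [convT, Tg]

theorem convT_unit (g : ℝ → ℝ) (φ : C(Sph n, ℝ)) {x : En n} (hx : ‖x‖ = 1) :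
    convT g φ x = ∫ v : Sph n, g ⟪x, (v : En n)⟫_ℝ * φ v ∂(sphVol n) := by
  simp [convT_apply, hx]

theorem posHom_convT (g : ℝ → ℝ) (φ : C(Sph n, ℝ)) : PosHom (convT g φ) := fun c hc x => by
  have h : ‖c • x‖⁻¹ • c • x = ‖x‖⁻¹ • x := by
    rw [norm_smul, Real.norm_of_nonneg hc.le, mul_inv, smul_smul, mul_comm c⁻¹, mul_assoc,
      inv_mul_cancel₀ hc.ne', mul_one]
  rw [convT_apply, convT_apply, h, norm_smul, Real.norm_of_nonneg hc.le, mul_assoc]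

theorem convT_smul (g : ℝ → ℝ) (c : ℝ) (φ : C(Sph n, ℝ)) :
    convT g (c • φ) = fun x => c * convT g φ x := by
  funext x
  rw [convT_apply, convT_apply, mul_left_comm, ← integral_const_mul c]
  congr 2
  funext v
  simp only [ContinuousMap.smul_apply, smul_eq_mul]
  ring

theorem integrable_kernel {g : ℝ → ℝ} (hg : Continuous g) (φ : C(Sph n, ℝ)) (x : En n) :
    Integrable (fun v : Sph n => g ⟪x, (v : En n)⟫_ℝ * φ v) (sphVol n) :=
  integrable_of_continuous (by fun_prop)

theorem convT_add {g : ℝ → ℝ} (hg : Continuous g) (φ ψ : C(Sph n, ℝ)) :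
    convT g (φ + ψ) = fun x => convT g φ x + convT g ψ x := by
  funext x
  rw [convT_apply, convT_apply, convT_apply, ← mul_add,
    ← integral_add (integrable_kernel hg φ _) (integrable_kernel hg ψ _)]
  congr 2
  funext v
  simp only [ContinuousMap.add_apply]
  ring

/-- The multipliers of a zonal kernel. -/
def kerMult (n : ℕ) (g : ℝ → ℝ) (k : ℕ) : ℝ :=
  ∫ v : Sph n, g ⟪pole n, (v : En n)⟫_ℝ * (legPoly n k).eval ⟪pole n, (v : En n)⟫_ℝ ∂(sphVol n)

/-- The `1`-homogeneous extension of a zonal polynomial function. -/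
def zonalHom (q : Polynomial ℝ) (w x : En n) : ℝ := ‖x‖ * q.eval (‖x‖⁻¹ * ⟪x, w⟫_ℝ)

theorem convT_zonal (hn : 3 ≤ n) {g : ℝ → ℝ} (hg : Continuous g) (k : ℕ) {w : En n}
    (hw : ‖w‖ = 1) :
    convT g (zonal k w) = fun x => kerMult n g k * zonalHom (legPoly n k) w x := by
  funext x
  rw [convT_apply, zonalHom]
  by_cases hx : x = 0
  · simp [hx]
  have h1 : ‖‖x‖⁻¹ • x‖ = 1 := by
    rw [norm_smul, norm_inv, norm_norm, inv_mul_cancel₀ (norm_ne_zero_iff.2 hx)]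
  simp only [zonal_apply]
  rw [funk_hecke hn hg k h1 hw, inner_smul_left, kerMult]
  simp only [conj_trivial]
  ring

theorem zonal_zero (w : En n) : zonal 0 w = 1 := by
  ext v
  simp [legPoly_zero]

theorem convT_one (hn : 3 ≤ n) {g : ℝ → ℝ} (hg : Continuous g) (h0 : kerMult n g 0 = 1) :
    convT g (1 : C(Sph n, ℝ)) = fun x => ‖x‖ := by
  rw [← zonal_zero (pole n), convT_zonal hn hg 0 (norm_pole (by omega)), h0]
  funext x
  simp [zonalHom, legPoly_zero]

theorem hasFDerivAt_norm' {x : En n} (hx : x ≠ 0) :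
    HasFDerivAt (fun y : En n => ‖y‖) (‖x‖⁻¹ • innerSL ℝ x) x := by
  rw [← fderiv_norm_eq hx]
  exact ((contDiffAt_norm ℝ hx).differentiableAt (n := 1) (by norm_num)).hasFDerivAt

theorem hasFDerivAt_angle (w : En n) {x : En n} (hx : x ≠ 0) :
    HasFDerivAt (fun y : En n => ‖y‖⁻¹ * ⟪y, w⟫_ℝ)
      (‖x‖⁻¹ • innerSL ℝ w - (‖x‖⁻¹ * (‖x‖⁻¹ * ⟪x, w⟫_ℝ)) • (‖x‖⁻¹ • innerSL ℝ x)) x := by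
  have hx' : ‖x‖ ≠ 0 := norm_ne_zero_iff.2 hx
  have h1 := ((hasDerivAt_inv hx').comp_hasFDerivAt x (hasFDerivAt_norm' hx))
  have h2 : HasFDerivAt (fun y : En n => ⟪y, w⟫_ℝ) (innerSL ℝ w) x := by
    have := (innerSL ℝ w).hasFDerivAt (x := x)
    refine this.congr_of_eventuallyEq (Eventually.of_forall fun y => ?_)
    simp [real_inner_comm]
  have h3 := h1.mul h2
  refine h3.congr_fderiv ?_
  ext v
  simp
  field_simp
  ring

theorem hasFDerivAt_zonalHom (q : Polynomial ℝ) (w : En n) {x : En n} (hx : x ≠ 0) :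
    HasFDerivAt (zonalHom q w)
      ((q - Polynomial.X * q.derivative).eval (‖x‖⁻¹ * ⟪x, w⟫_ℝ) •
          fderiv ℝ (fun y : En n => ‖y‖) x +
        q.derivative.eval (‖x‖⁻¹ * ⟪x, w⟫_ℝ) • innerSL ℝ w) x := by
  have hx' : ‖x‖ ≠ 0 := norm_ne_zero_iff.2 hx
  have h1 := (q.hasDerivAt (‖x‖⁻¹ * ⟪x, w⟫_ℝ)).comp_hasFDerivAt x (hasFDerivAt_angle w hx)
  refine ((hasFDerivAt_norm' hx).mul h1).congr_fderiv ?_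
  rw [fderiv_norm_eq hx]
  ext v
  simp
  field_simp
  ring

theorem hessB_zonalHom (q : Polynomial ℝ) (w : En n) {u : En n} (hu : ‖u‖ = 1) (v v' : En n) :
    hessB (zonalHom q w) u v v' =
      (q - Polynomial.X * q.derivative).eval ⟪u, w⟫_ℝ * (⟪v, v'⟫_ℝ - ⟪u, v⟫_ℝ * ⟪u, v'⟫_ℝ) +
        q.derivative.derivative.eval ⟪u, w⟫_ℝ *
          ((⟪w, v⟫_ℝ - ⟪u, w⟫_ℝ * ⟪u, v⟫_ℝ) * (⟪w, v'⟫_ℝ - ⟪u, w⟫_ℝ * ⟪u, v'⟫_ℝ)) := by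
  have hu0 : u ≠ 0 := fun h => by simp [h] at hu
  set r := q - Polynomial.X * q.derivative with hr
  have h1 : fderiv ℝ (zonalHom q w) =ᶠ[𝓝 u] fun x =>
      r.eval (‖x‖⁻¹ * ⟪x, w⟫_ℝ) • fderiv ℝ (fun y : En n => ‖y‖) x +
        q.derivative.eval (‖x‖⁻¹ * ⟪x, w⟫_ℝ) • innerSL ℝ w := by
    filter_upwards [isOpen_compl_singleton.mem_nhds hu0] with x hx
    exact (hasFDerivAt_zonalHom q w hx).fderiv
  have h2 := (r.hasDerivAt (‖u‖⁻¹ * ⟪u, w⟫_ℝ)).comp_hasFDerivAt u (hasFDerivAt_angle w hu0)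
  have h3 := (q.derivative.hasDerivAt (‖u‖⁻¹ * ⟪u, w⟫_ℝ)).comp_hasFDerivAt u
    (hasFDerivAt_angle w hu0)
  have h4 : HasFDerivAt (fderiv ℝ (fun y : En n => ‖y‖)) (hessB (fun y : En n => ‖y‖) u) u :=
    (c2off_norm.differentiableAt_fderiv hu0).hasFDerivAt
  have h5 := (h2.smul h4).add (h3.smul_const (innerSL ℝ w))
  rw [hessB, h1.fderiv_eq]
  have h6 := h5.fderiv
  simp only [Function.comp_def] at h6
  erw [h6]
  have h7 := hessB_norm hu v v'
  simp only [add_apply, smul_apply,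
    ContinuousLinearMap.smulRight_apply, sub_apply, innerSL_apply_apply,
    fderiv_norm_eq hu0, hu, inv_one, one_mul, one_smul, smul_eq_mul, h7]
  have h8 : r.derivative = - (Polynomial.X * q.derivative.derivative) := by
    rw [hr]; simp
  rw [h8]
  simp
  ring

theorem sum_hessE_zonalHom (q : Polynomial ℝ) {u w : En n} (hu : ‖u‖ = 1) (hw : ‖w‖ = 1) :
    ∑ j, hessE (zonalHom q w) u j j =
      ((n : ℝ) - 1) * (q - Polynomial.X * q.derivative).eval ⟪u, w⟫_ℝ +
        (1 - ⟪u, w⟫_ℝ ^ 2) * q.derivative.derivative.eval ⟪u, w⟫_ℝ := by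
  have hs : ∀ x y : En n, ∑ j, x j * y j = ⟪x, y⟫_ℝ := fun x y => by
    simp [PiLp.inner_apply, mul_comm]
  have e1 := hs u u
  have e2 := hs w w
  have e3 := hs u w
  rw [real_inner_self_eq_norm_sq, hu] at e1
  rw [real_inner_self_eq_norm_sq, hw] at e2
  simp only [hessE_eq, hessB_zonalHom q w hu]
  set τ := ⟪u, w⟫_ℝ
  set A := (q - Polynomial.X * q.derivative).eval τ
  set B := q.derivative.derivative.eval τ
  have : ∀ j : Fin n, A * (⟪(EuclideanSpace.single j 1 : En n), EuclideanSpace.single j 1⟫_ℝ -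
        ⟪u, EuclideanSpace.single j 1⟫_ℝ * ⟪u, EuclideanSpace.single j 1⟫_ℝ) +
      B * ((⟪w, EuclideanSpace.single j 1⟫_ℝ - τ * ⟪u, EuclideanSpace.single j 1⟫_ℝ) *
        (⟪w, EuclideanSpace.single j 1⟫_ℝ - τ * ⟪u, EuclideanSpace.single j 1⟫_ℝ)) =
      A - A * (u j * u j) + B * (w j * w j) - 2 * B * τ * (u j * w j) +
        B * τ ^ 2 * (u j * u j) := fun j => by
    have hi : ∀ x : En n, ⟪x, (EuclideanSpace.single j 1 : En n)⟫_ℝ = x j := fun x => by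
      simp [EuclideanSpace.inner_single_right]
    rw [hi, hi, hi]
    simp
    ring
  rw [Finset.sum_congr rfl fun j _ => this j]
  simp only [Finset.sum_add_distrib, Finset.sum_sub_distrib, ← Finset.mul_sum, e1, e2, e3]
  simp
  ring

theorem sum_hessE_zonalHom_legPoly (k : ℕ) {u w : En n} (hu : ‖u‖ = 1)
    (hw : ‖w‖ = 1) :
    ∑ j, hessE (zonalHom (legPoly n k) w) u j j =
      -(((k : ℝ) - 1) * ((k : ℝ) + n - 1)) * (legPoly n k).eval ⟪u, w⟫_ℝ := by
  rw [sum_hessE_zonalHom _ hu hw]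
  have h := congrArg (Polynomial.eval ⟪u, w⟫_ℝ) (legPoly_ode n k)
  simp at h ⊢
  linear_combination h

theorem hessB_add {h k : En n → ℝ} (hh : C2off h) (hk : C2off k) {x : En n} (hx : x ≠ 0) :
    hessB (fun y => h y + k y) x = hessB h x + hessB k x := by
  have h1 : (fderiv ℝ fun y => h y + k y) =ᶠ[𝓝 x] fun y => fderiv ℝ h y + fderiv ℝ k y := by
    filter_upwards [isOpen_compl_singleton.mem_nhds hx] with y hy
    exact fderiv_fun_add (hh.differentiableAt hy) (hk.differentiableAt hy)
  rw [hessB, h1.fderiv_eq]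
  exact fderiv_fun_add (hh.differentiableAt_fderiv hx) (hk.differentiableAt_fderiv hx)

theorem hessB_const_mul {h : En n → ℝ} (hh : C2off h) (c : ℝ) {x : En n} (hx : x ≠ 0) :
    hessB (fun y => c * h y) x = c • hessB h x := by
  have h1 : (fderiv ℝ fun y => c * h y) =ᶠ[𝓝 x] fun y => c • fderiv ℝ h y := by
    filter_upwards [isOpen_compl_singleton.mem_nhds hx] with y hy
    exact fderiv_const_mul (hh.differentiableAt hy) c
  rw [hessB, h1.fderiv_eq]
  exact fderiv_fun_const_smul (hh.differentiableAt_fderiv hx) c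

theorem c2off_zonalHom (q : Polynomial ℝ) (w : En n) : C2off (zonalHom q w) := by
  intro x hx
  have hx' : ‖x‖ ≠ 0 := norm_ne_zero_iff.2 hx
  have h1 : ContDiffAt ℝ 2 (fun y : En n => ‖y‖) x := contDiffAt_norm ℝ hx
  have h2 : ContDiffAt ℝ 2 (fun y : En n => ‖y‖⁻¹ * ⟪y, w⟫_ℝ) x :=
    (h1.inv hx').mul (contDiffAt_id.inner ℝ contDiffAt_const)
  have h3 : ContDiff ℝ 2 fun t : ℝ => q.eval t := by
    simpa [Polynomial.aeval_def] using q.contDiff_aeval (𝕜 := ℝ) 2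
  exact (h1.mul (h3.contDiffAt.comp x h2)).contDiffWithinAt

/-- The total mass of the spherical Lebesgue measure. -/
abbrev sphMass (n : ℕ) : ℝ := (sphVol n).real Set.univ

theorem sphMass_nonneg (n : ℕ) : 0 ≤ sphMass n := measureReal_nonneg

theorem sphL2_le {f : En n → ℝ} {c : ℝ} (hc : 0 ≤ c) (h : ∀ v : Sph n, |f v| ≤ c) :
    sphL2 f ≤ Real.sqrt (sphMass n) * c := by
  have h1 : ‖∫ v : Sph n, (f v) ^ 2 ∂(sphVol n)‖ ≤ c ^ 2 * sphMass n :=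
    norm_integral_le_of_norm_le_const (Eventually.of_forall fun v => by
      rw [Real.norm_eq_abs, abs_pow]
      exact pow_le_pow_left₀ (abs_nonneg _) (h v) 2)
  calc sphL2 f ≤ Real.sqrt (c ^ 2 * sphMass n) :=
        Real.sqrt_le_sqrt ((le_abs_self _).trans h1)
    _ = _ := by rw [Real.sqrt_mul (sq_nonneg c), Real.sqrt_sq hc, mul_comm]

theorem UBounds_mono {α M M' : ℝ} {f : En n → ℝ} (h : M ∈ UBounds α f) (hM : M ≤ M') :
    M' ∈ UBounds α f := by
  refine ⟨fun u hu => (h.1 u hu).trans hM, fun k hk => ?_⟩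
  obtain ⟨p, hp, h2⟩ := h.2 k hk
  exact ⟨p, hp, h2.trans (by gcongr)⟩

theorem UNorm_le (hn : 0 < n) {α M : ℝ} {f : En n → ℝ} (h : M ∈ UBounds α f) :
    UNorm α f ≤ M :=
  csInf_le ⟨0, fun _ hM => (abs_nonneg _).trans (hM.1 _ (norm_pole hn))⟩ h

theorem mem_UBounds_zero (φ : C(Sph n, ℝ)) :
    (1 + Real.sqrt (sphMass n)) * ‖φ‖ ∈ UBounds 0 (extS φ) := by
  have h1 : ∀ v : Sph n, |extS φ v| ≤ ‖φ‖ := fun v => by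
    rw [extS_coe]; exact φ.norm_coe_le_norm v
  refine ⟨fun u hu => (h1 ⟨u, by simpa using hu⟩).trans ?_, fun k hk => ⟨0, by simp, ?_⟩⟩
  · nlinarith [norm_nonneg φ, Real.sqrt_nonneg (sphMass n)]
  · have h2 := sphL2_le (norm_nonneg φ) h1
    simp only [map_zero, sub_zero, neg_zero, Real.rpow_zero, mul_one]
    nlinarith [norm_nonneg φ]

/-- The regularity conditions on a zonal kernel. -/
structure IsRegKernel (n i : ℕ) (g : ℝ → ℝ) : Prop where
  three_le : 3 ≤ n
  pos : 0 < i
  cont : Continuous g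
  c2 : ∀ f : En n → ℝ, ContinuousOn f (sphere (0 : En n) 1) → ContDiffOn ℝ 2 (Tg g f) {0}ᶜ
  mult_zero : kerMult n g 0 = 1
  mult_lt : ∀ k : ℕ, 2 ≤ k →
    ((k : ℝ) - 1) * ((k : ℝ) + n - 1) * |kerMult n g k| < ((n : ℝ) - 1) / i
  hess_mem : ∃ β > (0 : ℝ), ∀ α : ℝ, 0 ≤ α → ∃ C > (0 : ℝ), ∀ f : En n → ℝ, MemU α f →
    ∀ j l : Fin n, C * UNorm α f ∈ UBounds (α + β) (fun u => hessE (Tg g f) u j l)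

/-- The multipliers of the linearization at the sphere. -/
def linMult (n i : ℕ) (g : ℝ → ℝ) (k : ℕ) : ℝ :=
  -((i : ℝ) / ((n : ℝ) - 1) * (((k : ℝ) - 1) * ((k : ℝ) + n - 1) * kerMult n g k))

namespace IsRegKernel

variable {i : ℕ} {g : ℝ → ℝ}

theorem one_lt (hg : IsRegKernel n i g) : (0 : ℝ) < (n : ℝ) - 1 := by
  have : (3 : ℝ) ≤ n := by exact_mod_cast hg.three_le
  linarith

theorem c2off (hg : IsRegKernel n i g) (φ : C(Sph n, ℝ)) : C2off (convT g φ) :=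
  hg.c2 _ (continuousOn_extS φ)

theorem hessB_convT_add (hg : IsRegKernel n i g) (φ ψ : C(Sph n, ℝ)) {x : En n} (hx : x ≠ 0) :
    hessB (convT g (φ + ψ)) x = hessB (convT g φ) x + hessB (convT g ψ) x := by
  rw [convT_add hg.cont, hessB_add (hg.c2off φ) (hg.c2off ψ) hx]

theorem hessB_convT_smul (hg : IsRegKernel n i g) (c : ℝ) (φ : C(Sph n, ℝ)) {x : En n}
    (hx : x ≠ 0) : hessB (convT g (c • φ)) x = c • hessB (convT g φ) x := by
  rw [convT_smul, hessB_const_mul (hg.c2off φ) c hx]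

theorem exists_hessE_bound (hg : IsRegKernel n i g) : ∃ A : ℝ, 0 ≤ A ∧
    ∀ (φ : C(Sph n, ℝ)) (u : En n), ‖u‖ = 1 → ∀ j l, |hessE (convT g φ) u j l| ≤ A * ‖φ‖ := by
  obtain ⟨β, hβ, h⟩ := hg.hess_mem
  obtain ⟨C, hC, h⟩ := h 0 le_rfl
  refine ⟨C * (1 + Real.sqrt (sphMass n)), by positivity, fun φ u hu j l => ?_⟩
  have h1 := mem_UBounds_zero φ
  refine ((h (extS φ) ⟨_, h1⟩ j l).1 u hu).trans ?_
  rw [mul_assoc]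
  gcongr
  exact UNorm_le (by have := hg.three_le; omega) h1

/-- The linearization at the sphere. -/
def linFun (hg : IsRegKernel n i g) (φ : C(Sph n, ℝ)) : C(Sph n, ℝ) :=
  ⟨fun u => (i : ℝ) / ((n : ℝ) - 1) * ∑ j, hessE (convT g φ) u j j,
    continuous_const.mul (continuous_finsetSum _ fun j _ => (hg.c2off φ).continuous_hessE j j)⟩

theorem linFun_apply (hg : IsRegKernel n i g) (φ : C(Sph n, ℝ)) (u : Sph n) :
    hg.linFun φ u = (i : ℝ) / ((n : ℝ) - 1) * ∑ j, hessE (convT g φ) u j j := rfl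

theorem exists_linFun_bound (hg : IsRegKernel n i g) :
    ∃ A : ℝ, ∀ φ : C(Sph n, ℝ), ‖hg.linFun φ‖ ≤ A * ‖φ‖ := by
  obtain ⟨A, hA, h⟩ := hg.exists_hessE_bound
  have h1 := hg.one_lt
  refine ⟨(i : ℝ) / ((n : ℝ) - 1) * (n * A), fun φ => ?_⟩
  rw [ContinuousMap.norm_le _ (by positivity)]
  intro u
  rw [linFun_apply, norm_mul, Real.norm_of_nonneg (by positivity), mul_assoc]
  gcongr
  refine (norm_sum_le _ _).trans ((Finset.sum_le_sum fun j _ =>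
    h φ u (norm_eq_of_mem_sphere u) j j).trans ?_)
  simp [mul_assoc]

/-- The linearization at the sphere, as a continuous linear map. -/
def lin (hg : IsRegKernel n i g) : C(Sph n, ℝ) →L[ℝ] C(Sph n, ℝ) :=
  LinearMap.mkContinuousOfExistsBound
    { toFun := hg.linFun
      map_add' := fun φ ψ => by
        ext u
        simp only [ContinuousMap.add_apply, linFun_apply, hessE_eq,
          hg.hessB_convT_add φ ψ (sph_ne_zero u), add_apply, Finset.sum_add_distrib,
          mul_add]
      map_smul' := fun c φ => by
        ext u
        simp only [ContinuousMap.smul_apply, linFun_apply, hessE_eq,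
          hg.hessB_convT_smul c φ (sph_ne_zero u), smul_apply,
          smul_eq_mul, ← Finset.mul_sum, RingHom.id_apply]
        ring }
    hg.exists_linFun_bound

theorem lin_apply (hg : IsRegKernel n i g) (φ : C(Sph n, ℝ)) (u : Sph n) :
    hg.lin φ u = (i : ℝ) / ((n : ℝ) - 1) * ∑ j, hessE (convT g φ) u j j := rfl

theorem sum_hessE_convT_zonal (hg : IsRegKernel n i g) (k : ℕ) {w u : En n} (hw : ‖w‖ = 1)
    (hu : ‖u‖ = 1) : ∑ j, hessE (convT g (zonal k w)) u j j =
      -(((k : ℝ) - 1) * ((k : ℝ) + n - 1) * kerMult n g k) * (legPoly n k).eval ⟪w, u⟫_ℝ := by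
  have hu0 : u ≠ 0 := fun h => by simp [h] at hu
  have h := sum_hessE_zonalHom_legPoly k hu hw
  simp only [hessE_eq] at h ⊢
  rw [convT_zonal hg.three_le hg.cont k hw, hessB_const_mul (c2off_zonalHom _ _) _ hu0]
  simp only [smul_apply, smul_eq_mul, ← Finset.mul_sum]
  rw [h, real_inner_comm]
  ring

theorem lin_zonal (hg : IsRegKernel n i g) (k : ℕ) {w : En n} (hw : ‖w‖ = 1) :
    hg.lin (zonal k w) = linMult n i g k • zonal k w := by
  ext u
  rw [lin_apply, hg.sum_hessE_convT_zonal k hw (norm_eq_of_mem_sphere u)]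
  simp only [ContinuousMap.smul_apply, zonal_apply, smul_eq_mul, linMult]
  ring

theorem linMult_zero (hg : IsRegKernel n i g) : linMult n i g 0 = i := by
  have := hg.one_lt.ne'
  rw [linMult, hg.mult_zero]
  field_simp
  simp

theorem linMult_one : linMult n i g 1 = 0 := by simp [linMult]

theorem abs_linMult_lt_one (hg : IsRegKernel n i g) {k : ℕ} (hk : 2 ≤ k) :
    |linMult n i g k| < 1 := by
  have h := hg.mult_lt k hk
  have h1 := hg.one_lt
  have h2 : (0 : ℝ) < i := by exact_mod_cast hg.pos
  have hk' : (2 : ℝ) ≤ k := by exact_mod_cast hk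
  rw [linMult, abs_neg, abs_mul, abs_mul, abs_of_nonneg (by positivity : 0 ≤ (i : ℝ) / ((n : ℝ) - 1)),
    abs_of_nonneg (mul_nonneg (by linarith) (by linarith))]
  calc _ < (i : ℝ) / ((n : ℝ) - 1) * (((n : ℝ) - 1) / i) := by gcongr
    _ = 1 := by field_simp

end IsRegKernel

theorem abs_integral_mul_le_sphL2 {f h : En n → ℝ} (hf : Continuous fun v : Sph n => f v)
    (hh : Continuous fun v : Sph n => h v) :
    |∫ v : Sph n, f v * h v ∂(sphVol n)| ≤ sphL2 f * sphL2 h := by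
  rw [sphL2, sphL2, ← Real.sqrt_mul (integral_nonneg fun v => sq_nonneg _)]
  refine Real.abs_le_sqrt ?_
  have h1 : Integrable (fun v : Sph n => (f v) ^ 2) (sphVol n) :=
    integrable_of_continuous (hf.pow 2)
  have h2 : Integrable (fun v : Sph n => (h v) ^ 2) (sphVol n) :=
    integrable_of_continuous (hh.pow 2)
  have h3 : Integrable (fun v : Sph n => f v * h v) (sphVol n) :=
    integrable_of_continuous (hf.mul hh)
  have h4 : ∀ t : ℝ, 0 ≤ (∫ v : Sph n, (f v) ^ 2 ∂(sphVol n)) * (t * t) +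
      (2 * ∫ v : Sph n, f v * h v ∂(sphVol n)) * t + ∫ v : Sph n, (h v) ^ 2 ∂(sphVol n) := by
    intro t
    have : 0 ≤ ∫ v : Sph n, (t * f v + h v) ^ 2 ∂(sphVol n) :=
      integral_nonneg fun v => sq_nonneg _
    have e : (fun v : Sph n => (t * f v + h v) ^ 2) = fun v : Sph n =>
        ((t * t) * (f v) ^ 2 + (2 * t) * (f v * h v)) + (h v) ^ 2 := by
      funext v; ring
    have h5 : Integrable (fun v : Sph n => (t * t) * (f v) ^ 2 + (2 * t) * (f v * h v)) (sphVol n) :=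
      (h1.const_mul _).add (h3.const_mul _)
    rw [e, integral_add h5 h2, integral_add (h1.const_mul _) (h3.const_mul _), integral_const_mul, integral_const_mul] at this
    linarith
  have h5 := discrim_le_zero h4
  rw [discrim] at h5
  linarith

/-- The zonal harmonic of degree `k` about the pole, as a polynomial. -/
def zonalMv (hn : 0 < n) (k : ℕ) : MvPolynomial (Fin n) ℝ :=
  Polynomial.aeval (MvPolynomial.X ⟨0, hn⟩) (legPoly n k)

theorem zonalMv_totalDegree_le (hn : 3 ≤ n) (k : ℕ) :
    (zonalMv (n := n) (by omega) k).totalDegree ≤ k := by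
  rw [zonalMv, Polynomial.aeval_eq_sum_range, legPoly_natDegree hn]
  refine MvPolynomial.totalDegree_finsetSum_le fun j hj => ?_
  refine (MvPolynomial.totalDegree_smul_le _ _).trans ?_
  refine (MvPolynomial.totalDegree_pow _ _).trans ?_
  rw [MvPolynomial.totalDegree_X, mul_one]
  exact Nat.lt_succ_iff.1 (Finset.mem_range.1 hj)

theorem eval_zonalMv (hn : 0 < n) (k : ℕ) (x : En n) :
    MvPolynomial.eval (fun j => x j) (zonalMv hn k) = (legPoly n k).eval ⟪pole n, x⟫_ℝ := by
  have h : ⟪pole n, x⟫_ℝ = x ⟨0, hn⟩ := by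
    simp [pole, hn, EuclideanSpace.inner_single_left]
  rw [h, zonalMv, ← MvPolynomial.coe_aeval_eq_eval, AlgHom.coe_toRingHom, ← Polynomial.aeval_algHom_apply]
  simp

theorem sphL2_zonal (hn : 3 ≤ n) (k : ℕ) {w : En n} (hw : ‖w‖ = 1) :
    sphL2 (extS (zonal k w)) = Real.sqrt (legNormSq n k) := by
  have h := integral_legPoly_mul_legPoly hn k k hw hw
  rw [if_pos rfl, real_inner_self_eq_norm_sq, hw, one_pow, legPoly_eval_one hn, mul_one] at h
  rw [sphL2, ← h]
  congr 2
  funext v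
  rw [extS_coe, zonal_apply, sq]

/-- The norms of zonal harmonics in the polynomial approximation classes. -/
theorem exists_zonal_mem_UBounds (hn : 3 ≤ n) : ∃ D > (0 : ℝ), ∀ k : ℕ, 0 < k →
    D * Real.sqrt (legNormSq n k) * (k : ℝ) ^ (n : ℝ) ∈
      UBounds (n : ℝ) (extS (zonal k (pole n))) := by
  obtain ⟨c, hc, h⟩ := exists_legNormSq_lower hn
  have hp : ‖pole n‖ = 1 := norm_pole (by omega)
  have hsc : 0 < Real.sqrt c := Real.sqrt_pos.2 hc
  refine ⟨1 + 1 / Real.sqrt c, by positivity, fun k hk => ?_⟩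
  set s := Real.sqrt (legNormSq n k) with hs
  have hs0 : 0 ≤ s := Real.sqrt_nonneg _
  have hs2 : s ^ 2 = legNormSq n k := Real.sq_sqrt (legNormSq_pos hn k).le
  have hk1 : (1 : ℝ) ≤ k := by exact_mod_cast hk
  have hkn : (1 : ℝ) ≤ (k : ℝ) ^ n := one_le_pow₀ hk1
  have h1 : Real.sqrt c ≤ s * (k : ℝ) ^ n := by
    refine Real.sqrt_le_iff.2 ⟨by positivity, ?_⟩
    rw [mul_pow, hs2, sq ((k : ℝ) ^ n), ← mul_assoc]
    nlinarith [h k hk]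
  rw [Real.rpow_natCast]
  refine ⟨fun u hu => ?_, fun j hj => ?_⟩
  · have h2 : extS (zonal k (pole n)) u = (legPoly n k).eval ⟪pole n, u⟫_ℝ :=
      extS_coe (zonal k (pole n)) ⟨u, by simpa using hu⟩
    rw [h2]
    refine (abs_legPoly_eval_le hn k (inner_mem_Icc hp hu)).trans ?_
    have h3 : 1 / Real.sqrt c * Real.sqrt c ≤ 1 / Real.sqrt c * (s * (k : ℝ) ^ n) := by gcongr
    rw [one_div_mul_cancel hsc.ne'] at h3
    nlinarith
  · by_cases hjk : k ≤ j
    · refine ⟨zonalMv (by omega) k, (zonalMv_totalDegree_le hn k).trans hjk, ?_⟩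
      have : sphL2 (fun x => extS (zonal k (pole n)) x -
          MvPolynomial.eval (fun j => x j) (zonalMv (by omega) k)) = 0 := by
        simp [sphL2, eval_zonalMv]
      rw [this]
      positivity
    · refine ⟨0, by simp, ?_⟩
      simp only [map_zero, sub_zero]
      rw [sphL2_zonal hn k hp, ← hs, Real.rpow_neg (by positivity), Real.rpow_natCast]
      have hj0 : (0 : ℝ) < j := by exact_mod_cast hj
      have h4 : (1 : ℝ) ≤ (k : ℝ) ^ n * ((j : ℝ) ^ n)⁻¹ := by
        rw [← div_eq_mul_inv, one_le_div (by positivity)]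
        have : (j : ℝ) ≤ k := by exact_mod_cast (not_le.1 hjk).le
        gcongr
      have h5 : (1 : ℝ) ≤ 1 + 1 / Real.sqrt c := by
        have : 0 ≤ 1 / Real.sqrt c := by positivity
        linarith
      calc s = 1 * s * 1 := by ring
        _ ≤ (1 + 1 / Real.sqrt c) * s * ((k : ℝ) ^ n * ((j : ℝ) ^ n)⁻¹) := by gcongr
        _ = _ := by ring

theorem IsRegKernel.exists_linMult_decay {i : ℕ} {g : ℝ → ℝ} (hg : IsRegKernel n i g) :
    ∃ β > (0 : ℝ), ∃ C > (0 : ℝ), ∀ k : ℕ, 2 ≤ k → |linMult n i g k| ≤ C * (k : ℝ) ^ (-β) := by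
  have hn := hg.three_le
  have hp : ‖pole n‖ = 1 := norm_pole (by omega)
  obtain ⟨β, hβ, h⟩ := hg.hess_mem
  obtain ⟨C, hC, h⟩ := h n (by positivity)
  obtain ⟨D, hD, hDk⟩ := exists_zonal_mem_UBounds hn
  have hn1 := hg.one_lt
  have hi : (0 : ℝ) < i := by exact_mod_cast hg.pos
  have hn0 : (0 : ℝ) < n := by linarith
  refine ⟨β, hβ, (i : ℝ) / ((n : ℝ) - 1) * (n * (C * D * 2 ^ ((n : ℝ) + β))), by positivity,
    fun k hk => ?_⟩
  set φ := zonal k (pole n)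
  set s := Real.sqrt (legNormSq n k) with hs
  have hs2 : s ^ 2 = legNormSq n k := Real.sq_sqrt (legNormSq_pos hn k).le
  have hs0 : 0 < s := Real.sqrt_pos.2 (legNormSq_pos hn k)
  have hU := hDk k (by omega)
  have hkpos : (0 : ℝ) < k := by exact_mod_cast (by omega : 0 < k)
  have hV : ∀ j l, C * (D * s * (k : ℝ) ^ (n : ℝ)) ∈
      UBounds ((n : ℝ) + β) (fun u => hessE (convT g φ) u j l) := fun j l =>
    UBounds_mono (h _ ⟨_, hU⟩ j l) (by gcongr; exact UNorm_le (by omega) hU)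
  have hex := fun j => (hV j j).2 (k - 1) (by omega)
  choose p hpd hpL using hex
  set R := C * (D * s * (k : ℝ) ^ (n : ℝ)) * ((k - 1 : ℕ) : ℝ) ^ (-((n : ℝ) + β)) with hR
  have hcont : ∀ j, Continuous fun v : Sph n => hessE (convT g φ) v j j := fun j =>
    (hg.c2off φ).continuous_hessE j j
  have hint : ∀ j, Integrable (fun v : Sph n => hessE (convT g φ) v j j * φ v) (sphVol n) :=
    fun j => integrable_of_continuous ((hcont j).mul φ.continuous)
  have hterm : ∀ j, |∫ v : Sph n, hessE (convT g φ) v j j * φ v ∂(sphVol n)| ≤ R * s := by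
    intro j
    have h1 : ∫ v : Sph n, restrPoly n (p j) v * φ v ∂(sphVol n) = 0 :=
      integral_zonalSpan_mul_zonal hn
        (restrPoly_mem_zonalSpan hn (p j) (lt_of_le_of_lt (hpd j) (by omega))) hp
    have h0 : Integrable (fun v : Sph n => restrPoly n (p j) v * φ v) (sphVol n) :=
      integrable_of_continuous (by fun_prop)
    have h2 : ∫ v : Sph n, hessE (convT g φ) v j j * φ v ∂(sphVol n) =
        ∫ v : Sph n, (hessE (convT g φ) v j j - MvPolynomial.eval (fun l => (v : En n) l) (p j)) *
          extS φ v ∂(sphVol n) := by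
      rw [← sub_zero (∫ v : Sph n, hessE (convT g φ) v j j * φ v ∂(sphVol n)), ← h1,
        ← integral_sub (hint j) h0]
      congr 1
      funext v
      rw [extS_coe, restrPoly_apply]
      ring
    rw [h2]
    have hc1 : Continuous fun v : Sph n =>
        hessE (convT g φ) v j j - MvPolynomial.eval (fun l => (v : En n) l) (p j) := by
      simp only [← restrPoly_apply]
      exact (hcont j).sub (restrPoly n (p j)).continuous
    have hc2 : Continuous fun v : Sph n => extS φ v := by
      simp only [extS_coe]; exact φ.continuous
    refine (abs_integral_mul_le_sphL2
      (f := fun x => hessE (convT g φ) x j j - MvPolynomial.eval (fun l => x l) (p j)) hc1 hc2).trans ?_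
    rw [sphL2_zonal hn k hp]
    gcongr
    exact hpL j
  have hsum : ∑ j, ∫ v : Sph n, hessE (convT g φ) v j j * φ v ∂(sphVol n) =
      -(((k : ℝ) - 1) * ((k : ℝ) + n - 1) * kerMult n g k) * s ^ 2 := by
    rw [← integral_finsetSum _ fun j _ => hint j]
    have h1 := integral_legPoly_mul_legPoly hn k k hp hp
    rw [if_pos rfl, real_inner_self_eq_norm_sq, hp, one_pow, legPoly_eval_one hn, mul_one] at h1
    rw [hs2, ← h1, ← integral_const_mul]
    congr 1
    funext v
    rw [← Finset.sum_mul, hg.sum_hessE_convT_zonal k hp (norm_eq_of_mem_sphere v), zonal_apply]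
    ring
  set lam := ((k : ℝ) - 1) * ((k : ℝ) + n - 1) * kerMult n g k with hlam
  have hmain : |lam| * s ^ 2 ≤ n * (R * s) := by
    calc |lam| * s ^ 2 = |-lam * s ^ 2| := by
          rw [abs_mul (-lam), abs_neg, abs_of_nonneg (sq_nonneg s)]
      _ ≤ ∑ j : Fin n, R * s := by
          rw [← hsum]
          exact (Finset.abs_sum_le_sum_abs _ _).trans (Finset.sum_le_sum fun j _ => hterm j)
      _ = n * (R * s) := by simp
  have hk1 : (k : ℝ) / 2 ≤ ((k - 1 : ℕ) : ℝ) := by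
    rw [Nat.cast_sub (by omega)]
    have : (2 : ℝ) ≤ k := by exact_mod_cast hk
    push_cast
    linarith
  have hRle : R ≤ C * D * s * (2 ^ ((n : ℝ) + β) * (k : ℝ) ^ (-β)) := by
    have h1 : ((k - 1 : ℕ) : ℝ) ^ (-((n : ℝ) + β)) ≤ ((k : ℝ) / 2) ^ (-((n : ℝ) + β)) :=
      Real.rpow_le_rpow_of_nonpos (by positivity) hk1 (by linarith)
    have h2 : ((k : ℝ) / 2) ^ (-((n : ℝ) + β)) = 2 ^ ((n : ℝ) + β) * (k : ℝ) ^ (-((n : ℝ) + β)) := by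
      rw [Real.div_rpow hkpos.le (by norm_num), Real.rpow_neg (by norm_num : (0 : ℝ) ≤ 2)]
      field_simp
    have h3 : (k : ℝ) ^ (-β) = (k : ℝ) ^ (n : ℝ) * (k : ℝ) ^ (-((n : ℝ) + β)) := by
      rw [← Real.rpow_add hkpos]; congr 1; ring
    calc R ≤ C * (D * s * (k : ℝ) ^ (n : ℝ)) * ((k : ℝ) / 2) ^ (-((n : ℝ) + β)) := by
          rw [hR]; gcongr
      _ = _ := by rw [h2, h3]; ring
  have hfin : |lam| ≤ n * (C * D * (2 ^ ((n : ℝ) + β) * (k : ℝ) ^ (-β))) := by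
    have h1 : |lam| * s ^ 2 ≤ n * (C * D * (2 ^ ((n : ℝ) + β) * (k : ℝ) ^ (-β))) * s ^ 2 := by
      refine hmain.trans ?_
      calc (n : ℝ) * (R * s) ≤ n * ((C * D * s * (2 ^ ((n : ℝ) + β) * (k : ℝ) ^ (-β))) * s) := by
            gcongr
        _ = _ := by ring
    exact le_of_mul_le_mul_right h1 (by positivity)
  rw [linMult, abs_neg, abs_mul, abs_of_nonneg (by positivity : 0 ≤ (i : ℝ) / ((n : ℝ) - 1)), ← hlam]
  calc (i : ℝ) / ((n : ℝ) - 1) * |lam| ≤ (i : ℝ) / ((n : ℝ) - 1) *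
        (n * (C * D * (2 ^ ((n : ℝ) + β) * (k : ℝ) ^ (-β)))) := by gcongr
    _ = _ := by ring

theorem continuousLinearMap_ext_zonal (hn : 3 ≤ n) {F : Type*} [NormedAddCommGroup F]
    [NormedSpace ℝ F] {S T : C(Sph n, ℝ) →L[ℝ] F}
    (h : ∀ k (w : En n), ‖w‖ = 1 → S (zonal k w) = T (zonal k w)) : S = T := by
  refine ContinuousLinearMap.ext_on (s := {f | ∃ k, ∃ w : En n, ‖w‖ = 1 ∧ f = zonal k w}) ?_ ?_
  · refine Metric.dense_iff.2 fun f ε hε => ?_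
    obtain ⟨d, p, hp, hfp⟩ := exists_zonalSpan_approx hn f hε
    refine ⟨p, by rwa [mem_ball, dist_comm, dist_eq_norm], ?_⟩
    refine Submodule.span_mono ?_ hp
    rintro _ ⟨k, -, w, hw, rfl⟩
    exact ⟨k, w, hw, rfl⟩
  · rintro _ ⟨k, w, hw, rfl⟩
    exact h k w hw

theorem integrable_continuousMap (φ : C(Sph n, ℝ)) : Integrable φ (sphVol n) :=
  integrable_of_continuous φ.continuous

/-- Integration over the sphere. -/
def sphInt (n : ℕ) : C(Sph n, ℝ) →L[ℝ] ℝ :=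
  LinearMap.mkContinuous
    { toFun := fun φ => ∫ v, φ v ∂(sphVol n)
      map_add' := fun φ ψ => integral_add (integrable_continuousMap φ) (integrable_continuousMap ψ)
      map_smul' := fun c φ => integral_const_mul c φ }
    (sphMass n) fun φ => by
      rw [mul_comm]
      exact norm_integral_le_of_norm_le_const (Eventually.of_forall φ.norm_coe_le_norm)

theorem sphInt_apply (φ : C(Sph n, ℝ)) : sphInt n φ = ∫ v, φ v ∂(sphVol n) := rfl

theorem abs_sphInt_le (φ : C(Sph n, ℝ)) : |sphInt n φ| ≤ sphMass n * ‖φ‖ := by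
  rw [mul_comm]
  exact norm_integral_le_of_norm_le_const (Eventually.of_forall φ.norm_coe_le_norm)

theorem sphInt_zonal (hn : 3 ≤ n) {k : ℕ} (hk : k ≠ 0) {w : En n} (hw : ‖w‖ = 1) :
    sphInt n (zonal k w) = 0 := by
  have h := integral_legPoly_mul_legPoly hn k 0 hw hw
  rw [if_neg hk] at h
  rw [sphInt_apply]
  simpa [legPoly_zero, zonal_apply] using h

theorem summable_clm_of_norm_bounded {E : Type*} [NormedAddCommGroup E] [NormedSpace ℝ E]
    [CompleteSpace E] {T : ℕ → E →L[ℝ] E} {a : ℕ → ℝ} (ha : Summable a) (h : ∀ k, ‖T k‖ ≤ a k) :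
    Summable T :=
  Summable.of_norm_bounded ha h

theorem norm_tsum_clm_le {E : Type*} [NormedAddCommGroup E] [NormedSpace ℝ E]
    {T : ℕ → E →L[ℝ] E} {a : ℕ → ℝ} (ha : Summable a) (h : ∀ k, ‖T k‖ ≤ a k) :
    ‖∑' k, T k‖ ≤ ∑' k, a k :=
  tsum_of_norm_bounded ha.hasSum h

theorem tsum_clm_apply {E : Type*} [NormedAddCommGroup E] [NormedSpace ℝ E]
    {T : ℕ → E →L[ℝ] E} (h : Summable T) (φ : E) : (∑' k, T k) φ = ∑' k, T k φ :=
  (ContinuousLinearMap.apply ℝ E φ).map_tsum h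

/-- The projection onto spherical harmonics of degree `k`. -/
def projFun (k : ℕ) (φ : C(Sph n, ℝ)) : C(Sph n, ℝ) :=
  ⟨fun u => (legNormSq n k)⁻¹ *
      ∫ v : Sph n, φ v * (legPoly n k).eval ⟪(u : En n), (v : En n)⟫_ℝ ∂(sphVol n), by
    refine continuous_const.mul ?_
    have h : Continuous (Function.uncurry fun u v : Sph n =>
        φ v * (legPoly n k).eval ⟪(u : En n), (v : En n)⟫_ℝ) := by
      have h1 := (legPoly n k).continuous
      simp only [Function.uncurry_def]
      fun_prop
    simpa using continuous_parametric_integral_of_continuous (μ := sphVol n) h isCompact_univ⟩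

theorem projFun_apply (k : ℕ) (φ : C(Sph n, ℝ)) (u : Sph n) : projFun k φ u = (legNormSq n k)⁻¹ *
    ∫ v : Sph n, φ v * (legPoly n k).eval ⟪(u : En n), (v : En n)⟫_ℝ ∂(sphVol n) := rfl

theorem integrable_mul_legPoly (k : ℕ) (φ : C(Sph n, ℝ)) (u : En n) :
    Integrable (fun v : Sph n => φ v * (legPoly n k).eval ⟪u, (v : En n)⟫_ℝ) (sphVol n) :=
  integrable_of_continuous (φ.continuous.mul (continuous_eval_inner _ _))

theorem norm_projFun_le (hn : 3 ≤ n) (k : ℕ) (φ : C(Sph n, ℝ)) :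
    ‖projFun k φ‖ ≤ (legNormSq n k)⁻¹ * sphMass n * ‖φ‖ := by
  have hN := legNormSq_pos hn k
  rw [ContinuousMap.norm_le _ (by positivity)]
  intro u
  rw [projFun_apply, norm_mul, Real.norm_of_nonneg (by positivity), mul_assoc, mul_comm (sphMass n)]
  gcongr
  refine norm_integral_le_of_norm_le_const (Eventually.of_forall fun v => ?_)
  rw [norm_mul]
  calc ‖φ v‖ * ‖(legPoly n k).eval ⟪(u : En n), (v : En n)⟫_ℝ‖ ≤ ‖φ‖ * 1 :=
        mul_le_mul (φ.norm_coe_le_norm v) (abs_legPoly_eval_le hn k (inner_mem_Icc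
          (norm_eq_of_mem_sphere u) (norm_eq_of_mem_sphere v))) (norm_nonneg _) (norm_nonneg _)
    _ = ‖φ‖ := mul_one _

/-- The projection onto spherical harmonics of degree `k`, as a continuous linear map. -/
def projZ (hn : 3 ≤ n) (k : ℕ) : C(Sph n, ℝ) →L[ℝ] C(Sph n, ℝ) :=
  LinearMap.mkContinuous
    { toFun := projFun k
      map_add' := fun φ ψ => by
        ext u
        simp only [ContinuousMap.add_apply, projFun_apply, add_mul]
        rw [integral_add (integrable_mul_legPoly k φ u) (integrable_mul_legPoly k ψ u), mul_add]
      map_smul' := fun c φ => by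
        ext u
        simp only [ContinuousMap.smul_apply, projFun_apply, smul_eq_mul, RingHom.id_apply,
          mul_assoc, integral_const_mul]
        ring }
    ((legNormSq n k)⁻¹ * sphMass n) (norm_projFun_le hn k)

theorem projZ_apply (hn : 3 ≤ n) (k : ℕ) (φ : C(Sph n, ℝ)) : projZ hn k φ = projFun k φ := rfl

theorem norm_projZ_le (hn : 3 ≤ n) (k : ℕ) : ‖projZ hn k‖ ≤ (legNormSq n k)⁻¹ * sphMass n :=
  LinearMap.mkContinuous_norm_le _ (by have := legNormSq_pos hn k; positivity) _

theorem projZ_zonal (hn : 3 ≤ n) (j k : ℕ) {w : En n} (hw : ‖w‖ = 1) :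
    projZ hn k (zonal j w) = if j = k then zonal k w else 0 := by
  ext u
  rw [projZ_apply, projFun_apply]
  simp only [zonal_apply]
  rw [integral_legPoly_mul_legPoly hn j k hw (norm_eq_of_mem_sphere u)]
  have hN := (legNormSq_pos hn k).ne'
  split_ifs
  · rw [zonal_apply, ← mul_assoc, inv_mul_cancel₀ hN, one_mul]
  · simp

theorem projZ_zero (hn : 3 ≤ n) {φ : C(Sph n, ℝ)} (hφ : sphInt n φ = 0) : projZ hn 0 φ = 0 := by
  ext u
  rw [projZ_apply, projFun_apply]
  rw [sphInt_apply] at hφ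
  simp [legPoly_zero, hφ]

namespace IsRegKernel

variable {i : ℕ} {g : ℝ → ℝ}

theorem sphInt_lin (hg : IsRegKernel n i g) (φ : C(Sph n, ℝ)) :
    sphInt n (hg.lin φ) = i * sphInt n φ := by
  have h : (sphInt n).comp hg.lin = (i : ℝ) • sphInt n := by
    refine continuousLinearMap_ext_zonal hg.three_le fun k w hw => ?_
    simp only [ContinuousLinearMap.comp_apply, smul_apply, hg.lin_zonal k hw, map_smul, smul_eq_mul]
    by_cases hk : k = 0
    · rw [hk, hg.linMult_zero]
    · rw [sphInt_zonal hg.three_le hk hw, mul_zero, mul_zero]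
  exact congrArg (fun T : C(Sph n, ℝ) →L[ℝ] ℝ => T φ) h

theorem lin_pow_zonal (hg : IsRegKernel n i g) (M k : ℕ) {w : En n} (hw : ‖w‖ = 1) :
    (hg.lin ^ M) (zonal k w) = linMult n i g k ^ M • zonal k w := by
  induction M with
  | zero => simp
  | succ M ih =>
    rw [pow_succ', mul_apply_eq_comp, ih, map_smul, hg.lin_zonal k hw, smul_smul, pow_succ]

/-- The spectral majorant of the powers of the linearization. -/
def specTerm (hg : IsRegKernel n i g) (M k : ℕ) : ℝ :=
  |linMult n i g (k + 2)| ^ M * ‖projZ hg.three_le (k + 2)‖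

theorem exists_summable_specTerm (hg : IsRegKernel n i g) :
    ∃ M, 0 < M ∧ Summable (hg.specTerm M) := by
  have hn := hg.three_le
  obtain ⟨β, hβ, C, hC, h⟩ := hg.exists_linMult_decay
  obtain ⟨c, hc, hN⟩ := exists_legNormSq_lower hn
  obtain ⟨M, hM⟩ := exists_nat_gt (((n : ℝ) + 2) / β)
  have hM0 : 0 < M := by
    have : (0 : ℝ) < M := lt_trans (by positivity) hM
    exact_mod_cast this
  refine ⟨M, hM0, ?_⟩
  have hsum : Summable fun k : ℕ => C ^ M * (c⁻¹ * sphMass n) * (((k + 2 : ℕ) : ℝ) ^ 2)⁻¹ :=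
    ((summable_nat_add_iff 2).2 (Real.summable_nat_pow_inv.2 (by norm_num : 1 < 2))).mul_left _
  refine Summable.of_nonneg_of_le (fun k => by unfold specTerm; positivity) (fun k => ?_) hsum
  have hk : (1 : ℝ) ≤ ((k + 2 : ℕ) : ℝ) := by push_cast; linarith [(Nat.cast_nonneg k : (0 : ℝ) ≤ k)]
  have hk0 : (0 : ℝ) < ((k + 2 : ℕ) : ℝ) := by linarith
  set x : ℝ := ((k + 2 : ℕ) : ℝ) with hx
  have h1 : |linMult n i g (k + 2)| ^ M ≤ C ^ M * x ^ (-(β * M)) := by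
    calc |linMult n i g (k + 2)| ^ M ≤ (C * x ^ (-β)) ^ M := by
          gcongr
          exact h _ (by omega)
      _ = _ := by rw [mul_pow, ← Real.rpow_mul_natCast hk0.le, neg_mul]
  have h2 : (legNormSq n (k + 2))⁻¹ ≤ c⁻¹ * x ^ n := by
    have hp := legNormSq_pos hn (k + 2)
    rw [inv_le_iff_one_le_mul₀' hp]
    have := hN (k + 2) (by omega)
    rw [← hx] at this
    calc (1 : ℝ) = c⁻¹ * c := (inv_mul_cancel₀ hc.ne').symm
      _ ≤ c⁻¹ * (legNormSq n (k + 2) * x ^ n) := by gcongr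
      _ = _ := by ring
  have h3 : x ^ (-(β * M)) ≤ x ^ (-((n : ℝ) + 2)) := by
    refine Real.rpow_le_rpow_of_exponent_le hk ?_
    rw [div_lt_iff₀ hβ] at hM
    linarith
  have h4 : x ^ (-((n : ℝ) + 2)) * x ^ n = (x ^ 2)⁻¹ := by
    rw [← Real.rpow_natCast x n, ← Real.rpow_add hk0]
    rw [show -((n : ℝ) + 2) + n = -((2 : ℕ) : ℝ) by push_cast; ring, Real.rpow_neg hk0.le,
      Real.rpow_natCast]
  calc hg.specTerm M k ≤ (C ^ M * x ^ (-((n : ℝ) + 2))) * ((c⁻¹ * x ^ n) * sphMass n) := by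
        unfold specTerm
        have hm := sphMass_nonneg n
        gcongr
        · exact h1.trans (by gcongr)
        · exact (norm_projZ_le hn _).trans (by gcongr)
    _ = C ^ M * (c⁻¹ * sphMass n) * (x ^ (-((n : ℝ) + 2)) * x ^ n) := by ring
    _ = _ := by rw [h4]

theorem specTerm_anti (hg : IsRegKernel n i g) {M M' : ℕ} (h : M ≤ M') (k : ℕ) :
    hg.specTerm M' k ≤ hg.specTerm M k := by
  unfold specTerm
  gcongr ?_ * _
  exact pow_le_pow_of_le_one (abs_nonneg _) (hg.abs_linMult_lt_one (by omega)).le h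

theorem tendsto_tsum_specTerm (hg : IsRegKernel n i g) :
    Tendsto (fun M => ∑' k, hg.specTerm M k) atTop (𝓝 0) := by
  obtain ⟨M₀, -, hs⟩ := hg.exists_summable_specTerm
  have h := tendsto_tsum_of_dominated_convergence (𝓕 := atTop) (f := fun M k => hg.specTerm M k)
    (g := fun _ => (0 : ℝ)) hs (fun k => ?_) ?_
  · simpa using h
  · have := (tendsto_pow_atTop_nhds_zero_of_lt_one (abs_nonneg (linMult n i g (k + 2)))
      (hg.abs_linMult_lt_one (by omega))).mul_const ‖projZ hg.three_le (k + 2)‖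
    simpa [specTerm] using this
  · filter_upwards [eventually_ge_atTop M₀] with M hM k
    rw [Real.norm_of_nonneg (by unfold specTerm; positivity)]
    exact hg.specTerm_anti hM k

/-- The part of a power of the linearization acting on harmonics of degree `k + 2`. -/
def specOp (hg : IsRegKernel n i g) (M k : ℕ) : C(Sph n, ℝ) →L[ℝ] C(Sph n, ℝ) :=
  linMult n i g (k + 2) ^ M • projZ hg.three_le (k + 2)

theorem specOp_apply (hg : IsRegKernel n i g) (M k : ℕ) (φ : C(Sph n, ℝ)) :
    hg.specOp M k φ = linMult n i g (k + 2) ^ M • projZ hg.three_le (k + 2) φ := rfl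

theorem norm_specOp_le (hg : IsRegKernel n i g) (M k : ℕ) : ‖hg.specOp M k‖ ≤ hg.specTerm M k := by
  refine ContinuousLinearMap.opNorm_le_bound _ (by unfold specTerm; positivity) fun φ => ?_
  rw [specOp_apply, specTerm, mul_assoc, norm_smul, norm_pow, Real.norm_eq_abs]
  gcongr
  exact (projZ hg.three_le (k + 2)).le_opNorm φ

theorem specOp_zonal (hg : IsRegKernel n i g) (M k j : ℕ) {w : En n} (hw : ‖w‖ = 1) :
    hg.specOp M k (zonal j w) =
      if k + 2 = j then linMult n i g j ^ M • zonal j w else 0 := by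
  rw [specOp_apply, projZ_zonal hg.three_le j (k + 2) hw]
  by_cases h : k + 2 = j
  · rw [if_pos h.symm, if_pos h, h]
  · rw [if_neg (Ne.symm h), if_neg h, smul_zero]

theorem summable_specOp (hg : IsRegKernel n i g) {M : ℕ} (hs : Summable (hg.specTerm M)) :
    Summable (hg.specOp M) :=
  summable_clm_of_norm_bounded hs (hg.norm_specOp_le M)

theorem tsum_specOp_apply (hg : IsRegKernel n i g) {M : ℕ} (hs : Summable (hg.specTerm M))
    (φ : C(Sph n, ℝ)) : (∑' k, hg.specOp M k) φ = ∑' k, hg.specOp M k φ :=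
  tsum_clm_apply (hg.summable_specOp hs) φ

theorem lin_pow_eq (hg : IsRegKernel n i g) {M : ℕ} (hM : 0 < M)
    (hs : Summable (hg.specTerm M)) :
    hg.lin ^ M = linMult n i g 0 ^ M • projZ hg.three_le 0 + ∑' k, hg.specOp M k := by
  refine continuousLinearMap_ext_zonal hg.three_le fun j w hw => ?_
  rw [hg.lin_pow_zonal M j hw, add_apply, smul_apply, projZ_zonal hg.three_le j 0 hw,
    hg.tsum_specOp_apply hs]
  simp only [hg.specOp_zonal M _ j hw]
  rcases j with _ | _ | j
  · simp
  · simp [linMult_one, hM.ne']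
  · rw [tsum_eq_single j fun k hk => if_neg (by omega)]
    simp

theorem norm_lin_pow_le (hg : IsRegKernel n i g) {M : ℕ} (hM : 0 < M)
    (hs : Summable (hg.specTerm M)) {φ : C(Sph n, ℝ)} (hφ : sphInt n φ = 0) :
    ‖(hg.lin ^ M) φ‖ ≤ (∑' k, hg.specTerm M k) * ‖φ‖ := by
  rw [hg.lin_pow_eq hM hs, add_apply, smul_apply, projZ_zero hg.three_le hφ, smul_zero, zero_add]
  refine (ContinuousLinearMap.le_opNorm _ _).trans ?_
  gcongr
  exact norm_tsum_clm_le hs (hg.norm_specOp_le M)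

/-- Some power of the linearization is a contraction on functions with mean zero. -/
theorem exists_contraction (hg : IsRegKernel n i g) : ∃ M, 0 < M ∧
    ∀ φ : C(Sph n, ℝ), sphInt n φ = 0 → ‖(hg.lin ^ M) φ‖ ≤ 1 / 2 * ‖φ‖ := by
  obtain ⟨M₀, hM₀, hs⟩ := hg.exists_summable_specTerm
  obtain ⟨M, hM1, hM2⟩ := ((hg.tendsto_tsum_specTerm.eventually_lt_const
    (by norm_num : (0 : ℝ) < 1 / 2)).and (eventually_ge_atTop M₀)).exists
  refine ⟨M, by omega, fun φ hφ => ?_⟩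
  have hs' : Summable (hg.specTerm M) := Summable.of_nonneg_of_le
    (fun k => by unfold specTerm; positivity) (hg.specTerm_anti hM2) hs
  exact (hg.norm_lin_pow_le (by omega) hs' hφ).trans (by gcongr)

end IsRegKernel

section

variable {m : ℕ}

theorem sum_apply_basis (b : OrthonormalBasis (Fin n) ℝ (En n))
    (β : En n →L[ℝ] En n →L[ℝ] ℝ) :
    ∑ k, β (b k) (b k) = ∑ j, β (EuclideanSpace.single j 1) (EuclideanSpace.single j 1) := by
  have h1 := LinearMap.trace_eq_sum_inner (opOf β : En n →ₗ[ℝ] En n) b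
  have h2 := LinearMap.trace_eq_sum_inner (opOf β : En n →ₗ[ℝ] En n)
    (EuclideanSpace.basisFun (Fin n) ℝ)
  rw [h1] at h2
  simpa [inner_opOf] using h2

theorem trace_cmpr (b : OrthonormalBasis (Fin (m + 1)) ℝ (En (m + 1)))
    {β : En (m + 1) →L[ℝ] En (m + 1) →L[ℝ] ℝ} (hβ : β (b 0) (b 0) = 0) :
    (cmpr b β).trace = ∑ j, β (EuclideanSpace.single j 1) (EuclideanSpace.single j 1) := by
  rw [← sum_apply_basis b, Fin.sum_univ_succ, hβ, zero_add]
  rfl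

theorem abs_apply_le_of_entries {β : En n →L[ℝ] En n →L[ℝ] ℝ} {B : ℝ}
    (hβ : ∀ j l, |β (EuclideanSpace.single j 1) (EuclideanSpace.single l 1)| ≤ B)
    {v w : En n} (hv : ‖v‖ = 1) (hw : ‖w‖ = 1) : |β v w| ≤ (n : ℝ) ^ 2 * B := by
  have hx : ∀ x : En n, x = ∑ j, x j • EuclideanSpace.single j (1 : ℝ) := fun x => by
    simpa using ((EuclideanSpace.basisFun (Fin n) ℝ).sum_repr x).symm
  have hc : ∀ x : En n, ‖x‖ = 1 → ∀ j, |x j| ≤ 1 := fun x h j => by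
    rw [← h]; exact PiLp.norm_apply_le x j
  have h1 : β v w = ∑ j, ∑ l, v j * w l *
      β (EuclideanSpace.single j 1) (EuclideanSpace.single l 1) := by
    conv_lhs => rw [hx v, hx w]
    simp only [map_sum, map_smul, sum_apply, smul_apply, smul_eq_mul]
    rw [Finset.sum_comm]
    refine Finset.sum_congr rfl fun j _ => ?_
    rw [Finset.mul_sum]
    exact Finset.sum_congr rfl fun l _ => by ring
  rw [h1]
  calc _ ≤ ∑ _j : Fin n, ∑ _l : Fin n, B := by
        refine (Finset.abs_sum_le_sum_abs _ _).trans (Finset.sum_le_sum fun j _ => ?_)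
        refine (Finset.abs_sum_le_sum_abs _ _).trans (Finset.sum_le_sum fun l _ => ?_)
        rw [abs_mul, abs_mul]
        calc _ ≤ 1 * 1 * B := by
              gcongr
              · exact hc v hv j
              · exact hc w hw l
              · exact hβ j l
          _ = B := by ring
    _ = _ := by simp; ring

namespace IsRegKernel

variable {i : ℕ} {g : ℝ → ℝ}

/-- The map sending a density to the area density of the body it generates. -/
def areaMap (hg : IsRegKernel (m + 1) i g) (ψ : C(Sph (m + 1), ℝ)) : C(Sph (m + 1), ℝ) :=
  ⟨fun u => areaDens i (convT g ψ) u, continuous_areaDens i (hg.c2off ψ)⟩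

theorem areaMap_apply (hg : IsRegKernel (m + 1) i g) (ψ : C(Sph (m + 1), ℝ)) (u : Sph (m + 1)) :
    hg.areaMap ψ u = areaDens i (convT g ψ) u := rfl

theorem areaMap_apply_basis (hg : IsRegKernel (m + 1) i g) (ψ : C(Sph (m + 1), ℝ))
    {u : Sph (m + 1)} {b : OrthonormalBasis (Fin (m + 1)) ℝ (En (m + 1))} (hb : b 0 = u) :
    hg.areaMap ψ u = mixDet i (cmpr b (hessB (convT g ψ) u)) := by
  rw [areaMap_apply, ← hb, areaDens_eq i (hg.c2off ψ) (posHom_convT g ψ)]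

theorem areaMap_smul (hg : IsRegKernel (m + 1) i g) (hi : i ≤ m) (c : ℝ)
    (ψ : C(Sph (m + 1), ℝ)) : hg.areaMap (c • ψ) = c ^ i • hg.areaMap ψ := by
  ext u
  obtain ⟨b, hb⟩ := exists_basis_of_unit (norm_sph u)
  rw [ContinuousMap.smul_apply, hg.areaMap_apply_basis _ hb, hg.areaMap_apply_basis _ hb,
    hg.hessB_convT_smul c ψ (sph_ne_zero u), cmpr_smul, mixDet_smul hi, smul_eq_mul]

theorem exists_areaMap_sub_le (hg : IsRegKernel (m + 1) i g) (hi : i ≤ m) :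
    ∃ C > (0 : ℝ), ∃ η > (0 : ℝ), ∀ φ : C(Sph (m + 1), ℝ), ‖φ‖ ≤ η →
      ‖hg.areaMap (1 + φ) - 1 - hg.lin φ‖ ≤ C * ‖φ‖ ^ 2 := by
  have hm : 0 < m := by have := hg.three_le; omega
  obtain ⟨A, hA, hAb⟩ := hg.exists_hessE_bound
  obtain ⟨C, hC, hCb⟩ := abs_mixDet_one_add_sub_le hi hm
  set B : ℝ := ((m + 1 : ℕ) : ℝ) ^ 2 * A + 1 with hB
  have hB0 : 0 < B := by positivity
  refine ⟨C * B ^ 2 + 1, by positivity, B⁻¹, by positivity, fun φ hφ => ?_⟩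
  rw [ContinuousMap.norm_le _ (by positivity)]
  intro u
  obtain ⟨b, hb⟩ := exists_basis_of_unit (norm_sph u)
  set E := cmpr b (hessB (convT g φ) u) with hE
  have h1 : hg.areaMap (1 + φ) u = mixDet i (1 + E) := by
    rw [hg.areaMap_apply_basis _ hb, hg.hessB_convT_add 1 φ (sph_ne_zero u), cmpr_add,
      convT_one hg.three_le hg.cont hg.mult_zero]
    conv_lhs => rw [← hb, cmpr_norm]
    rw [hE, hb]
  have h2 : hg.lin φ u = i / m * E.trace := by
    rw [hg.lin_apply, hE, trace_cmpr b (by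
      rw [hb, (posHom_convT g φ).fderiv_fderiv_self (hg.c2off φ) (sph_ne_zero u)]; rfl)]
    simp only [hessE_eq]
    push_cast
    rw [add_sub_cancel_right]
  have h3 : ∀ j l, |E j l| ≤ B * ‖φ‖ := fun j l => by
    have := abs_apply_le_of_entries (β := hessB (convT g φ) u)
      (fun j l => by rw [← hessE_eq]; exact hAb φ u (norm_sph u) j l)
      (b.orthonormal.1 l.succ) (b.orthonormal.1 j.succ)
    refine this.trans ?_
    rw [hB]
    nlinarith [norm_nonneg φ]
  have h4 : B * ‖φ‖ ≤ 1 := by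
    calc B * ‖φ‖ ≤ B * B⁻¹ := by gcongr
      _ = 1 := mul_inv_cancel₀ hB0.ne'
  have h5 := hCb E _ h4 h3
  simp only [ContinuousMap.sub_apply, ContinuousMap.one_apply, Real.norm_eq_abs]
  rw [h1, h2]
  refine h5.trans ?_
  nlinarith [sq_nonneg ‖φ‖]

end IsRegKernel

end

section

variable {m : ℕ}

section Contraction

variable {E : Type*} [NormedAddCommGroup E] [NormedSpace ℝ E]

theorem clm_pow_apply (T : E →L[ℝ] E) (M : ℕ) (x : E) : (T ^ M) x = T^[M] x := by
  induction M with
  | zero => rfl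
  | succ M ih => rw [pow_succ', mul_apply_eq_comp, ih, Function.iterate_succ_apply']

/-- The sum of the norms of the first `M` iterates of `T`. -/
def orbitNorm (T : E →L[ℝ] E) (M : ℕ) (x : E) : ℝ := ∑ j ∈ Finset.range M, ‖T^[j] x‖

theorem orbitNorm_add_le (T : E →L[ℝ] E) (M : ℕ) (x y : E) :
    orbitNorm T M (x + y) ≤ orbitNorm T M x + orbitNorm T M y := by
  rw [orbitNorm, orbitNorm, orbitNorm, ← Finset.sum_add_distrib]
  refine Finset.sum_le_sum fun j _ => ?_
  rw [iterate_map_add T j]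
  exact norm_add_le _ _

theorem norm_le_orbitNorm (T : E →L[ℝ] E) {M : ℕ} (hM : 0 < M) (x : E) :
    ‖x‖ ≤ orbitNorm T M x :=
  Finset.single_le_sum (f := fun j => ‖T^[j] x‖) (fun _ _ => norm_nonneg _)
    (Finset.mem_range.2 hM)

theorem orbitNorm_map (T : E →L[ℝ] E) (M : ℕ) (x : E) :
    orbitNorm T M (T x) = orbitNorm T M x - ‖x‖ + ‖T^[M] x‖ := by
  have h := Finset.sum_range_succ' (fun j => ‖T^[j] x‖) M
  rw [Finset.sum_range_succ] at h
  simp only [Function.iterate_succ_apply, Function.iterate_zero, id] at h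
  simp only [orbitNorm]
  linarith

theorem exists_orbitNorm_le (T : E →L[ℝ] E) (M : ℕ) :
    ∃ Q > (0 : ℝ), ∀ x, orbitNorm T M x ≤ Q * ‖x‖ := by
  refine ⟨∑ j ∈ Finset.range M, ‖T‖ ^ j + 1, by positivity, fun x => ?_⟩
  rw [orbitNorm, add_mul, Finset.sum_mul]
  have h : ∀ j, ‖T^[j] x‖ ≤ ‖T‖ ^ j * ‖x‖ := fun j => by
    induction j with
    | zero => simp
    | succ j ih =>
      rw [Function.iterate_succ_apply', pow_succ', mul_assoc]
      exact (T.le_opNorm _).trans (by gcongr)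
  have := Finset.sum_le_sum fun j (_ : j ∈ Finset.range M) => h j
  linarith [norm_nonneg x]

/-- A map which is tangent to a linear map with a contracting power is locally attracting. -/
theorem exists_attracting {V : Set E} {T : E →L[ℝ] E} {f : E → E} {M : ℕ} (hM : 0 < M)
    (hT : ∀ x ∈ V, ‖T^[M] x‖ ≤ 1 / 2 * ‖x‖) {C η : ℝ} (hC : 0 < C) (hη : 0 < η)
    (hfV : ∀ x ∈ V, ‖x‖ ≤ η → f x ∈ V)
    (hf : ∀ x ∈ V, ‖x‖ ≤ η → ‖f x - T x‖ ≤ C * ‖x‖ ^ 2) {ρ : ℝ} (hρ : 0 < ρ) :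
    ∃ δ > (0 : ℝ), ∀ x ∈ V, ‖x‖ ≤ δ →
      (∀ k, f^[k] x ∈ V ∧ ‖f^[k] x‖ ≤ ρ) ∧ Tendsto (fun k => f^[k] x) atTop (𝓝 0) := by
  obtain ⟨Q, hQ, hQb⟩ := exists_orbitNorm_le T M
  set r : ℝ := min (min η ρ) ((4 * Q ^ 2 * C)⁻¹) with hr
  have hr0 : 0 < r := by positivity
  have hrη : r ≤ η := (min_le_left _ _).trans (min_le_left _ _)
  have hrρ : r ≤ ρ := (min_le_left _ _).trans (min_le_right _ _)
  have hrC : Q * C * r ≤ (4 * Q)⁻¹ := by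
    calc Q * C * r ≤ Q * C * (4 * Q ^ 2 * C)⁻¹ := by gcongr; exact min_le_right _ _
      _ = (4 * Q)⁻¹ := by field_simp
  set θ : ℝ := max (1 - (4 * Q)⁻¹) 0 with hθ
  have hθ0 : 0 ≤ θ := le_max_right _ _
  have hθ1 : θ < 1 := max_lt (by linarith [inv_pos.2 (show 0 < 4 * Q by positivity)]) one_pos
  have hstep : ∀ x ∈ V, orbitNorm T M x ≤ r → orbitNorm T M (f x) ≤ θ * orbitNorm T M x := by
    intro x hx hxr
    have h0 := norm_le_orbitNorm T hM x
    have h1 := hf x hx (h0.trans (hxr.trans hrη))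
    have h2 : orbitNorm T M (f x) ≤ orbitNorm T M (T x) + orbitNorm T M (f x - T x) := by
      simpa using orbitNorm_add_le T M (T x) (f x - T x)
    have h3 := hQb (f x - T x)
    have h4 := hT x hx
    have h5 : Q * ‖f x - T x‖ ≤ (4 * Q)⁻¹ * orbitNorm T M x := by
      calc Q * ‖f x - T x‖ ≤ Q * (C * ‖x‖ ^ 2) := by gcongr
        _ = Q * C * ‖x‖ * ‖x‖ := by ring
        _ ≤ Q * C * r * orbitNorm T M x := by gcongr; exact h0.trans hxr
        _ ≤ _ := by
          have : 0 ≤ orbitNorm T M x := (norm_nonneg x).trans h0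
          gcongr
    have h6 : (2 * Q)⁻¹ * orbitNorm T M x ≤ 1 / 2 * ‖x‖ := by
      calc (2 * Q)⁻¹ * orbitNorm T M x ≤ (2 * Q)⁻¹ * (Q * ‖x‖) := by gcongr; exact hQb x
        _ = _ := by field_simp
    have h7 : (2 * Q)⁻¹ = 2 * (4 * Q)⁻¹ := by field_simp; norm_num
    rw [orbitNorm_map] at h2
    calc orbitNorm T M (f x) ≤ (1 - (4 * Q)⁻¹) * orbitNorm T M x := by
          rw [h7] at h6; linarith
      _ ≤ _ := by
        have : 0 ≤ orbitNorm T M x := (norm_nonneg x).trans h0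
        gcongr
        exact le_max_left _ _
  refine ⟨r / Q, by positivity, fun x hx hxδ => ?_⟩
  have key : ∀ k, f^[k] x ∈ V ∧ orbitNorm T M (f^[k] x) ≤ θ ^ k * r := by
    intro k
    induction k with
    | zero =>
      refine ⟨hx, ?_⟩
      rw [pow_zero, one_mul]
      calc orbitNorm T M x ≤ Q * (r / Q) := (hQb x).trans (by gcongr)
        _ = r := by field_simp
    | succ k ih =>
      have h1 : orbitNorm T M (f^[k] x) ≤ r :=
        ih.2.trans (mul_le_of_le_one_left hr0.le (pow_le_one₀ hθ0 hθ1.le))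
      rw [Function.iterate_succ_apply']
      refine ⟨hfV _ ih.1 ((norm_le_orbitNorm T hM _).trans (h1.trans hrη)), ?_⟩
      refine (hstep _ ih.1 h1).trans ?_
      rw [pow_succ', mul_assoc]
      gcongr
      exact ih.2
  refine ⟨fun k => ⟨(key k).1, (norm_le_orbitNorm T hM _).trans ((key k).2.trans ?_)⟩, ?_⟩
  · exact (mul_le_of_le_one_left hr0.le (pow_le_one₀ hθ0 hθ1.le)).trans hrρ
  · refine squeeze_zero_norm (fun k => (norm_le_orbitNorm T hM _).trans (key k).2) ?_
    simpa using (tendsto_pow_atTop_nhds_zero_of_lt_one hθ0 hθ1).mul_const r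

end Contraction

theorem sphMass_pos (hn : 0 < n) : 0 < sphMass n := by
  have : Nonempty (Sph n) := ⟨⟨pole n, by simpa using norm_pole hn⟩⟩
  exact ENNReal.toReal_pos (isOpen_univ.measure_ne_zero _ Set.univ_nonempty) (measure_ne_top _ _)

/-- The mean over the sphere. -/
def sphAvg (n : ℕ) : C(Sph n, ℝ) →L[ℝ] ℝ := (sphMass n)⁻¹ • sphInt n

theorem sphAvg_apply (φ : C(Sph n, ℝ)) : sphAvg n φ = (sphMass n)⁻¹ * sphInt n φ := rfl

theorem sphAvg_one (hn : 0 < n) : sphAvg n 1 = 1 := by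
  rw [sphAvg_apply, sphInt_apply]
  simp [inv_mul_cancel₀ (sphMass_pos hn).ne']

theorem abs_sphAvg_le (φ : C(Sph n, ℝ)) : |sphAvg n φ| ≤ ‖φ‖ := by
  rw [sphAvg_apply, abs_mul, abs_of_nonneg (inv_nonneg.2 (sphMass_nonneg n))]
  calc (sphMass n)⁻¹ * |sphInt n φ| ≤ (sphMass n)⁻¹ * (sphMass n * ‖φ‖) := by
        have := sphMass_nonneg n
        gcongr
        exact abs_sphInt_le φ
    _ ≤ 1 * ‖φ‖ := by
      rw [← mul_assoc]
      gcongr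
      exact inv_mul_le_one
    _ = _ := one_mul _

theorem sphInt_eq_zero_of_sphAvg (hn : 0 < n) {φ : C(Sph n, ℝ)} (h : sphAvg n φ = 0) :
    sphInt n φ = 0 := by
  rw [sphAvg_apply] at h
  exact (mul_eq_zero.1 h).resolve_left (inv_ne_zero (sphMass_pos hn).ne')

namespace IsRegKernel

variable {i : ℕ} {g : ℝ → ℝ}

theorem sphAvg_lin (hg : IsRegKernel n i g) (φ : C(Sph n, ℝ)) :
    sphAvg n (hg.lin φ) = i * sphAvg n φ := by
  rw [sphAvg_apply, sphAvg_apply, hg.sphInt_lin]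
  ring

/-- The area map, normalized to have mean one. -/
def normMap (hg : IsRegKernel (m + 1) i g) (ψ : C(Sph (m + 1), ℝ)) : C(Sph (m + 1), ℝ) :=
  (sphAvg (m + 1) (hg.areaMap ψ))⁻¹ • hg.areaMap ψ

theorem normMap_smul (hg : IsRegKernel (m + 1) i g) (hi : i ≤ m) {c : ℝ} (hc : c ≠ 0)
    (ψ : C(Sph (m + 1), ℝ)) : hg.normMap (c • ψ) = hg.normMap ψ := by
  have := pow_ne_zero i hc
  rw [normMap, normMap, hg.areaMap_smul hi, map_smul, smul_smul, smul_eq_mul, mul_inv_rev, mul_assoc,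
    inv_mul_cancel₀ this, mul_one]

theorem sphAvg_normMap (hg : IsRegKernel (m + 1) i g) {ψ : C(Sph (m + 1), ℝ)}
    (h : sphAvg (m + 1) (hg.areaMap ψ) ≠ 0) : sphAvg (m + 1) (hg.normMap ψ) = 1 := by
  rw [normMap, map_smul, smul_eq_mul, inv_mul_cancel₀ h]

theorem exists_normMap_sub_le (hg : IsRegKernel (m + 1) i g) (hi : i ≤ m) :
    ∃ C > (0 : ℝ), ∃ η > (0 : ℝ), ∀ φ : C(Sph (m + 1), ℝ), sphAvg (m + 1) φ = 0 → ‖φ‖ ≤ η →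
      0 < sphAvg (m + 1) (hg.areaMap (1 + φ)) ∧
      ‖hg.normMap (1 + φ) - 1 - hg.lin φ‖ ≤ C * ‖φ‖ ^ 2 := by
  obtain ⟨C, hC, η, hη, h⟩ := hg.exists_areaMap_sub_le hi
  refine ⟨(4 + 2 * ‖hg.lin‖) * C, by positivity, min (min η 1) (2 * C)⁻¹, by positivity,
    fun φ hφ hφη => ?_⟩
  have hη1 : ‖φ‖ ≤ η := hφη.trans ((min_le_left _ _).trans (min_le_left _ _))
  have hη2 : ‖φ‖ ≤ 1 := hφη.trans ((min_le_left _ _).trans (min_le_right _ _))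
  have hη3 : ‖φ‖ ≤ (2 * C)⁻¹ := hφη.trans (min_le_right _ _)
  have hR := h φ hη1
  set R := hg.areaMap (1 + φ) - 1 - hg.lin φ with hRdef
  have ha : hg.areaMap (1 + φ) = 1 + hg.lin φ + R := by rw [hRdef]; abel
  set r := sphAvg (m + 1) R with hr
  have havg : sphAvg (m + 1) (hg.areaMap (1 + φ)) = 1 + r := by
    rw [ha, map_add, map_add, sphAvg_one m.succ_pos, hg.sphAvg_lin, hφ, mul_zero, add_zero]
  have hrR : |r| ≤ ‖R‖ := abs_sphAvg_le R
  have hR2 : ‖R‖ ≤ 1 / 2 := by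
    calc ‖R‖ ≤ C * (‖φ‖ * ‖φ‖) := by rw [← sq]; exact hR
      _ ≤ C * (1 * (2 * C)⁻¹) := by gcongr
      _ = 1 / 2 := by field_simp
  have hr1 : 1 / 2 ≤ 1 + r := by linarith [neg_abs_le r]
  have hr0 : 0 < 1 + r := by linarith
  refine ⟨by rw [havg]; exact hr0, ?_⟩
  have heq : hg.normMap (1 + φ) - 1 - hg.lin φ =
      (1 + r)⁻¹ • (R - r • (1 : C(Sph (m + 1), ℝ)) - r • hg.lin φ) := by
    rw [normMap, havg, ha]
    have h1 : (1 : C(Sph (m + 1), ℝ)) + hg.lin φ =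
        (1 + r)⁻¹ • ((1 + r) • (1 + hg.lin φ)) := by
      rw [smul_smul, inv_mul_cancel₀ hr0.ne', one_smul]
    rw [sub_sub]
    nth_rewrite 2 [h1]
    rw [← smul_sub]
    congr 1
    module
  have hnorm1 : ‖(1 : C(Sph (m + 1), ℝ))‖ ≤ 1 := by
    rw [ContinuousMap.norm_le _ zero_le_one]
    intro u
    simp
  rw [heq, norm_smul, norm_inv, Real.norm_of_nonneg hr0.le]
  have hb : ‖R - r • (1 : C(Sph (m + 1), ℝ)) - r • hg.lin φ‖ ≤ ‖R‖ * (2 + ‖hg.lin‖) := by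
    refine (norm_sub_le _ _).trans ((add_le_add (norm_sub_le _ _) le_rfl).trans ?_)
    rw [norm_smul, norm_smul, Real.norm_eq_abs]
    have h1 : ‖hg.lin φ‖ ≤ ‖hg.lin‖ * 1 := (hg.lin.le_opNorm φ).trans (by gcongr)
    calc _ ≤ ‖R‖ + ‖R‖ * 1 + ‖R‖ * (‖hg.lin‖ * 1) := by gcongr
      _ = _ := by ring
  calc (1 + r)⁻¹ * _ ≤ 2 * (‖R‖ * (2 + ‖hg.lin‖)) := by
        gcongr
        rw [inv_le_comm₀ hr0 two_pos]
        linarith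
    _ ≤ 2 * (C * ‖φ‖ ^ 2 * (2 + ‖hg.lin‖)) := by gcongr
    _ = _ := by ring

/-- The sphere is a local attractor of the normalized area map. -/
theorem exists_normMap_attracting (hg : IsRegKernel (m + 1) i g) (hi : i ≤ m) :
    ∃ δ > (0 : ℝ), ∀ ψ : C(Sph (m + 1), ℝ), sphAvg (m + 1) ψ = 1 → ‖ψ - 1‖ ≤ δ →
      (∀ k, 0 < sphAvg (m + 1) (hg.areaMap (hg.normMap^[k] ψ)) ∧
        ‖hg.normMap^[k] ψ - 1‖ ≤ 1 / 2) ∧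
      Tendsto (fun k => ‖hg.normMap^[k] ψ - 1‖) atTop (𝓝 0) := by
  obtain ⟨C, hC, η, hη, h⟩ := hg.exists_normMap_sub_le hi
  obtain ⟨M, hM, hc⟩ := hg.exists_contraction
  set f : C(Sph (m + 1), ℝ) → C(Sph (m + 1), ℝ) := fun φ => hg.normMap (1 + φ) - 1 with hf
  obtain ⟨δ, hδ, H⟩ := exists_attracting (V := {φ | sphAvg (m + 1) φ = 0}) (T := hg.lin) (f := f)
    hM (fun φ hφ => by
      rw [← clm_pow_apply]
      exact hc φ (sphInt_eq_zero_of_sphAvg m.succ_pos hφ)) hC hη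
    (fun φ hφ hφη => by
      show sphAvg (m + 1) (hg.normMap (1 + φ) - 1) = 0
      rw [map_sub, sphAvg_one m.succ_pos, hg.sphAvg_normMap (h φ hφ hφη).1.ne', sub_self])
    (fun φ hφ hφη => (h φ hφ hφη).2) (show 0 < min η (1 / 2) by positivity)
  refine ⟨δ, hδ, fun ψ hψ hψδ => ?_⟩
  have hit : ∀ k, hg.normMap^[k] ψ - 1 = f^[k] (ψ - 1) := fun k => by
    induction k with
    | zero => rfl
    | succ k ih =>
      rw [Function.iterate_succ_apply', Function.iterate_succ_apply', ← ih, hf]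
      simp
  obtain ⟨H1, H2⟩ := H (ψ - 1) (by
    show sphAvg (m + 1) (ψ - 1) = 0
    rw [map_sub, hψ, sphAvg_one m.succ_pos, sub_self]) hψδ
  refine ⟨fun k => ⟨?_, ?_⟩, ?_⟩
  · have := (h _ (H1 k).1 ((H1 k).2.trans (min_le_left _ _))).1
    rwa [← hit, add_sub_cancel] at this
  · rw [hit]
    exact (H1 k).2.trans (min_le_right _ _)
  · simp only [hit]
    simpa using H2.norm

end IsRegKernel

end

section

variable {m : ℕ}

theorem PosHom.map_zero {h : En n → ℝ} (hh : PosHom h) : h 0 = 0 := by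
  have := hh 2 two_pos 0
  rw [smul_zero] at this
  linarith

theorem PosHom.ext_unit {h k : En n → ℝ} (hh : PosHom h) (hk : PosHom k)
    (H : ∀ u, ‖u‖ = 1 → h u = k u) : h = k := by
  funext x
  by_cases hx : x = 0
  · rw [hx, hh.map_zero, hk.map_zero]
  · have hx' : 0 < ‖x‖ := norm_pos_iff.2 hx
    have h1 : x = ‖x‖ • ‖x‖⁻¹ • x := by rw [smul_smul, mul_inv_cancel₀ hx'.ne', one_smul]
    rw [h1, hh _ hx', hk _ hx', H]
    rw [norm_smul, norm_inv, norm_norm, inv_mul_cancel₀ hx'.ne']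

/-- The measure with density `ψ` with respect to spherical Lebesgue measure. -/
abbrev densMeasure (ψ : C(Sph n, ℝ)) : Measure (Sph n) :=
  (sphVol n).withDensity fun v => ENNReal.ofReal (ψ v)

theorem integral_densMeasure {ψ : C(Sph n, ℝ)} (hψ : ∀ v, 0 ≤ ψ v) (f : Sph n → ℝ) :
    ∫ v, f v ∂(densMeasure ψ) = ∫ v, f v * ψ v ∂(sphVol n) := by
  rw [integral_withDensity_eq_integral_toReal_smul
    (ψ.continuous.measurable.ennreal_ofReal) (Eventually.of_forall fun v => ENNReal.ofReal_lt_top)]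
  refine integral_congr_ae (Eventually.of_forall fun v => ?_)
  simp only [ENNReal.toReal_ofReal (hψ v), smul_eq_mul, mul_comm]

theorem dTV_densMeasure_le {ψ : C(Sph n, ℝ)} (hψ : ∀ v, 0 ≤ ψ v) :
    dTV (densMeasure ψ) (sphVol n) ≤ sphMass n * ‖ψ - 1‖ := by
  have : Nonempty {A : Set (Sph n) // MeasurableSet A} := ⟨⟨∅, MeasurableSet.empty⟩⟩
  refine ciSup_le fun ⟨A, hA⟩ => ?_
  have hi := (integrable_continuousMap ψ).integrableOn (s := A)
  have h1 : (densMeasure ψ A).toReal = ∫ v in A, ψ v ∂(sphVol n) := by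
    rw [withDensity_apply _ hA, ← ofReal_integral_eq_lintegral_ofReal hi
      (Eventually.of_forall hψ), ENNReal.toReal_ofReal (integral_nonneg hψ)]
  have h2 : (sphVol n A).toReal = ∫ _v in A, (1 : ℝ) ∂(sphVol n) := by
    simp [Measure.real]
  simp only
  rw [h1, h2, ← integral_sub hi (integrable_const _)]
  have h3 : ‖∫ v in A, (ψ v - 1) ∂(sphVol n)‖ ≤ ‖ψ - 1‖ * (sphVol n).real A := by
    rw [← measureReal_restrict_apply_univ]
    exact norm_integral_le_of_norm_le_const
      (Eventually.of_forall fun v => (ψ - 1).norm_coe_le_norm v)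
  rw [mul_comm]
  refine h3.trans ?_
  gcongr
  exact measureReal_mono (Set.subset_univ A)

theorem dTV_nonneg (μ ν : Measure (Sph n)) : 0 ≤ dTV μ ν :=
  Real.iSup_nonneg fun _ => abs_nonneg _

namespace IsRegKernel

variable {i : ℕ} {g : ℝ → ℝ} {Φ : ConvexBody (En (m + 1)) → ConvexBody (En (m + 1))}

/-- The scaling factor accompanying one step of the normalized area map. -/
def stepScale (hg : IsRegKernel (m + 1) i g) (ψ : C(Sph (m + 1), ℝ)) : ℝ :=
  ((sphAvg (m + 1) (hg.areaMap ψ))⁻¹) ^ ((i : ℝ)⁻¹)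

theorem stepScale_pos (hg : IsRegKernel (m + 1) i g) {ψ : C(Sph (m + 1), ℝ)}
    (h : 0 < sphAvg (m + 1) (hg.areaMap ψ)) : 0 < hg.stepScale ψ :=
  Real.rpow_pos_of_pos (inv_pos.2 h) _

theorem areaMap_stepScale_smul (hg : IsRegKernel (m + 1) i g) (hi : i ≤ m)
    {ψ : C(Sph (m + 1), ℝ)} (h : 0 < sphAvg (m + 1) (hg.areaMap ψ)) :
    hg.areaMap (hg.stepScale ψ • ψ) = hg.normMap ψ := by
  rw [hg.areaMap_smul hi, normMap, stepScale,
    Real.rpow_inv_natCast_pow (inv_pos.2 h).le hg.pos.ne']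

theorem supp_scale_eq_convT (hgen : GeneratedBy i Φ g) (hdeg : HasDegree i Φ)
    {γ : ℝ} (hγ : 0 < γ) {K : ConvexBody (En (m + 1))} {ψ : C(Sph (m + 1), ℝ)}
    (hψ : ∀ v, 0 ≤ ψ v) (hK : IsAreaMeasure i (scale γ K) (densMeasure ψ)) :
    supp (scale (γ ^ i) (Φ K)) = convT g ψ := by
  refine PosHom.ext_unit (isSublin_supp _).posHom (posHom_convT g ψ) fun u hu => ?_
  rw [← hdeg K γ hγ.le, hgen _ _ hK u hu, integral_densMeasure hψ, convT_unit g ψ hu]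

/-- One step of the iteration, on the level of area measures. -/
theorem eq_densMeasure_normMap (hg : IsRegKernel (m + 1) i g) (hi : i ≤ m)
    (hgen : GeneratedBy i Φ g) (hdeg : HasDegree i Φ) {γ : ℝ} (hγ : 0 < γ)
    {K : ConvexBody (En (m + 1))} {ψ : C(Sph (m + 1), ℝ)} (hψ : ∀ v, 0 ≤ ψ v)
    (hK : IsAreaMeasure i (scale γ K) (densMeasure ψ))
    (hpos : 0 < sphAvg (m + 1) (hg.areaMap ψ)) (hψ' : ∀ v, 0 < hg.normMap ψ v)
    {μ : Measure (Sph (m + 1))} (hμ : IsAreaMeasure i (scale (hg.stepScale ψ * γ ^ i) (Φ K)) μ) :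
    μ = densMeasure (hg.normMap ψ) := by
  have hs : supp (scale (hg.stepScale ψ * γ ^ i) (Φ K)) = convT g (hg.stepScale ψ • ψ) := by
    funext x
    rw [← scale_scale, supp_scale (hg.stepScale_pos hpos).le,
      supp_scale_eq_convT hgen hdeg hγ hψ hK, convT_smul]
  have hd : ∀ u : Sph (m + 1),
      areaDens i (supp (scale (hg.stepScale ψ * γ ^ i) (Φ K))) u = hg.normMap ψ u := fun u => by
    rw [hs, ← hg.areaMap_stepScale_smul hi hpos, areaMap_apply]
  have hm : 1 ≤ m := hg.pos.trans_le hi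
  have h := hμ.eq_withDensity hm (by rw [hs]; exact hg.c2off _) fun u => by
    rw [hd]; exact hψ' u
  simpa only [hd] using h

/-- The scaling factors of the iterated bodies. -/
def iterScale (hg : IsRegKernel (m + 1) i g) (γ : ℝ) (ψ : C(Sph (m + 1), ℝ)) : ℕ → ℝ
  | 0 => γ
  | k + 1 => hg.stepScale (hg.normMap^[k] ψ) * iterScale hg γ ψ k ^ i

/-- A small density becomes attracted to the sphere. -/
theorem exists_attracted (hg : IsRegKernel (m + 1) i g) (hi : i ≤ m) :
    ∃ ε > (0 : ℝ), ∀ ψ : C(Sph (m + 1), ℝ), ‖ψ - 1‖ ≤ ε →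
      (∀ k, 0 < sphAvg (m + 1) (hg.areaMap (hg.normMap^[k] ψ))) ∧
      (∀ k v, 0 < hg.normMap^[k + 1] ψ v) ∧
      Tendsto (fun k => ‖hg.normMap^[k + 1] ψ - 1‖) atTop (𝓝 0) := by
  obtain ⟨δ, hδ, h⟩ := hg.exists_normMap_attracting hi
  refine ⟨min (1 / 2) (δ / 4), by positivity, fun ψ hψ => ?_⟩
  have hψ1 := hψ.trans (min_le_left _ _)
  have hψ2 := hψ.trans (min_le_right _ _)
  set c := sphAvg (m + 1) ψ with hc
  have hc1 : |c - 1| ≤ ‖ψ - 1‖ := by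
    have := abs_sphAvg_le (ψ - 1)
    rwa [map_sub, sphAvg_one m.succ_pos] at this
  have hc2 : 1 / 2 ≤ c := by linarith [neg_abs_le (c - 1)]
  have hc0 : 0 < c := by linarith
  set ψ' := c⁻¹ • ψ with hψ'
  have hψψ' : ψ = c • ψ' := by rw [hψ', smul_smul, mul_inv_cancel₀ hc0.ne', one_smul]
  have hnorm1 : ‖(1 : C(Sph (m + 1), ℝ))‖ ≤ 1 := by
    rw [ContinuousMap.norm_le _ zero_le_one]
    intro u
    simp
  have hclose : ‖ψ' - 1‖ ≤ δ := by
    have h1 : ψ' - 1 = c⁻¹ • ((ψ - 1) - (c - 1) • (1 : C(Sph (m + 1), ℝ))) := by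
      have : (1 : C(Sph (m + 1), ℝ)) = c⁻¹ • c • (1 : C(Sph (m + 1), ℝ)) := by
        rw [smul_smul, inv_mul_cancel₀ hc0.ne', one_smul]
      rw [hψ']
      nth_rewrite 1 [this]
      rw [← smul_sub]
      congr 1
      module
    rw [h1, norm_smul, norm_inv, Real.norm_of_nonneg hc0.le]
    calc c⁻¹ * _ ≤ 2 * (‖ψ - 1‖ + ‖ψ - 1‖ * 1) := by
          gcongr
          · rw [inv_le_comm₀ hc0 two_pos]; linarith
          · refine (norm_sub_le _ _).trans ?_
            rw [norm_smul, Real.norm_eq_abs]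
            gcongr
      _ ≤ δ := by linarith
  obtain ⟨H1, H2⟩ := h ψ' (by rw [hψ', map_smul, ← hc, smul_eq_mul, inv_mul_cancel₀ hc0.ne'])
    hclose
  have hit : ∀ k, hg.normMap^[k + 1] ψ = hg.normMap^[k + 1] ψ' := fun k => by
    rw [Function.iterate_succ_apply, Function.iterate_succ_apply, hψψ',
      hg.normMap_smul hi hc0.ne']
  refine ⟨fun k => ?_, fun k v => ?_, ?_⟩
  · rcases k with _ | k
    · have := (H1 0).1
      simp only [Function.iterate_zero, id] at this ⊢
      rw [hψψ', hg.areaMap_smul hi, map_smul, smul_eq_mul]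
      positivity
    · rw [hit]
      exact (H1 _).1
  · rw [hit]
    have h1 := ((hg.normMap^[k + 1] ψ') - 1).norm_coe_le_norm v
    have h2 := h1.trans (H1 (k + 1)).2
    rw [ContinuousMap.sub_apply, ContinuousMap.one_apply, Real.norm_eq_abs] at h2
    linarith [neg_abs_le ((hg.normMap^[k + 1] ψ') v - 1)]
  · simp only [hit]
    exact H2.comp (tendsto_add_atTop_nat 1)

theorem exists_tendsto_dTV (hg : IsRegKernel (m + 1) i g) (hi : i ≤ m)
    (hgen : GeneratedBy i Φ g) (hdeg : HasDegree i Φ) :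
    ∃ ε > (0 : ℝ), ∀ (K : ConvexBody (En (m + 1))) (γ : ℝ), 0 < γ →
      ∀ ψ : C(Sph (m + 1), ℝ), (∀ v, 0 ≤ ψ v) →
      IsAreaMeasure i (scale γ K) (densMeasure ψ) → ‖ψ - 1‖ ≤ ε →
      ∃ γs : ℕ → ℝ, (∀ k, 0 < γs k) ∧
        ∀ μ : ℕ → Measure (Sph (m + 1)),
          (∀ k, IsAreaMeasure i (scale (γs k) (Φ^[k] K)) (μ k)) →
          Tendsto (fun k => dTV (μ k) (sphVol (m + 1))) atTop (𝓝 0) := by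
  obtain ⟨ε, hε, h⟩ := hg.exists_attracted hi
  refine ⟨ε, hε, fun K γ hγ ψ hψ hK hψε => ?_⟩
  obtain ⟨hpos, hpos', hlim⟩ := h ψ hψε
  have hnn : ∀ k v, 0 ≤ hg.normMap^[k] ψ v := fun k v => by
    rcases k with _ | k
    · exact hψ v
    · exact (hpos' k v).le
  have hγs : ∀ k, 0 < hg.iterScale γ ψ k := fun k => by
    induction k with
    | zero => exact hγ
    | succ k ih => exact mul_pos (hg.stepScale_pos (hpos k)) (pow_pos ih i)
  refine ⟨hg.iterScale γ ψ, hγs, fun μ hμ => ?_⟩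
  have hstep : ∀ k, IsAreaMeasure i (scale (hg.iterScale γ ψ k) (Φ^[k] K))
      (densMeasure (hg.normMap^[k] ψ)) → μ (k + 1) = densMeasure (hg.normMap^[k + 1] ψ) := by
    intro k hk
    have hμk := hμ (k + 1)
    rw [Function.iterate_succ_apply'] at hμk
    rw [Function.iterate_succ_apply']
    refine hg.eq_densMeasure_normMap hi hgen hdeg (hγs k) (hnn k) hk (hpos k) (fun v => ?_) hμk
    rw [← Function.iterate_succ_apply' hg.normMap k ψ]
    exact hpos' k v
  have hall : ∀ k, IsAreaMeasure i (scale (hg.iterScale γ ψ k) (Φ^[k] K))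
      (densMeasure (hg.normMap^[k] ψ)) := fun k => by
    induction k with
    | zero => exact hK
    | succ k ih =>
      rw [← hstep k ih]
      exact hμ (k + 1)
  rw [← tendsto_add_atTop_iff_nat 1]
  refine squeeze_zero (fun k => dTV_nonneg _ _) (fun k => ?_)
    (by simpa using hlim.const_mul (sphMass (m + 1)))
  rw [hstep k (hall k)]
  exact dTV_densMeasure_le (hnn (k + 1))

end IsRegKernel

end

/-- **Theorem 4.1 (generalthm).** Under conditions (a), (b), (c) on the generating
body `L`, the area measures of the rescaled iterates converge in total variation
to spherical Lebesgue measure. -/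
theorem area_measures_of_iterates_converge
    (n i : ℕ) (hn : 3 ≤ n) (hi₁ : 2 ≤ i) (hi₂ : i ≤ n - 1)
    (Φ : ConvexBody (En n) → ConvexBody (En n))
    (hval : IsMinkowskiValuation Φ)
    (hcont : Continuous Φ)
    (htrans : TranslationInvariant Φ)
    (hdeg : HasDegree i Φ)
    (hrot : RotationEquivariant Φ)
    (L : ConvexBody (En n)) (g : ℝ → ℝ)
    (hLzonal : IsZonalBody L)
    (hprof : ∀ u : En n, ‖u‖ = 1 → supp L u = g ⟪u, pole n⟫_ℝ)
    (hgen : GeneratedBy i Φ g)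
    (hnorm : multSph 0 (supp L) = 1)
    (ha : ∀ f : En n → ℝ, ContinuousOn f (sphere (0 : En n) 1) →
      ContDiffOn ℝ 2 (Tg g f) {0}ᶜ)
    (hb : ∀ k : ℕ, 2 ≤ k →
      ((k : ℝ) - 1) * ((k : ℝ) + n - 1) * |multSph k (supp L)| < ((n : ℝ) - 1) / i)
    (hc : ∃ β > (0 : ℝ), ∀ α : ℝ, 0 ≤ α → ∃ C > (0 : ℝ), ∀ f : En n → ℝ, MemU α f →
      ∀ j l : Fin n, C * UNorm α f ∈ UBounds (α + β) (fun u => hessE (Tg g f) u j l)) :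
    ∃ ε > (0 : ℝ), ∀ (K : ConvexBody (En n)) (γ : ℝ), 0 < γ →
      ∀ s : Sph n → ℝ, Continuous s → (∀ v, 0 ≤ s v) →
      IsAreaMeasure i (scale γ K) ((sphVol n).withDensity fun v => ENNReal.ofReal (s v)) →
      (⨆ v : Sph n, |1 - s v|) < ε →
      ∃ γs : ℕ → ℝ, (∀ m, 0 < γs m) ∧
        ∀ μ : ℕ → Measure (Sph n),
          (∀ m, IsAreaMeasure i (scale (γs m) (Φ^[m] K)) (μ m)) →
          Tendsto (fun m => dTV (μ m) (sphVol n)) atTop (𝓝 0) := by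
  have hn2 : 2 ≤ n := by omega
  obtain ⟨g', hg'c, hgg'⟩ := exists_continuous_profile hn2 hprof
  have hTg : ∀ f : En n → ℝ, Tg g f = Tg g' f := fun f => by
    funext x
    by_cases hx : x = 0
    · simp [Tg, hx]
    · have hu : ‖‖x‖⁻¹ • x‖ = 1 := by
        rw [norm_smul, norm_inv, norm_norm, inv_mul_cancel₀ (norm_ne_zero_iff.2 hx)]
      rw [Tg, Tg]
      congr 1
      exact integral_congr_ae (Eventually.of_forall fun v => by
        simp only [hgg' _ (inner_mem_Icc hu (norm_sph v))])
  have hmult : ∀ k, kerMult n g' k = multSph k (supp L) := fun k => by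
    rw [kerMult, multSph_eq hn]
    refine integral_congr_ae (Eventually.of_forall fun v => ?_)
    simp only
    rw [hprof _ (norm_sph v), real_inner_comm (pole n) (v : En n),
      hgg' _ (inner_mem_Icc (norm_pole (by omega)) (norm_sph v))]
  have hgen' : GeneratedBy i Φ g' := fun K μ hμ u hu => by
    rw [hgen K μ hμ u hu]
    exact integral_congr_ae (Eventually.of_forall fun v => hgg' _ (inner_mem_Icc hu (norm_sph v)))
  have hg : IsRegKernel n i g' :=
    { three_le := hn
      pos := by omega
      cont := hg'c
      c2 := fun f hf => hTg f ▸ ha f hf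
      mult_zero := (hmult 0).trans hnorm
      mult_lt := fun k hk => by rw [hmult]; exact hb k hk
      hess_mem := by simpa only [hTg] using hc }
  obtain ⟨m, rfl⟩ : ∃ m, n = m + 1 := ⟨n - 1, by omega⟩
  obtain ⟨ε, hε, H⟩ := hg.exists_tendsto_dTV hi₂ hgen' hdeg
  refine ⟨ε, hε, fun K γ hγ s hs hs0 hK hsε => H K γ hγ ⟨s, hs⟩ hs0 hK ?_⟩
  rw [ContinuousMap.norm_le _ hε.le]
  intro v
  have hbdd : BddAbove (Set.range fun v : Sph (m + 1) => |1 - s v|) :=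
    (isCompact_range (by fun_prop)).bddAbove
  calc ‖s v - 1‖ = |1 - s v| := by rw [Real.norm_eq_abs, abs_sub_comm]
    _ ≤ ε := (le_ciSup hbdd v).trans hsε.le

end MinkIter
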